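/- arXiv:2309.02806 — 2 statements merged into one kernel-verified Lean document; each statement's English description precedes it below -/
import Mathlib

section
/- Assume the cost is c(x,y) = k(y−x) with k satisfying (H1), (H2) and (H3). Then for every m > 0 the supremum defining ℰ_set(m) := sup{Υ_set(E) : E ⊂ ℝ^d Lebesgue measurable, |E| = m} is attained by some measurable set E, and ℰ_set(m) = ℰ(m). -/
open MeasureTheory ENNReal Filter Set

noncomputable section

/-- Euclidean space `ℝ^d`. -/
abbrev Rd (d : ℕ) : Type := EuclideanSpace ℝ (Fin d)

/-- The measure `f · Leb` on `ℝ^d`. -/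
def fMeas {d : ℕ} (f : Rd d → ℝ) : Measure (Rd d) :=
  MeasureTheory.volume.withDensity fun x => ENNReal.ofReal (f x)

/-- The set `Π_f` of admissible exterior transport plans: first marginal `f · Leb`,
second marginal `≤ (1 - f) · Leb`. -/
def ExtPlans {d : ℕ} (f : Rd d → ℝ) : Set (Measure (Rd d × Rd d)) :=
  {γ | γ.map Prod.fst = fMeas f ∧ γ.map Prod.snd ≤ fMeas fun x => 1 - f x}

/-- The transport cost `∫ c dγ` of a plan `γ`. -/
def planCost {d : ℕ} (c : Rd d → Rd d → ℝ) (γ : Measure (Rd d × Rd d)) : ℝ≥0∞ :=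
  ∫⁻ p, ENNReal.ofReal (c p.1 p.2) ∂γ

/-- The functional `Υ(f) = inf { ∫ c dγ : γ ∈ Π_f }`. -/
def Ups {d : ℕ} (c : Rd d → Rd d → ℝ) (f : Rd d → ℝ) : ℝ≥0∞ :=
  ⨅ γ ∈ ExtPlans f, planCost c γ

/-- `f ∈ L¹(ℝ^d, [0,1])`. -/
def InUnit {d : ℕ} (f : Rd d → ℝ) : Prop :=
  Integrable f MeasureTheory.volume ∧ ∀ x, 0 ≤ f x ∧ f x ≤ 1

/-- `f ∈ L¹_m`: in `L¹(ℝ^d,[0,1])` with `∫ f ≤ m`. -/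
def MemL1m {d : ℕ} (m : ℝ) (f : Rd d → ℝ) : Prop := InUnit f ∧ (∫ x, f x) ≤ m

/-- The energy `ℰ(m) = sup { Υ(f) : f ∈ L¹(ℝ^d,[0,1]), ∫ f = m }`. -/
def Energy {d : ℕ} (c : Rd d → Rd d → ℝ) (m : ℝ) : ℝ≥0∞ :=
  ⨆ f ∈ {f : Rd d → ℝ | InUnit f ∧ (∫ x, f x) = m}, Ups c f

/-- Hypothesis (H1): `k` continuous, `k 0 = 0`, `k → ∞` at infinity. -/
def H1 {d : ℕ} (k : Rd d → ℝ) : Prop :=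
  Continuous k ∧ k 0 = 0 ∧ Tendsto k (Bornology.cobounded (Rd d)) atTop

/-- Hypothesis (H2). -/
def H2 {d : ℕ} (k : Rd d → ℝ) : Prop :=
  ∀ x : Rd d, x ≠ 0 →
    0 < Filter.limsup
      (fun r : ℝ =>
        MeasureTheory.volume (Metric.ball x r ∩ {y | k y < k x}) / ENNReal.ofReal (r ^ d))
      (nhdsWithin 0 (Set.Ioi 0))

/-- Hypothesis (H3): `r ↦ k (r σ)` increasing on `[0, ∞)` for every unit direction `σ`. -/
def H3 {d : ℕ} (k : Rd d → ℝ) : Prop :=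
  ∀ σ : Rd d, ‖σ‖ = 1 → StrictMonoOn (fun r : ℝ => k (r • σ)) (Set.Ici 0)

/-- Translation-invariant cost `c(x,y) = k(y - x)`. -/
def transCost {d : ℕ} (k : Rd d → ℝ) : Rd d → Rd d → ℝ := fun x y => k (y - x)

/-- The support of a measure: points all of whose open neighbourhoods have positive measure. -/
def msupport {α : Type*} [TopologicalSpace α] [MeasurableSpace α] (μ : Measure α) : Set α :=
  {x | ∀ U : Set α, IsOpen U → x ∈ U → 0 < μ U}

/-- Couplings of two measures on `ℝ^d`. -/
def Couplings {d : ℕ} (μ ν : Measure (Rd d)) : Set (Measure (Rd d × Rd d)) :=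
  {γ | γ.map Prod.fst = μ ∧ γ.map Prod.snd = ν}

/-- The optimal transport cost `𝒯_c(μ, ν)`. -/
def Tcost {d : ℕ} (c : Rd d → Rd d → ℝ) (μ ν : Measure (Rd d)) : ℝ≥0∞ :=
  ⨅ γ ∈ Couplings μ ν, planCost c γ

/-- `Υ_set(E) = inf { 𝒯_c(χ_E, χ_F) : F measurable, |F| = |E|, |F ∩ E| = 0 }`. -/
def UpsSet {d : ℕ} (c : Rd d → Rd d → ℝ) (E : Set (Rd d)) : ℝ≥0∞ :=
  ⨅ F ∈ {F : Set (Rd d) | MeasurableSet F ∧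
      MeasureTheory.volume F = MeasureTheory.volume E ∧ MeasureTheory.volume (F ∩ E) = 0},
    Tcost c (MeasureTheory.volume.restrict E) (MeasureTheory.volume.restrict F)

/-- `ℰ_set(m) = sup { Υ_set(E) : E measurable, |E| = m }`. -/
def EnergySet {d : ℕ} (c : Rd d → Rd d → ℝ) (m : ℝ) : ℝ≥0∞ :=
  ⨆ E ∈ {E : Set (Rd d) | MeasurableSet E ∧ MeasureTheory.volume E = ENNReal.ofReal m},
    UpsSet c E

theorem exists_relay {ι X Y : Type*} [Countable ι] [MeasurableSpace X] [MeasurableSpace Y]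
    (q : Y → ι) (hq : ∀ n, MeasurableSet (q ⁻¹' {n})) (π : Measure (X × Y)) [IsFiniteMeasure π]
    (b : Measure Y) (hb : ∀ n, b (q ⁻¹' {n}) ≠ ∞)
    (h : ∀ n, π (Prod.snd ⁻¹' (q ⁻¹' {n})) ≤ b (q ⁻¹' {n})) :
    ∃ π' : Measure (X × Y), π'.map Prod.fst = π.map Prod.fst ∧ π'.map Prod.snd ≤ b ∧
      ∀ c c0 : X × Y → ℝ≥0∞, Measurable c →
        (∀ p y, q y = q p.2 → c (p.1, y) ≤ c0 p) → ∫⁻ p, c p ∂π' ≤ ∫⁻ p, c0 p ∂π := by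
  set C : ι → Set Y := fun n => q ⁻¹' {n} with hC
  set P : ι → Set (X × Y) := fun n => Prod.snd ⁻¹' (C n) with hP
  have hPm : ∀ n, MeasurableSet (P n) := fun n => measurable_snd (hq n)
  set κ : ι → Measure Y := fun n => (b (C n))⁻¹ • b.restrict (C n) with hκ
  have hκ1 : ∀ n, κ n univ ≤ 1 := by
    intro n
    simp only [hκ, Measure.smul_apply, Measure.restrict_apply MeasurableSet.univ, univ_inter,
      smul_eq_mul]
    exact ENNReal.inv_mul_le_one _
  have hκf : ∀ n, IsFiniteMeasure (κ n) := fun n => ⟨(hκ1 n).trans_lt ENNReal.one_lt_top⟩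
  have hzero : ∀ n, b (C n) = 0 → π.restrict (P n) = 0 := by
    intro n hn
    rw [Measure.restrict_eq_zero]
    exact le_antisymm ((h n).trans hn.le) bot_le
  have hsumπ : Measure.sum (fun n => π.restrict (P n)) = π := by
    rw [← Measure.restrict_iUnion _ hPm, iUnion_eq_univ_iff.2, Measure.restrict_univ]
    · intro p; exact ⟨q p.2, rfl⟩
    · intro i j hij
      refine Disjoint.preimage _ ?_
      exact Disjoint.preimage _ (by simpa using hij)
  have hsumb : Measure.sum (fun n => b.restrict (C n)) = b := by
    rw [← Measure.restrict_iUnion _ hq, iUnion_eq_univ_iff.2, Measure.restrict_univ]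
    · intro p; exact ⟨q p, rfl⟩
    · intro i j hij
      exact Disjoint.preimage _ (by simpa using hij)
  refine ⟨Measure.sum fun n => ((π.restrict (P n)).map Prod.fst).prod (κ n), ?_, ?_, ?_⟩
  · conv_rhs => rw [← hsumπ]
    ext A hA
    rw [Measure.map_apply measurable_fst hA, Measure.sum_apply _ (measurable_fst hA),
      Measure.map_apply measurable_fst hA, Measure.sum_apply _ (measurable_fst hA)]
    congr 1
    ext n
    rw [← Measure.map_apply measurable_fst hA, Measure.map_fst_prod]
    rcases eq_or_ne (b (C n)) 0 with h0 | h0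
    · simp [hzero n h0]
    · have : κ n univ = 1 := by
        simp only [hκ, Measure.smul_apply, Measure.restrict_apply MeasurableSet.univ, univ_inter,
          smul_eq_mul]
        exact ENNReal.inv_mul_cancel h0 (hb n)
      rw [this, one_smul, Measure.map_apply measurable_fst hA]
  · rw [Measure.le_iff]
    intro A hA
    conv_rhs => rw [← hsumb]
    rw [Measure.map_apply measurable_snd hA, Measure.sum_apply _ (measurable_snd hA),
      Measure.sum_apply _ hA]
    refine ENNReal.tsum_le_tsum fun n => ?_
    rw [← Measure.map_apply measurable_snd hA, Measure.map_snd_prod,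
      Measure.map_apply measurable_fst MeasurableSet.univ, preimage_univ,
      Measure.restrict_apply MeasurableSet.univ, univ_inter]
    simp only [hκ, Measure.smul_apply, smul_eq_mul, ← mul_assoc]
    calc _ ≤ 1 * (b.restrict (C n)) A := by
          gcongr
          calc _ ≤ b (C n) * (b (C n))⁻¹ := by gcongr; exact h n
            _ ≤ 1 := ENNReal.mul_inv_le_one _
      _ = _ := one_mul _
  · intro c c0 hc hcc
    rw [lintegral_sum_measure]
    conv_rhs => rw [← hsumπ, lintegral_sum_measure]
    refine ENNReal.tsum_le_tsum fun n => ?_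
    rw [lintegral_prod _ hc.aemeasurable, lintegral_map hc.lintegral_prod_right' measurable_fst]
    refine lintegral_mono_ae ?_
    filter_upwards [ae_restrict_mem (hPm n)] with p hp
    calc ∫⁻ y, c (p.1, y) ∂κ n ≤ ∫⁻ _, c0 p ∂κ n := by
          refine lintegral_mono_ae ?_
          refine Measure.ae_smul_measure ?_ _
          filter_upwards [ae_restrict_mem (hq n)] with y hy
          refine hcc p y ?_
          have h1 : q y = n := hy
          have h2 : q p.2 = n := hp
          rw [h1, h2]
      _ ≤ c0 p := by
          rw [lintegral_const]
          calc _ ≤ c0 p * 1 := by gcongr; exact hκ1 n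
            _ = _ := mul_one _

theorem exists_grid (d : ℕ) {s : ℝ} (hs : 0 < s) :
    ∃ q : Rd d → (Fin d → ℤ), (∀ n, MeasurableSet (q ⁻¹' {n})) ∧
      (∀ n, volume (q ⁻¹' {n}) = ENNReal.ofReal (s ^ d)) ∧
      (∀ x y, q x = q y → ‖x - y‖ ≤ s * d) ∧
      ∀ R, (q '' Metric.closedBall 0 R).Finite := by
  refine ⟨fun x i => ⌊x i / s⌋, ?_, ?_, ?_, ?_⟩
  · intro n
    have : Measurable (fun (x : Rd d) (i : Fin d) => ⌊x i / s⌋) := by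
      refine measurable_pi_lambda _ fun i => Int.measurable_floor.comp ?_
      fun_prop
    exact this (measurableSet_singleton n)
  · intro n
    have : (fun (x : Rd d) (i : Fin d) => ⌊x i / s⌋) ⁻¹' {n} =
        WithLp.ofLp ⁻¹' (univ.pi fun i => Ico (s * n i) (s * n i + s)) := by
      ext x
      simp only [mem_preimage, mem_singleton_iff, funext_iff, Int.floor_eq_iff, Set.mem_pi,
          mem_univ,
        true_imp_iff, mem_Ico]
      refine forall_congr' fun i => ?_
      rw [le_div_iff₀ hs, div_lt_iff₀ hs]
      constructor <;> rintro ⟨h1, h2⟩ <;> constructor <;> linarith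
    rw [this, (PiLp.volume_preserving_ofLp (Fin d)).measure_preimage
      (MeasurableSet.univ_pi fun i => measurableSet_Ico).nullMeasurableSet, Real.volume_pi_Ico]
    simp [ENNReal.ofReal_pow hs.le]
  · intro x y hxy
    have hi : ∀ i, ((x - y) i) ^ 2 ≤ s ^ 2 := by
      intro i
      have h1 : |x i / s - y i / s| < 1 := Int.abs_sub_lt_one_of_floor_eq_floor (congrFun hxy i)
      rw [← sub_div, abs_div, abs_of_pos hs, div_lt_one hs] at h1
      rw [← sq_abs, PiLp.sub_apply]
      gcongr
    rw [EuclideanSpace.norm_eq]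
    refine Real.sqrt_le_iff.2 ⟨by positivity, ?_⟩
    calc ∑ i, ‖(x - y) i‖ ^ 2 ≤ ∑ i : Fin d, s ^ 2 := by
          refine Finset.sum_le_sum fun i _ => ?_
          rw [Real.norm_eq_abs, sq_abs]; exact hi i
      _ = d * s ^ 2 := by simp
      _ ≤ (d * d) * s ^ 2 := by
          gcongr
          exact_mod_cast Nat.le_mul_self d
      _ = _ := by ring
  · intro R
    refine (Set.finite_Icc (fun _ : Fin d => ⌊-R / s⌋) (fun _ => ⌊R / s⌋)).subset ?_
    rintro _ ⟨x, hx, rfl⟩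
    have hxi : ∀ i, |x i| ≤ R := fun i =>
      (PiLp.norm_apply_le x i).trans (by simpa using hx)
    refine ⟨fun i => Int.floor_le_floor ?_, fun i => Int.floor_le_floor ?_⟩
    · have := (abs_le.1 (hxi i)).1
      gcongr
    · have := (abs_le.1 (hxi i)).2
      gcongr

/-- The cost `∫ c(y - x) dγ` of a plan for an extended displacement cost. -/
def dispCost {d : ℕ} (c : Rd d → ℝ≥0∞) (γ : Measure (Rd d × Rd d)) : ℝ≥0∞ :=
  ∫⁻ p, c (p.2 - p.1) ∂γ

/-- The exterior transport cost of a measure `μ`: target measures `ν` satisfy `μ + ν ≤ Leb`. -/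
def extCost {d : ℕ} (c : Rd d → ℝ≥0∞) (μ : Measure (Rd d)) : ℝ≥0∞ :=
  ⨅ γ ∈ {γ : Measure (Rd d × Rd d) | γ.map Prod.fst = μ ∧ μ + γ.map Prod.snd ≤ volume},
    dispCost c γ

/-- The cost `k`, made infinite for displacements longer than `R`. -/
def truncCost {d : ℕ} (k : Rd d → ℝ) (R : ℝ) (v : Rd d) : ℝ≥0∞ :=
  open Classical in if ‖v‖ ≤ R then ENNReal.ofReal (k v) else ⊤

theorem extCost_le {d : ℕ} (c : Rd d → ℝ≥0∞) {μ : Measure (Rd d)} {γ : Measure (Rd d × Rd d)}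
    (h1 : γ.map Prod.fst = μ) (h2 : μ + γ.map Prod.snd ≤ volume) : extCost c μ ≤ dispCost c γ :=
  iInf₂_le γ ⟨h1, h2⟩

theorem le_extCost {d : ℕ} {c : Rd d → ℝ≥0∞} {μ : Measure (Rd d)} {a : ℝ≥0∞}
    (h : ∀ γ : Measure (Rd d × Rd d), γ.map Prod.fst = μ → μ + γ.map Prod.snd ≤ volume →
      a ≤ dispCost c γ) : a ≤ extCost c μ :=
  le_iInf₂ fun γ hγ => h γ hγ.1 hγ.2

theorem exists_plan_lt {d : ℕ} {c : Rd d → ℝ≥0∞} {μ : Measure (Rd d)} {a : ℝ≥0∞}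
    (h : extCost c μ < a) : ∃ γ : Measure (Rd d × Rd d), γ.map Prod.fst = μ ∧
      μ + γ.map Prod.snd ≤ volume ∧ dispCost c γ < a := by
  simp only [extCost, iInf_lt_iff] at h
  obtain ⟨γ, hγ, h⟩ := h
  exact ⟨γ, hγ.1, hγ.2, h⟩

theorem measurable_truncCost {d : ℕ} {k : Rd d → ℝ} (hk : Continuous k) (R : ℝ) :
    Measurable (truncCost k R) := by
  classical
  unfold truncCost
  refine Measurable.ite ?_ (by fun_prop) measurable_const
  exact (isClosed_le continuous_norm continuous_const).measurableSet

theorem ofReal_le_truncCost {d : ℕ} (k : Rd d → ℝ) (R : ℝ) (v : Rd d) :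
    ENNReal.ofReal (k v) ≤ truncCost k R v := by
  unfold truncCost; split_ifs <;> simp

theorem exists_truncCost_add_le {d : ℕ} {k : Rd d → ℝ} (hk : Continuous k) (hpos : ∀ x, 0 ≤ k x)
    (R : ℝ) {ε : ℝ} (hε : 0 < ε) :
    ∃ η, 0 < η ∧ η ≤ 1 ∧ ∀ v z : Rd d, ‖z‖ ≤ η →
      truncCost k (R + 1) (v + z) ≤ truncCost k R v + ENNReal.ofReal ε := by
  have huc := (isCompact_closedBall (0 : Rd d) (R + 1)).uniformContinuousOn_of_continuous
    hk.continuousOn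
  obtain ⟨η, hη, h⟩ := Metric.uniformContinuousOn_iff.1 huc ε hε
  refine ⟨min (η / 2) 1, by positivity, min_le_right _ _, fun v z hz => ?_⟩
  unfold truncCost
  by_cases hv : ‖v‖ ≤ R
  · have hvz : ‖v + z‖ ≤ R + 1 :=
      (norm_add_le _ _).trans (add_le_add hv (hz.trans (min_le_right _ _)))
    rw [if_pos hv, if_pos hvz, ← ENNReal.ofReal_add (hpos _) hε.le]
    refine ENNReal.ofReal_le_ofReal ?_
    have := h (v + z) (by simpa using hvz) v (by simp; linarith) (by
      rw [dist_eq_norm, add_sub_cancel_left]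
      linarith [hz.trans (min_le_left (η / 2) 1)])
    rw [Real.dist_eq] at this
    linarith [(abs_lt.1 this).2]
  · simp [hv]

theorem measure_univ_eq_of_map_fst {d : ℕ} (γ : Measure (Rd d × Rd d)) :
    γ.map Prod.fst univ = γ univ := by
  rw [Measure.map_apply measurable_fst MeasurableSet.univ, preimage_univ]

theorem measure_univ_eq_of_map_snd {d : ℕ} (γ : Measure (Rd d × Rd d)) :
    γ.map Prod.snd univ = γ univ := by
  rw [Measure.map_apply measurable_snd MeasurableSet.univ, preimage_univ]

theorem extCost_le_of_partial {d : ℕ} {c : Rd d → ℝ≥0∞} (hc : Measurable c) {M C : ℝ≥0∞} {s : ℝ}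
    (hs : 0 < s) (hM : 2 * M ≤ ENNReal.ofReal (s ^ d)) (hC : ∀ v, ‖v‖ ≤ s * d → c v ≤ C)
    {μ : Measure (Rd d)} (hμM : μ univ ≤ M) {γ : Measure (Rd d × Rd d)} {h : Measure (Rd d)}
    (hγ : γ.map Prod.fst + h = μ) (hv : μ + γ.map Prod.snd ≤ volume) :
    extCost c μ ≤ dispCost c γ + C * h univ := by
  classical
  obtain ⟨q, hq, hvol, hdiam, -⟩ := exists_grid d hs
  have hMtop : M < ∞ := by
    have : 2 * M < ∞ := hM.trans_lt ENNReal.ofReal_lt_top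
    by_contra hcon
    have : M = ∞ := by simpa using hcon
    simp [this] at *
  have hmass : γ univ + h univ = μ univ := by
    rw [← hγ, Measure.add_apply, measure_univ_eq_of_map_fst]
  have hμfin : IsFiniteMeasure μ := ⟨hμM.trans_lt hMtop⟩
  have hγfin : IsFiniteMeasure γ := ⟨by
    calc _ ≤ μ univ := by rw [← hmass]; exact le_self_add
      _ < _ := measure_lt_top _ _⟩
  have hhfin : IsFiniteMeasure h := ⟨by
    calc _ ≤ μ univ := by rw [← hmass]; exact le_add_self
      _ < _ := measure_lt_top _ _⟩
  set b := volume - (μ + γ.map Prod.snd) with hb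
  have hbv : b + (μ + γ.map Prod.snd) = volume := Measure.sub_add_cancel_of_le hv
  have hdiag : Measurable (fun x : Rd d => (x, x)) := by fun_prop
  set π := h.map (fun x : Rd d => (x, x)) with hπ
  have hble : b ≤ volume := by rw [← hbv]; exact Measure.le_add_right le_rfl
  obtain ⟨π', hf, hs', hcost⟩ := exists_relay q hq π b
    (fun n => ((hble _).trans_lt (by rw [hvol]; exact ENNReal.ofReal_lt_top)).ne) (by
      intro n
      rw [hπ, Measure.map_apply hdiag (measurable_snd (hq n))]
      have h1 : b (q ⁻¹' {n}) + (μ (q ⁻¹' {n}) + γ.map Prod.snd (q ⁻¹' {n})) =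
          ENNReal.ofReal (s ^ d) := by
        rw [← hvol n]; conv_rhs => rw [← hbv]
        simp
      have h2 : h (q ⁻¹' {n}) + (μ (q ⁻¹' {n}) + γ.map Prod.snd (q ⁻¹' {n})) ≤
          ENNReal.ofReal (s ^ d) := by
        calc _ ≤ h univ + (μ univ + γ.map Prod.snd univ) := by
              gcongr <;> exact subset_univ _
          _ = μ univ + μ univ := by
              rw [measure_univ_eq_of_map_snd, ← hmass]; ring
          _ ≤ 2 * M := by rw [two_mul]; gcongr
          _ ≤ _ := hM
      rw [← h1] at h2
      exact (ENNReal.add_le_add_iff_right (measure_lt_top (μ + γ.map Prod.snd) _).ne).1 h2)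
  have hcm : Measurable fun p : Rd d × Rd d => c (p.2 - p.1) := by fun_prop
  have hπcost : dispCost c π' ≤ C * h univ := by
    refine (hcost _ (fun p => if p.1 = p.2 then C else ⊤) hcm ?_).trans_eq ?_
    · rintro ⟨x, y'⟩ y hy
      dsimp only
      split_ifs with hxy
      · refine hC _ (hdiam _ _ ?_)
        rw [hy]; dsimp only at hxy ⊢; rw [hxy]
      · exact le_top
    · rw [hπ, lintegral_map (Measurable.ite measurableSet_diagonal measurable_const
        measurable_const) hdiag]
      simp
  have hff : (γ + π').map Prod.fst = μ := by
    rw [Measure.map_add _ _ measurable_fst, hf, hπ, Measure.map_map measurable_fst hdiag]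
    have : (Prod.fst ∘ fun x : Rd d => (x, x)) = id := rfl
    rw [this, Measure.map_id, hγ]
  refine (extCost_le c hff ?_).trans ?_
  · rw [Measure.map_add _ _ measurable_snd, ← add_assoc, add_comm]
    conv_rhs => rw [← hbv]
    gcongr
  · unfold dispCost at *
    rw [lintegral_add_measure]
    gcongr

/-- The cost `k` as an extended nonnegative function of the displacement. -/
abbrev ecost {d : ℕ} (k : Rd d → ℝ) (v : Rd d) : ℝ≥0∞ := ENNReal.ofReal (k v)

theorem exists_trunc {d : ℕ} (hd : 1 ≤ d) {k : Rd d → ℝ} (h1 : H1 k) {m : ℝ}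
    (hm : 0 < m) :
    ∃ R K : ℝ, 0 < R ∧ 0 < K ∧
      (∀ μ : Measure (Rd d), μ univ ≤ ENNReal.ofReal m →
        extCost (truncCost k R) μ ≤ extCost (ecost k) μ) ∧
      (∀ (μ : Measure (Rd d)) (γ : Measure (Rd d × Rd d)) (h : Measure (Rd d)),
        μ univ ≤ ENNReal.ofReal m → γ.map Prod.fst + h = μ → μ + γ.map Prod.snd ≤ volume →
        extCost (ecost k) μ ≤ dispCost (ecost k) γ + ENNReal.ofReal K * h univ) := by
  classical
  obtain ⟨hk, -, hinf⟩ := h1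
  set s : ℝ := (2 * m) ^ ((d : ℝ)⁻¹) with hs
  have hs0 : 0 < s := by positivity
  have hsd : s ^ d = 2 * m := Real.rpow_inv_natCast_pow (by positivity) (by omega)
  have hM : 2 * ENNReal.ofReal m ≤ ENNReal.ofReal (s ^ d) := by
    rw [hsd, ENNReal.ofReal_mul (by norm_num)]; simp
  obtain ⟨K, hK⟩ := (isCompact_closedBall (0 : Rd d) (s * d)).bddAbove_image hk.continuousOn
  have hK' : ∀ v : Rd d, ‖v‖ ≤ s * d → k v ≤ K := fun v hv =>
    hK (mem_image_of_mem k (by simpa using hv))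
  obtain ⟨R, hR⟩ : ∃ R : ℝ, ∀ v : Rd d, R < ‖v‖ → max K 1 ≤ k v := by
    have := (hinf.eventually (eventually_ge_atTop (max K 1)))
    rw [← comap_norm_atTop, eventually_comap] at this
    obtain ⟨R, hR⟩ := eventually_atTop.1 this
    exact ⟨R, fun v hv => hR _ hv.le v rfl⟩
  refine ⟨max R (max (s * d) 1), max K 1, by positivity, by positivity, ?_, ?_⟩
  · intro μ hμ
    refine le_extCost fun γ hγ1 hγ2 => ?_
    set R' := max R (max (s * d) 1)
    set A : Set (Rd d × Rd d) := {p | ‖p.2 - p.1‖ ≤ R'} with hA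
    have hAm : MeasurableSet A := (isClosed_le (by fun_prop) continuous_const).measurableSet
    have hsplit : γ.restrict A + γ.restrict Aᶜ = γ := Measure.restrict_add_restrict_compl hAm
    have := extCost_le_of_partial (measurable_truncCost hk R')
        (C := ENNReal.ofReal (max K 1)) hs0 hM
      (by
        intro v hv
        unfold truncCost
        rw [if_pos (hv.trans ((le_max_left _ _).trans (le_max_right _ _)))]
        exact ENNReal.ofReal_le_ofReal ((hK' v hv).trans (le_max_left _ _))) hμ
      (γ := γ.restrict A) (h := (γ.restrict Aᶜ).map Prod.fst)
      (by rw [← Measure.map_add _ _ measurable_fst, hsplit, hγ1])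
      (by
        refine le_trans ?_ hγ2
        exact add_le_add le_rfl (Measure.map_mono Measure.restrict_le_self measurable_snd))
    refine this.trans ?_
    rw [measure_univ_eq_of_map_fst]
    unfold dispCost
    conv_rhs => rw [← lintegral_add_compl _ hAm]
    refine add_le_add ?_ ?_
    · refine setLIntegral_mono' hAm fun p hp => ?_
      have hp' : ‖p.2 - p.1‖ ≤ R' := hp
      unfold truncCost
      rw [if_pos hp']
    · rw [← lintegral_const]
      refine setLIntegral_mono' hAm.compl fun p hp => ?_
      refine ENNReal.ofReal_le_ofReal (hR _ ?_)
      exact (le_max_left _ _).trans_lt (not_le.1 hp)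
  · intro μ γ h hμ hγ1 hγ2
    exact extCost_le_of_partial (by fun_prop) hs0 hM
      (fun v hv => ENNReal.ofReal_le_ofReal ((hK' v hv).trans (le_max_left _ _))) hμ hγ1 hγ2

theorem exists_small_mass {d : ℕ} {k : Rd d → ℝ} (hk : Continuous k) (hk0 : k 0 = 0)
    {ε : ℝ} (hε : 0 < ε) :
    ∃ c : ℝ, 0 < c ∧ ∀ μ : Measure (Rd d), μ ≤ volume → μ univ ≤ ENNReal.ofReal c →
      extCost (ecost k) μ ≤ ENNReal.ofReal ε * μ univ := by
  obtain ⟨η, hη, h⟩ := Metric.continuous_iff.1 hk 0 ε hε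
  set s := η / (d + 1) with hs
  have hs0 : 0 < s := by positivity
  have hsd : s * d < η := by
    rw [hs, div_mul_eq_mul_div, div_lt_iff₀ (by positivity)]
    nlinarith
  refine ⟨s ^ d / 2, by positivity, fun μ hμ hμc => ?_⟩
  have := extCost_le_of_partial (c := ecost k) (by fun_prop) (C := ENNReal.ofReal ε)
    (M := ENNReal.ofReal (s ^ d / 2)) hs0 (by
      rw [← ENNReal.ofReal_ofNat, ← ENNReal.ofReal_mul (by norm_num)]
      exact ENNReal.ofReal_le_ofReal (by linarith)) (by
      intro v hv
      refine ENNReal.ofReal_le_ofReal ?_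
      have := h v (by rw [dist_zero_right]; linarith)
      rw [hk0, dist_zero_right] at this
      exact (le_abs_self _).trans this.le) hμc (γ := 0) (h := μ) (by simp) (by simpa using hμ)
  simpa [dispCost] using this

theorem ae_norm_le_of_dispCost {d : ℕ} {k : Rd d → ℝ} (hk : Continuous k) {R : ℝ}
    {γ : Measure (Rd d × Rd d)} (hγ : dispCost (truncCost k R) γ ≠ ⊤) :
    ∀ᵐ p ∂γ, ‖p.2 - p.1‖ ≤ R := by
  have hm : Measurable fun p : Rd d × Rd d => truncCost k R (p.2 - p.1) :=
    (measurable_truncCost hk R).comp (by fun_prop)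
  filter_upwards [ae_lt_top hm hγ] with p hp
  by_contra hcon
  unfold truncCost at hp
  rw [if_neg hcon] at hp
  exact lt_irrefl _ hp

theorem extCost_add_le_of_gap {d : ℕ} {k : Rd d → ℝ} (hk : Continuous k) {R : ℝ}
    {μa μb : Measure (Rd d)} {Z : Set (Rd d)} (hZ : MeasurableSet Z) (hR : 0 ≤ R)
    (ha : ∀ᵐ x ∂μa, ∀ y, ‖y - x‖ ≤ R → y ∈ Z) (hb : ∀ᵐ x ∂μb, ∀ y, ‖y - x‖ ≤ R → y ∉ Z) :
    extCost (truncCost k R) (μa + μb) ≤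
      extCost (truncCost k R) μa + extCost (truncCost k R) μb := by
  simp only [extCost.eq_1 _ μa, extCost.eq_1 _ μb, ENNReal.iInf_add, ENNReal.add_iInf]
  refine le_iInf₂ fun γb hγb => le_iInf₂ fun γa hγa => ?_
  rcases eq_or_ne (dispCost (truncCost k R) γa) ⊤ with hta | hta
  · simp [hta]
  rcases eq_or_ne (dispCost (truncCost k R) γb) ⊤ with htb | htb
  · simp [htb]
  have hμa : μa Zᶜ = 0 := by
    rw [← compl_mem_ae_iff, compl_compl]
    filter_upwards [ha] with x hx
    exact hx x (by simpa using hR)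
  have hμb : μb Z = 0 := by
    rw [← compl_mem_ae_iff]
    filter_upwards [hb] with x hx
    exact hx x (by simpa using hR)
  have hga : γa.map Prod.snd Zᶜ = 0 := by
    rw [Measure.map_apply measurable_snd hZ.compl, ← compl_mem_ae_iff]
    have h1 := ae_of_ae_map measurable_fst.aemeasurable (hγa.1 ▸ ha)
    filter_upwards [h1, ae_norm_le_of_dispCost hk hta] with p hp hp2
    simpa using hp _ hp2
  have hgb : γb.map Prod.snd Z = 0 := by
    rw [Measure.map_apply measurable_snd hZ, ← compl_mem_ae_iff]
    have h1 := ae_of_ae_map measurable_fst.aemeasurable (hγb.1 ▸ hb)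
    filter_upwards [h1, ae_norm_le_of_dispCost hk htb] with p hp hp2
    exact hp _ hp2
  refine (extCost_le (γ := γa + γb) _ (by
    rw [Measure.map_add _ _ measurable_fst, hγa.1, hγb.1]) ?_).trans_eq ?_
  · rw [Measure.map_add _ _ measurable_snd, Measure.le_iff]
    intro E hE
    have e1 := hγa.2 (E ∩ Z)
    have e2 := hγb.2 (E \ Z)
    simp only [Measure.add_apply] at e1 e2 ⊢
    rw [← measure_inter_add_sdiff E hZ (μ := volume), ← measure_inter_add_sdiff E hZ (μ := μa),
      ← measure_inter_add_sdiff E hZ (μ := μb),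
      ← measure_inter_add_sdiff E hZ (μ := γa.map Prod.snd),
      ← measure_inter_add_sdiff E hZ (μ := γb.map Prod.snd)]
    rw [measure_mono_null (sdiff_subset_compl E Z) hμa, measure_mono_null inter_subset_right hμb,
      measure_mono_null (sdiff_subset_compl E Z) hga, measure_mono_null inter_subset_right hgb]
    calc _ = (μa (E ∩ Z) + γa.map Prod.snd (E ∩ Z)) + (μb (E \ Z) + γb.map Prod.snd (E \ Z)) := by
          ring
      _ ≤ _ := add_le_add e1 e2
  · unfold dispCost; rw [lintegral_add_measure]

theorem map_snd_withDensity {X Y : Type*} [MeasurableSpace X] [MeasurableSpace Y]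
    (γ : Measure (X × Y)) {w : Y → ℝ≥0∞} (hw : Measurable w) :
    (γ.withDensity fun p => w p.2).map Prod.snd = (γ.map Prod.snd).withDensity w := by
  ext A hA
  rw [Measure.map_apply measurable_snd hA, withDensity_apply _ (measurable_snd hA),
    withDensity_apply _ hA, setLIntegral_map hA hw measurable_snd]

theorem withDensity_le_withDensity_of_le {Y : Type*} [MeasurableSpace Y] {μ ν : Measure Y}
    (h : μ ≤ ν) (w : Y → ℝ≥0∞) : μ.withDensity w ≤ ν.withDensity w := by
  refine Measure.le_iff.2 fun A hA => ?_
  rw [withDensity_apply _ hA, withDensity_apply _ hA]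
  exact lintegral_mono' (Measure.restrict_mono le_rfl h) le_rfl

theorem exists_split_of_map_snd_le {X Y : Type*} [MeasurableSpace X] [MeasurableSpace Y]
    {γ : Measure (X × Y)} {ν₁ ν₂ : Measure Y} [SigmaFinite ν₁] [SigmaFinite ν₂]
    (h : γ.map Prod.snd ≤ ν₁ + ν₂) :
    ∃ γ₁ γ₂ : Measure (X × Y), γ₁ + γ₂ = γ ∧ γ₁.map Prod.snd ≤ ν₁ ∧ γ₂.map Prod.snd ≤ ν₂ := by
  have a1 : ν₁ ≪ ν₁ + ν₂ := Measure.absolutelyContinuous_of_le (Measure.le_add_right le_rfl)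
  have a2 : ν₂ ≪ ν₁ + ν₂ := Measure.absolutelyContinuous_of_le (Measure.le_add_left le_rfl)
  have m1 := Measure.measurable_rnDeriv ν₁ (ν₁ + ν₂)
  have m2 := Measure.measurable_rnDeriv ν₂ (ν₁ + ν₂)
  refine ⟨γ.withDensity fun p => ν₁.rnDeriv (ν₁ + ν₂) p.2,
    γ.withDensity fun p => ν₂.rnDeriv (ν₁ + ν₂) p.2, ?_, ?_, ?_⟩
  · rw [← withDensity_add_left (show Measurable fun p : X × Y => ν₁.rnDeriv (ν₁ + ν₂) p.2 from
      m1.comp measurable_snd)]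
    have h1 : ∀ᵐ y ∂(ν₁ + ν₂), ν₁.rnDeriv (ν₁ + ν₂) y + ν₂.rnDeriv (ν₁ + ν₂) y = 1 := by
      filter_upwards [Measure.rnDeriv_add' ν₁ ν₂ (ν₁ + ν₂), Measure.rnDeriv_self (ν₁ + ν₂)]
        with y hy hy2
      rw [← hy2, hy, Pi.add_apply]
    have h2 := ae_of_ae_map measurable_snd.aemeasurable
      ((Measure.absolutelyContinuous_of_le h).ae_le h1)
    exact (withDensity_congr_ae (g := 1) h2).trans withDensity_one
  · rw [map_snd_withDensity _ m1]
    conv_rhs => rw [← Measure.withDensity_rnDeriv_eq _ _ a1]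
    exact withDensity_le_withDensity_of_le h _
  · rw [map_snd_withDensity _ m2]
    conv_rhs => rw [← Measure.withDensity_rnDeriv_eq _ _ a2]
    exact withDensity_le_withDensity_of_le h _

theorem le_of_add_le_add_left_of_finite {Y : Type*} [MeasurableSpace Y] {μ ν₁ ν₂ : Measure Y}
    [IsFiniteMeasure μ] (h : μ + ν₁ ≤ μ + ν₂) : ν₁ ≤ ν₂ := by
  intro A
  have := h A
  simp only [Measure.add_apply] at this
  exact (ENNReal.add_le_add_iff_left (measure_lt_top μ A).ne).1 this

theorem exists_remove_thin {d : ℕ} {k : Rd d → ℝ} (hk : Continuous k) (hpos : ∀ x, 0 ≤ k x)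
    (hk0 : k 0 = 0) {R : ℝ} (hR : 0 ≤ R) {ε : ℝ} (hε : 0 < ε) :
    ∃ δ : ℝ, 0 < δ ∧ ∀ μ : Measure (Rd d), IsFiniteMeasure μ → μ ≤ volume →
      ∃ T : Set (Rd d), MeasurableSet T ∧
        (∀ x ∈ T, ENNReal.ofReal δ < μ (Metric.closedBall x (R + 2))) ∧
        extCost (ecost k) μ ≤ extCost (truncCost k R) (μ.restrict T) + ENNReal.ofReal ε * μ Tᶜ := by
  obtain ⟨η, hη, hη1, hunif⟩ := exists_truncCost_add_le hk hpos R (half_pos hε)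
  set s := η / (d + 1) with hs
  have hs0 : 0 < s := by positivity
  have hsd : s * d ≤ η := by
    rw [hs, div_mul_eq_mul_div, div_le_iff₀ (by positivity)]
    nlinarith
  obtain ⟨q, hq, hvol, hdiam, -⟩ := exists_grid d hs0
  refine ⟨s ^ d / 3, by positivity, fun μ hμ hμv => ?_⟩
  set δ := ENNReal.ofReal (s ^ d / 3) with hδ
  have h3δ : δ + δ + δ = ENNReal.ofReal (s ^ d) := by
    rw [hδ, ← ENNReal.ofReal_add (by positivity) (by positivity),
      ← ENNReal.ofReal_add (by positivity) (by positivity)]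
    congr 1; ring
  set N : (Fin d → ℤ) → Set (Rd d) := fun n => Metric.cthickening R (q ⁻¹' {n}) with hN
  have hNm : ∀ n, MeasurableSet (N n) := fun n => Metric.isClosed_cthickening.measurableSet
  set S : Set (Fin d → ℤ) := {n | δ < μ (N n)} with hS
  set T := q ⁻¹' S with hT
  have hTm : MeasurableSet T := by
    rw [hT, ← biUnion_of_singleton S, preimage_iUnion₂]
    exact MeasurableSet.biUnion (to_countable S) fun n _ => hq n
  refine ⟨T, hTm, ?_, ?_⟩
  · intro x hx
    refine lt_of_lt_of_le hx (measure_mono ?_)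
    intro y hy
    have hy' := Metric.cthickening_subset_thickening' (by linarith : 0 < R + 1)
      (by linarith) _ hy
    obtain ⟨z, hz, hyz⟩ := Metric.mem_thickening_iff.1 hy'
    have hzx : dist z x ≤ 1 := by
      rw [dist_eq_norm]
      exact (hdiam z x hz).trans (hsd.trans hη1)
    rw [Metric.mem_closedBall]
    linarith [dist_triangle y z x]
  · set μ₁ := μ.restrict T with hμ₁
    set μ₂ := μ.restrict Tᶜ with hμ₂
    have hsum : μ₁ + μ₂ = μ := Measure.restrict_add_restrict_compl hTm
    have hμ₂u : μ₂ univ = μ Tᶜ := by simp [hμ₂]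
    rw [extCost.eq_1 _ μ₁]
    simp only [ENNReal.iInf_add]
    refine le_iInf₂ fun γ hγ => ?_
    rcases eq_or_ne (dispCost (truncCost k R) γ) ⊤ with htop | htop
    · simp [htop]
    have hγfin : IsFiniteMeasure γ := ⟨by
      rw [← measure_univ_eq_of_map_fst, hγ.1]; exact measure_lt_top _ _⟩
    have hdisp := ae_norm_le_of_dispCost hk htop
    set ν := volume - μ with hν
    have hνμ : ν + μ = volume := Measure.sub_add_cancel_of_le hμv
    have hνv : ν ≤ volume := by rw [← hνμ]; exact Measure.le_add_right le_rfl
    have hνσ : SigmaFinite ν := Measure.sigmaFinite_of_le volume hνv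
    have hγν : γ.map Prod.snd ≤ ν + μ₂ := by
      refine le_of_add_le_add_left_of_finite (μ := μ₁) (hγ.2.trans ?_)
      rw [← hνμ, ← hsum, add_comm μ₁ (ν + μ₂), add_assoc, add_comm μ₂]
    obtain ⟨γ₁, γ₂, hγs, hγ₁, hγ₂⟩ := exists_split_of_map_snd_le hγν
    have hγ₁fin : IsFiniteMeasure γ₁ := isFiniteMeasure_of_le γ (by
      rw [← hγs]; exact Measure.le_add_right le_rfl)
    have hγ₂fin : IsFiniteMeasure γ₂ := isFiniteMeasure_of_le γ (by
      rw [← hγs]; exact Measure.le_add_left le_rfl)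
    set b := ν - γ₁.map Prod.snd with hb
    have hbν : b + γ₁.map Prod.snd = ν := Measure.sub_add_cancel_of_le hγ₁
    have hbv : b ≤ volume := le_trans (by rw [← hbν]; exact Measure.le_add_right le_rfl) hνv
    have hdiag : Measurable (fun x : Rd d => (x, x)) := by fun_prop
    set π := μ₂.map (fun x : Rd d => (x, x)) + γ₂ with hπ
    obtain ⟨π', hf, hs', hcost⟩ := exists_relay q hq π b
      (fun n => ((hbv _).trans_lt (by rw [hvol]; exact ENNReal.ofReal_lt_top)).ne) (by
        intro n
        have e0 : π (Prod.snd ⁻¹' (q ⁻¹' {n})) = μ₂ (q ⁻¹' {n}) + γ₂.map Prod.snd (q ⁻¹' {n}) := by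
          rw [hπ, Measure.add_apply, Measure.map_apply hdiag (measurable_snd (hq n)),
            Measure.map_apply measurable_snd (hq n)]
          rfl
        rw [e0]
        by_cases hn : n ∈ S
        · have : μ₂ (q ⁻¹' {n}) = 0 := by
            rw [hμ₂, Measure.restrict_apply (hq n)]
            have : q ⁻¹' {n} ∩ Tᶜ = ∅ := by
              ext x
              simp only [mem_inter_iff, mem_preimage, mem_singleton_iff, mem_compl_iff, hT,
                mem_empty_iff_false, iff_false, not_and, not_not]
              rintro rfl; exact hn
            rw [this, measure_empty]
          have h2 : γ₂.map Prod.snd (q ⁻¹' {n}) = 0 :=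
            le_antisymm ((hγ₂ _).trans this.le) bot_le
          rw [this, h2]; simp
        · have hn' : μ (N n) ≤ δ := not_lt.1 hn
          have h1 : μ (q ⁻¹' {n}) ≤ δ :=
            (measure_mono (Metric.self_subset_cthickening _)).trans hn'
          have h2 : μ₂ (q ⁻¹' {n}) ≤ δ := (Measure.restrict_le_self _).trans h1
          have h3 : γ₁.map Prod.snd (q ⁻¹' {n}) + γ₂.map Prod.snd (q ⁻¹' {n}) ≤ δ := by
            rw [← Measure.add_apply, ← Measure.map_add _ _ measurable_snd, hγs]
            calc γ.map Prod.snd (q ⁻¹' {n}) = γ (Prod.snd ⁻¹' (q ⁻¹' {n})) :=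
                  Measure.map_apply measurable_snd (hq n)
              _ ≤ γ (Prod.fst ⁻¹' N n) := by
                  refine measure_mono_ae ?_
                  filter_upwards [hdisp] with p hp hpn
                  refine Metric.mem_cthickening_of_dist_le p.1 p.2 _ _ hpn ?_
                  rw [dist_comm, dist_eq_norm]; exact hp
              _ = μ₁ (N n) := by rw [← hγ.1, Measure.map_apply measurable_fst (hNm n)]
              _ ≤ δ := (Measure.restrict_le_self _).trans hn'
          have h4 : b (q ⁻¹' {n}) + (γ₁.map Prod.snd (q ⁻¹' {n}) + μ (q ⁻¹' {n})) =
              ENNReal.ofReal (s ^ d) := by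
            rw [← hvol n]; conv_rhs => rw [← hνμ, ← hbν]
            simp [add_assoc]
          have hfin : γ₁.map Prod.snd (q ⁻¹' {n}) + μ (q ⁻¹' {n}) ≠ ∞ :=
            (measure_lt_top (γ₁.map Prod.snd + μ) _).ne
          rw [← ENNReal.add_le_add_iff_right hfin, h4, ← h3δ]
          calc _ = μ₂ (q ⁻¹' {n}) + (γ₁.map Prod.snd (q ⁻¹' {n}) + γ₂.map Prod.snd (q ⁻¹' {n}))
                + μ (q ⁻¹' {n}) := by ring
            _ ≤ _ := by gcongr)
    have hcm : Measurable fun p : Rd d × Rd d => ecost k (p.2 - p.1) := by fun_prop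
    have htm : Measurable fun p : Rd d × Rd d => truncCost k R (p.2 - p.1) :=
      (measurable_truncCost hk R).comp (by fun_prop)
    have hπcost : dispCost (ecost k) π' ≤
        dispCost (truncCost k R) γ₂ + ENNReal.ofReal ε * μ Tᶜ := by
      refine (hcost _ (fun p => truncCost k R (p.2 - p.1) + ENNReal.ofReal (ε / 2)) hcm ?_).trans ?_
      · intro p y hy
        refine (ofReal_le_truncCost k (R + 1) _).trans ?_
        have := hunif (p.2 - p.1) (y - p.2) ((hdiam _ _ hy).trans hsd)
        rwa [show p.2 - p.1 + (y - p.2) = y - p.1 by abel] at this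
      · rw [hπ, lintegral_add_measure, lintegral_map (by fun_prop) hdiag]
        simp only [sub_self]
        rw [lintegral_const, lintegral_add_right _ measurable_const, lintegral_const]
        have ht0 : truncCost k R 0 = 0 := by simp [truncCost, hR, hk0]
        have hγ₂u : γ₂ univ ≤ μ Tᶜ := by
          rw [← measure_univ_eq_of_map_snd, ← hμ₂u]; exact hγ₂ _
        rw [ht0, zero_add, hμ₂u]
        calc _ ≤ ENNReal.ofReal (ε / 2) * μ Tᶜ +
              (dispCost (truncCost k R) γ₂ + ENNReal.ofReal (ε / 2) * μ Tᶜ) := by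
              unfold dispCost; gcongr
          _ = dispCost (truncCost k R) γ₂ +
              (ENNReal.ofReal (ε / 2) + ENNReal.ofReal (ε / 2)) * μ Tᶜ := by ring
          _ = _ := by rw [← ENNReal.ofReal_add (by positivity) (by positivity), add_halves]
    refine (extCost_le (γ := γ₁ + π') _ ?_ ?_).trans ?_
    · rw [Measure.map_add _ _ measurable_fst, hf, hπ, Measure.map_add _ _ measurable_fst,
        Measure.map_map measurable_fst hdiag]
      have : (Prod.fst ∘ fun x : Rd d => (x, x)) = id := rfl
      rw [this, Measure.map_id, add_comm μ₂, ← add_assoc, ← Measure.map_add _ _ measurable_fst,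
        hγs, hγ.1, hsum]
    · rw [Measure.map_add _ _ measurable_snd, ← hνμ]
      conv_rhs => rw [← hbν]
      rw [add_comm μ, add_comm b]
      gcongr
    · have e1 : dispCost (ecost k) γ₁ ≤ dispCost (truncCost k R) γ₁ :=
        lintegral_mono fun p => ofReal_le_truncCost k R _
      calc dispCost (ecost k) (γ₁ + π') = dispCost (ecost k) γ₁ + dispCost (ecost k) π' := by
            unfold dispCost; rw [lintegral_add_measure]
        _ ≤ dispCost (truncCost k R) γ₁ +
            (dispCost (truncCost k R) γ₂ + ENNReal.ofReal ε * μ Tᶜ) := add_le_add e1 hπcost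
        _ = _ := by
            rw [← add_assoc]; congr 1
            rw [← hγs]; unfold dispCost; rw [lintegral_add_measure]

theorem smul_map_dilation_volume {d : ℕ} {r : ℝ} (hr : 0 < r) (x₀ : Rd d) :
    ENNReal.ofReal (r ^ d) • (volume : Measure (Rd d)).map (fun x => r • (x - x₀)) = volume := by
  have : (fun x : Rd d => r • (x - x₀)) = (fun x => r • x) ∘ (fun x => x - x₀) := rfl
  rw [this, ← Measure.map_map (by fun_prop) (by fun_prop), map_sub_right_eq_self,
    Measure.map_addHaar_smul _ hr.ne', smul_smul, finrank_euclideanSpace, Fintype.card_fin,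
    abs_of_pos (by positivity), ← ENNReal.ofReal_mul (by positivity),
    mul_inv_cancel₀ (by positivity), ENNReal.ofReal_one, one_smul]

theorem le_of_H3 {d : ℕ} {k : Rd d → ℝ} (h3 : H3 k) {r : ℝ} (hr : 1 ≤ r) (v : Rd d) :
    k (r⁻¹ • v) ≤ k v := by
  rcases eq_or_ne v 0 with rfl | hv
  · simp
  have hv' : 0 < ‖v‖ := norm_pos_iff.2 hv
  have := (h3 (‖v‖⁻¹ • v) (by rw [norm_smul, norm_inv, norm_norm]; field_simp)).monotoneOn
    (a := r⁻¹ * ‖v‖) (b := ‖v‖) (by simp; positivity) (by simp)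
    (mul_le_of_le_one_left hv'.le (inv_le_one_of_one_le₀ hr))
  simp only [smul_smul] at this
  rwa [mul_assoc, mul_inv_cancel₀ hv'.ne', mul_one, one_smul] at this

theorem extCost_dilation {d : ℕ} {k : Rd d → ℝ} (hk : Continuous k) (h3 : H3 k) {r : ℝ}
    (hr : 1 ≤ r) (x₀ : Rd d) (μ : Measure (Rd d)) :
    ENNReal.ofReal (r ^ d) * extCost (ecost k) μ ≤
      extCost (ecost k) (ENNReal.ofReal (r ^ d) • μ.map fun x => r • (x - x₀)) := by
  have hr0 : 0 < r := by linarith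
  set a := ENNReal.ofReal (r ^ d) with ha
  have ha0 : a ≠ 0 := by simpa [ha] using by positivity
  have hat : a ≠ ⊤ := ENNReal.ofReal_ne_top
  set φ : Rd d → Rd d := fun x => r • (x - x₀) with hφ
  set ψ : Rd d → Rd d := fun x => r⁻¹ • x + x₀ with hψ
  have hφm : Measurable φ := by fun_prop
  have hψm : Measurable ψ := by fun_prop
  have hψφ : ψ ∘ φ = id := by
    ext1 x
    simp only [hψ, hφ, Function.comp, smul_smul, inv_mul_cancel₀ hr0.ne', one_smul, id]
    abel
  have key : ∀ σ : Measure (Rd d), a⁻¹ • (a • σ.map φ).map ψ = σ := by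
    intro σ
    rw [Measure.map_smul, Measure.map_map hψm hφm, hψφ, Measure.map_id, smul_smul,
      ENNReal.inv_mul_cancel ha0 hat, one_smul]
  refine le_extCost fun γ' h1 h2 => ?_
  have hPm : Measurable (Prod.map ψ ψ) := hψm.prodMap hψm
  have hvol : a⁻¹ • (volume : Measure (Rd d)).map ψ = volume := by
    conv_lhs => rw [← smul_map_dilation_volume hr0 x₀]
    exact key _
  have hle := extCost_le (ecost k) (μ := μ) (γ := a⁻¹ • γ'.map (Prod.map ψ ψ)) (by
      rw [Measure.map_smul, Measure.map_map measurable_fst hPm]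
      have : Prod.fst ∘ Prod.map ψ ψ = ψ ∘ Prod.fst := rfl
      rw [this, ← Measure.map_map hψm measurable_fst, h1, key]) (by
      rw [Measure.map_smul, Measure.map_map measurable_snd hPm]
      have : Prod.snd ∘ Prod.map ψ ψ = ψ ∘ Prod.snd := rfl
      rw [this, ← Measure.map_map hψm measurable_snd]
      conv_lhs => rw [← key μ]
      rw [← smul_add, ← Measure.map_add _ _ hψm]
      conv_rhs => rw [← hvol]
      exact Measure.le_iff.2 fun A hA => by
        simp only [Measure.smul_apply, smul_eq_mul]
        gcongr)
  have hcost : dispCost (ecost k) (a⁻¹ • γ'.map (Prod.map ψ ψ)) ≤ a⁻¹ * dispCost (ecost k) γ' := by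
    unfold dispCost
    rw [lintegral_smul_measure, lintegral_map (by fun_prop) hPm, smul_eq_mul]
    gcongr with p
    refine ENNReal.ofReal_le_ofReal ?_
    have : (Prod.map ψ ψ p).2 - (Prod.map ψ ψ p).1 = r⁻¹ • (p.2 - p.1) := by
      simp [hψ, smul_sub]
    rw [this]
    exact le_of_H3 h3 hr _
  calc a * extCost (ecost k) μ ≤ a * (a⁻¹ * dispCost (ecost k) γ') := by
        gcongr; exact hle.trans hcost
    _ = _ := by rw [← mul_assoc, ENNReal.mul_inv_cancel ha0 hat, one_mul]

theorem extCost_zero {d : ℕ} (c : Rd d → ℝ≥0∞) : extCost c 0 = 0 :=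
  le_antisymm ((extCost_le c (γ := 0) (by simp) (by simpa using Measure.zero_le _)).trans
    (by simp [dispCost])) bot_le

theorem exists_gap_radius {X : Type*} [PseudoMetricSpace X] [MeasurableSpace X]
    [OpensMeasurableSpace X] {μ : Measure X} {D : Set X} {w : ℝ}
    (hw : 0 < w) {δ : ℝ≥0∞} (hD : ∀ x ∈ D, δ < μ (Metric.closedBall x w)) {J : ℕ}
    (hJ : μ univ ≤ J * δ) (hJ0 : J ≠ 0) (x₀ : X) :
    ∃ r, w < r ∧ r ≤ 5 * w * J ∧ ∀ x ∈ D, w < |dist x x₀ - r| := by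
  by_contra! hcon
  have hx : ∀ j : Fin J, ∃ x ∈ D, |dist x x₀ - 5 * w * (j + 1)| ≤ w := fun j =>
    hcon (5 * w * (j + 1)) (by nlinarith [(Nat.cast_nonneg (j : ℕ) : (0 : ℝ) ≤ (j : ℕ))]) (by
      have : ((j : ℕ) : ℝ) + 1 ≤ J := by exact_mod_cast j.2
      gcongr)
  choose x hxD hx using hx
  have hdisj : Pairwise (Function.onFun Disjoint fun j => Metric.closedBall (x j) w) := by
    intro i j hij
    refine Set.disjoint_left.2 fun y hyi hyj => hij ?_
    rw [Metric.mem_closedBall] at hyi hyj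
    have h1 := abs_le.1 (hx i)
    have h2 := abs_le.1 (hx j)
    have h3 := abs_le.1 (abs_dist_sub_le (x i) y x₀)
    have h4 := abs_le.1 (abs_dist_sub_le (x j) y x₀)
    rw [dist_comm] at hyi hyj
    have e1 : 5 * w * ((i : ℕ) - (j : ℕ) : ℝ) < 5 * w * 1 := by nlinarith
    have e2 : 5 * w * ((j : ℕ) - (i : ℕ) : ℝ) < 5 * w * 1 := by nlinarith
    have e1' := lt_of_mul_lt_mul_left e1 (by positivity)
    have e2' := lt_of_mul_lt_mul_left e2 (by positivity)
    have f1 : (i : ℕ) < (j : ℕ) + 1 := by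
      have : ((i : ℕ) : ℝ) < (j : ℕ) + 1 := by linarith
      exact_mod_cast this
    have f2 : (j : ℕ) < (i : ℕ) + 1 := by
      have : ((j : ℕ) : ℝ) < (i : ℕ) + 1 := by linarith
      exact_mod_cast this
    exact Fin.ext (by omega)
  have hsum : ∑ j : Fin J, δ < ∑ j : Fin J, μ (Metric.closedBall (x j) w) := by
    refine ENNReal.sum_lt_sum_of_nonempty ⟨⟨0, by omega⟩, Finset.mem_univ _⟩
      fun j _ => hD _ (hxD j)
  rw [← tsum_fintype (L := .unconditional _) (fun j => μ (Metric.closedBall (x j) w)),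
    ← measure_iUnion hdisj fun j => Metric.isClosed_closedBall.measurableSet] at hsum
  refine absurd (hsum.trans_le (measure_mono (subset_univ _))) (not_lt.2 ?_)
  simpa using hJ

theorem ratio_split {ρ a₁ a₂ f₁ f₂ : ℝ≥0∞} (h1 : a₁ = 0 → f₁ = 0) (h2 : a₂ = 0 → f₂ = 0)
    (h : ρ * (a₁ + a₂) ≤ f₁ + f₂) (h0 : a₁ + a₂ ≠ 0) :
    a₁ ≠ 0 ∧ ρ * a₁ ≤ f₁ ∨ a₂ ≠ 0 ∧ ρ * a₂ ≤ f₂ := by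
  by_cases ha : a₁ = 0
  · rw [ha, h1 ha, zero_add, zero_add] at h
    rw [ha, zero_add] at h0
    exact .inr ⟨h0, h⟩
  by_cases hb : a₂ = 0
  · rw [hb, h2 hb, add_zero, add_zero] at h
    exact .inl ⟨ha, h⟩
  by_contra! hcon
  rw [mul_add] at h
  exact absurd h (not_le.2 (ENNReal.add_lt_add (hcon.1 ha) (hcon.2 hb)))

theorem exists_cluster {d : ℕ} {k : Rd d → ℝ} (hk : Continuous k) {R w : ℝ} (hR : 0 ≤ R)
    (hw : 0 < w) (hRw : R ≤ w) {μ : Measure (Rd d)} [IsFiniteMeasure μ] {T : Set (Rd d)}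
    {δ : ℝ≥0∞} (hδ : δ ≠ ⊤) (hT : ∀ x ∈ T, δ < μ (Metric.closedBall x w)) {J : ℕ}
    (hJ : μ univ ≤ J * δ) (hJ0 : J ≠ 0) {ρ : ℝ≥0∞} (n : ℕ) (A : Set (Rd d))
    (hA : MeasurableSet A) (hAT : ∀ x ∈ A ∩ T, Metric.closedBall x w ⊆ A) (hTm : MeasurableSet T)
    (hAn : μ A ≤ n * δ) (hA0 : μ.restrict T A ≠ 0)
    (hAρ : ρ * μ.restrict T A ≤ extCost (truncCost k R) ((μ.restrict T).restrict A)) :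
    ∃ x₀ S, MeasurableSet S ∧ S ⊆ Metric.ball x₀ (5 * w * J) ∧ μ.restrict T S ≠ 0 ∧
      ρ * μ.restrict T S ≤ extCost (truncCost k R) ((μ.restrict T).restrict S) := by
  induction n generalizing A with
  | zero =>
    refine absurd ?_ hA0
    rw [Nat.cast_zero, zero_mul] at hAn
    exact le_antisymm ((Measure.restrict_apply_le T A).trans hAn) bot_le
  | succ n ih =>
    obtain ⟨x₀, hx₀A, hx₀T⟩ : (A ∩ T).Nonempty := by
      rw [Measure.restrict_apply hA] at hA0
      exact nonempty_of_measure_ne_zero hA0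
    obtain ⟨r, hwr, hrJ, hr⟩ := exists_gap_radius hw (D := A ∩ T) (fun x hx => hT x hx.2) hJ hJ0 x₀
    set Z := Metric.ball x₀ r with hZ
    have hZm : MeasurableSet Z := Metric.isOpen_ball.measurableSet
    have hin : ∀ x ∈ A ∩ T, x ∈ Z → Metric.closedBall x w ⊆ Z := by
      intro x hx hxZ y hy
      rw [hZ, Metric.mem_ball] at *
      rw [Metric.mem_closedBall] at hy
      have h1 := hr x hx
      rw [abs_of_neg (by linarith)] at h1
      linarith [dist_triangle y x x₀]
    have hout : ∀ x ∈ A ∩ T, x ∉ Z → Metric.closedBall x w ⊆ Zᶜ := by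
      intro x hx hxZ y hy
      rw [hZ, mem_compl_iff, Metric.mem_ball, not_lt] at *
      rw [Metric.mem_closedBall] at hy
      have h1 := hr x hx
      rw [abs_of_nonneg (by linarith)] at h1
      linarith [dist_triangle_left x x₀ y]
    set ν := μ.restrict T with hν
    have hTν : ∀ᵐ x ∂ν, x ∈ T := ae_restrict_mem hTm
    have hsplitm : ν.restrict (A ∩ Z) + ν.restrict (A \ Z) = ν.restrict A :=
      Measure.restrict_inter_add_sdiff _ hZm
    have hgap := extCost_add_le_of_gap hk (μa := ν.restrict (A ∩ Z)) (μb := ν.restrict (A \ Z))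
      hZm hR (by
        filter_upwards [ae_restrict_mem (hA.inter hZm), ae_restrict_of_ae hTν] with x hx hxT y hy
        refine hin x ⟨hx.1, hxT⟩ hx.2 ?_
        rw [Metric.mem_closedBall, dist_eq_norm]; linarith) (by
        filter_upwards [ae_restrict_mem (hA.diff hZm), ae_restrict_of_ae hTν] with x hx hxT y hy
        refine hout x ⟨hx.1, hxT⟩ hx.2 ?_
        rw [Metric.mem_closedBall, dist_eq_norm]; linarith)
    rw [hsplitm] at hgap
    have hzero : ∀ B, ν B = 0 → extCost (truncCost k R) (ν.restrict B) = 0 := fun B hB => by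
      rw [Measure.restrict_eq_zero.2 hB, extCost_zero]
    have hνA : ν (A ∩ Z) + ν (A \ Z) = ν A := measure_inter_add_sdiff A hZm
    rcases ratio_split (hzero (A ∩ Z)) (hzero (A \ Z)) (by rw [hνA]; exact hAρ.trans hgap)
      (by rwa [hνA]) with h | h
    · refine ⟨x₀, A ∩ Z, hA.inter hZm, ?_, h.1, h.2⟩
      exact inter_subset_right.trans (Metric.ball_subset_ball hrJ)
    · refine ih (A \ Z) (hA.diff hZm) ?_ ?_ h.1 h.2
      · intro x hx
        exact subset_inter (hAT x ⟨hx.1.1, hx.2⟩) (hout x ⟨hx.1.1, hx.2⟩ hx.1.2)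
      · have h1 : δ ≤ μ (A ∩ Z) := (hT x₀ hx₀T).le.trans (measure_mono
          (subset_inter (hAT x₀ ⟨hx₀A, hx₀T⟩) (Metric.closedBall_subset_ball hwr)))
        rw [← measure_inter_add_sdiff A hZm, Nat.cast_succ, add_mul, one_mul, add_comm] at hAn
        exact (ENNReal.add_le_add_iff_right hδ).1 ((add_le_add le_rfl h1).trans hAn)

theorem exists_tight {d : ℕ} (hd : 1 ≤ d) {k : Rd d → ℝ} (hpos : ∀ x, 0 ≤ k x) (h1 : H1 k)
    (h3 : H3 k) {m ρ₀ : ℝ} (hm : 0 < m) (hρ₀ : 0 < ρ₀) :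
    ∃ r₁ : ℝ, ∀ μ : Measure (Rd d), μ ≤ volume → μ univ = ENNReal.ofReal m →
      ENNReal.ofReal ρ₀ * μ univ < extCost (ecost k) μ →
      ∃ μ' : Measure (Rd d), μ' ≤ volume ∧ μ' univ = ENNReal.ofReal m ∧
        μ' (Metric.closedBall 0 r₁)ᶜ = 0 ∧ extCost (ecost k) μ ≤ extCost (ecost k) μ' := by
  have hk := h1.1
  obtain ⟨R, K, hR, hK, htrunc, hfin⟩ := exists_trunc hd h1 hm
  obtain ⟨δ, hδ, hthin⟩ := exists_remove_thin hk hpos h1.2.1 hR.le hρ₀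
  obtain ⟨c, hc, hsmall⟩ := exists_small_mass hk h1.2.1 (half_pos hρ₀)
  obtain ⟨J, hJ⟩ := exists_nat_ge (m / δ)
  have hJ0 : J ≠ 0 := by
    rintro rfl
    have : 0 < m / δ := by positivity
    simp at hJ; linarith
  have hJ' : ENNReal.ofReal m ≤ J * ENNReal.ofReal δ := by
    rw [← ENNReal.ofReal_natCast, ← ENNReal.ofReal_mul (by positivity)]
    refine ENNReal.ofReal_le_ofReal ?_
    rwa [div_le_iff₀ hδ] at hJ
  set w := R + 2 with hw
  have hd0 : (d : ℝ)⁻¹ ≠ 0 := by positivity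
  refine ⟨(m / c) ^ ((d : ℝ)⁻¹) * (5 * w * J), fun μ hμv hμm hμρ => ?_⟩
  have hμfin : IsFiniteMeasure μ := ⟨by rw [hμm]; exact ENNReal.ofReal_lt_top⟩
  have hm0 : ENNReal.ofReal m ≠ 0 := by simpa using hm
  obtain ⟨T, hTm, hT, hTcost⟩ := hthin μ hμfin hμv
  set ρ := extCost (ecost k) μ / ENNReal.ofReal m with hρ
  have hρm : ρ * ENNReal.ofReal m = extCost (ecost k) μ :=
    ENNReal.div_mul_cancel hm0 ENNReal.ofReal_ne_top
  have hρ₀ρ : ENNReal.ofReal ρ₀ ≤ ρ := by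
    rw [hρ, ENNReal.le_div_iff_mul_le (.inl hm0) (.inl ENNReal.ofReal_ne_top), ← hμm]
    exact hμρ.le
  have hEfin : extCost (ecost k) μ ≠ ⊤ := by
    refine ne_top_of_le_ne_top ?_ (hfin μ 0 μ hμm.le (by simp) (by simpa using hμv))
    rw [hμm]; simp [dispCost, ENNReal.mul_eq_top]
  have hρtop : ρ ≠ ⊤ := ENNReal.div_ne_top hEfin hm0
  have hTu : μ T + μ Tᶜ = μ univ := measure_add_measure_compl hTm
  have hTρ : ρ * μ T ≤ extCost (truncCost k R) (μ.restrict T) := by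
    have : ρ * μ T + ρ * μ Tᶜ ≤ extCost (truncCost k R) (μ.restrict T) + ρ * μ Tᶜ := by
      rw [← mul_add, hTu, hμm, hρm]
      exact hTcost.trans (by gcongr)
    exact (ENNReal.add_le_add_iff_right
      (ENNReal.mul_ne_top hρtop (measure_ne_top μ _))).1 this
  have hT0 : μ T ≠ 0 := by
    intro h0
    rw [Measure.restrict_eq_zero.2 h0, extCost_zero, zero_add] at hTcost
    refine absurd hμρ (not_lt.2 (hTcost.trans ?_))
    gcongr; exact subset_univ _
  obtain ⟨n, hn⟩ : ∃ n : ℕ, μ univ ≤ n * ENNReal.ofReal δ := ⟨J, by rw [hμm]; exact hJ'⟩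
  obtain ⟨x₀, S, hS, hSb, hS0, hSρ⟩ := exists_cluster hk hR.le (by linarith : 0 < w)
    (by linarith) ENNReal.ofReal_ne_top hT (by rw [hμm]; exact hJ') hJ0 (ρ := ρ) n univ
    MeasurableSet.univ (fun x _ => subset_univ _) hTm hn (by simpa using hT0)
    (by simpa using hTρ)
  set σ := (μ.restrict T).restrict S with hσ
  have hσu : μ.restrict T S = σ univ := by simp [hσ]
  rw [hσu] at hS0 hSρ
  have hσμ : σ ≤ μ := Measure.restrict_le_self.trans Measure.restrict_le_self
  have hσm : σ univ ≤ ENNReal.ofReal m := (hσμ univ).trans hμm.le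
  have hσfin : IsFiniteMeasure σ := isFiniteMeasure_of_le μ hσμ
  replace hSρ := hSρ.trans (htrunc σ hσm)
  set t := (σ univ).toReal with ht
  have htσ : σ univ = ENNReal.ofReal t := (ENNReal.ofReal_toReal (measure_ne_top _ _)).symm
  have ht0 : 0 < t := ENNReal.toReal_pos hS0 (measure_ne_top _ _)
  have htm : t ≤ m := (ENNReal.ofReal_le_ofReal_iff hm.le).1 (by rw [← htσ]; exact hσm)
  have htc : c ≤ t := by
    by_contra! hlt
    have h := hSρ.trans (hsmall σ (hσμ.trans hμv) (by
      rw [htσ]; exact ENNReal.ofReal_le_ofReal hlt.le))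
    have h' : ENNReal.ofReal ρ₀ * σ univ ≤ ENNReal.ofReal (ρ₀ / 2) * σ univ :=
      le_trans (by gcongr) h
    rw [ENNReal.mul_le_mul_iff_left hS0 (measure_ne_top _ _),
      ENNReal.ofReal_le_ofReal_iff (by positivity)] at h'
    linarith
  set r := (m / t) ^ ((d : ℝ)⁻¹) with hr
  have hmt : 1 ≤ m / t := (one_le_div ht0).2 htm
  have hr1 : 1 ≤ r := Real.one_le_rpow hmt (by positivity)
  have hrd : r ^ d = m / t := Real.rpow_inv_natCast_pow (by positivity) (by omega)
  have hrr : r ≤ (m / c) ^ ((d : ℝ)⁻¹) := by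
    refine Real.rpow_le_rpow (by positivity) ?_ (by positivity)
    gcongr
  have hφ : Measurable fun x : Rd d => r • (x - x₀) := by fun_prop
  refine ⟨ENNReal.ofReal (r ^ d) • σ.map fun x => r • (x - x₀), ?_, ?_, ?_, ?_⟩
  · conv_rhs => rw [← smul_map_dilation_volume (by linarith : 0 < r) x₀]
    have := Measure.map_mono (hσμ.trans hμv) hφ
    exact Measure.le_iff.2 fun A hA => by
      simp only [Measure.smul_apply, smul_eq_mul]
      gcongr
  · rw [Measure.smul_apply, Measure.map_apply hφ MeasurableSet.univ, preimage_univ, htσ,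
      smul_eq_mul,
      ← ENNReal.ofReal_mul (by positivity), hrd, div_mul_cancel₀ _ ht0.ne']
  · rw [Measure.smul_apply, Measure.map_apply hφ Metric.isClosed_closedBall.measurableSet.compl]
    have : σ ((fun x : Rd d => r • (x - x₀)) ⁻¹'
        (Metric.closedBall 0 ((m / c) ^ ((d : ℝ)⁻¹) * (5 * w * J)))ᶜ) = 0 := by
      rw [hσ, Measure.restrict_apply (hφ Metric.isClosed_closedBall.measurableSet.compl)]
      convert measure_empty (μ := μ.restrict T)
      refine eq_empty_of_forall_notMem fun x hx => hx.1 ?_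
      have := Metric.mem_ball.1 (hSb hx.2)
      rw [dist_eq_norm] at this
      rw [Metric.mem_closedBall, dist_zero_right, norm_smul, Real.norm_eq_abs,
          abs_of_pos (by linarith)]
      gcongr
    rw [this, smul_zero]
  · refine le_trans ?_ (extCost_dilation hk h3 hr1 x₀ σ)
    calc extCost (ecost k) μ = ENNReal.ofReal (r ^ d) * (ρ * σ univ) := by
          rw [← hρm, htσ, mul_left_comm, ← ENNReal.ofReal_mul (by positivity), hrd,
            div_mul_cancel₀ _ ht0.ne']
      _ ≤ _ := by gcongr

theorem exists_subset_volume_eq {d : ℕ} (hd : 1 ≤ d) {A : Set (Rd d)} (hA : MeasurableSet A)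
    (hfin : volume A ≠ ⊤) {t : ℝ≥0∞} (ht : t ≤ volume A) :
    ∃ B ⊆ A, MeasurableSet B ∧ volume B = t := by
  have : Nonempty (Fin d) := ⟨⟨0, by omega⟩⟩
  have : Nontrivial (Rd d) := inferInstance
  rcases ht.eq_or_lt with rfl | htlt
  · exact ⟨A, subset_rfl, hA, rfl⟩
  have hAf : IsFiniteMeasure (volume.restrict A) := ⟨by simpa using hfin.lt_top⟩
  set η : Measure ℝ := (volume.restrict A).map norm with hη
  have hηa : NullSingletonClass η := ⟨fun r => by
    rw [hη, Measure.map_apply measurable_norm (measurableSet_singleton r)]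
    refine le_antisymm ((Measure.restrict_apply_le _ _).trans ?_) bot_le
    have : norm ⁻¹' {r} = Metric.sphere (0 : Rd d) r := by ext; simp
    rw [this, Measure.addHaar_sphere]⟩
  set f : ℝ → ℝ := fun r => ∫ x in (-1)..r, (1 : ℝ) ∂η with hf
  have hfc : Continuous f :=
    intervalIntegral.continuous_primitive (fun a b => intervalIntegrable_const) _
  have hfe : ∀ r, -1 ≤ r → ENNReal.ofReal (f r) = volume (Metric.closedBall (0 : Rd d) r ∩ A) := by
    intro r hr
    simp only [hf]
    rw [intervalIntegral.integral_of_le hr]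
    simp only [integral_const, smul_eq_mul, mul_one, measureReal_restrict_apply_univ]
    rw [measureReal_def, ENNReal.ofReal_toReal (measure_ne_top _ _), hη,
      Measure.map_apply measurable_norm measurableSet_Ioc,
      ← Measure.restrict_apply Metric.isClosed_closedBall.measurableSet]
    congr 1
    ext x
    simp only [mem_preimage, mem_Ioc, Metric.mem_closedBall, dist_zero_right, and_iff_right_iff_imp]
    intro _
    linarith [norm_nonneg x]
  have htend : Tendsto (fun n : ℕ => volume (Metric.closedBall (0 : Rd d) n ∩ A)) atTop
      (nhds (volume A)) := by
    have := tendsto_measure_iUnion_atTop (μ := volume)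
      (s := fun n : ℕ => Metric.closedBall (0 : Rd d) n ∩ A) (by
        intro a b hab
        exact inter_subset_inter_left _ (Metric.closedBall_subset_closedBall (by exact_mod_cast hab)))
    rwa [← iUnion_inter, Metric.iUnion_closedBall_nat, univ_inter] at this
  obtain ⟨n, hn⟩ := (htend.eventually (lt_mem_nhds htlt)).exists
  have htt : t ≠ ⊤ := htlt.ne_top
  have hn0 : (-1 : ℝ) ≤ n := by linarith [(Nat.cast_nonneg n : (0 : ℝ) ≤ n)]
  obtain ⟨r, hr, hfr⟩ := intermediate_value_Icc hn0
    hfc.continuousOn (show t.toReal ∈ Icc (f (-1)) (f n) by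
      refine ⟨by simp [hf], ?_⟩
      have h0 : 0 ≤ f n := by
        simp only [hf]
        exact intervalIntegral.integral_nonneg hn0 fun _ _ => zero_le_one
      rw [← ENNReal.ofReal_le_ofReal_iff h0, hfe n hn0,
        ENNReal.ofReal_toReal htt]
      exact hn.le)
  refine ⟨Metric.closedBall 0 r ∩ A, inter_subset_right,
    Metric.isClosed_closedBall.measurableSet.inter hA, ?_⟩
  rw [← hfe r hr.1, hfr, ENNReal.ofReal_toReal htt]

theorem exists_fine_grid {d : ℕ} {k : Rd d → ℝ} (hk : Continuous k) (hpos : ∀ x, 0 ≤ k x)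
    (R : ℝ) {ε : ℝ} (hε : 0 < ε) :
    ∃ q : Rd d → (Fin d → ℤ), (∀ n, MeasurableSet (q ⁻¹' {n})) ∧
      (∀ n, volume (q ⁻¹' {n}) ≠ ⊤) ∧ (∀ r, (q '' Metric.closedBall 0 r).Finite) ∧
      ∀ x y y', q y = q y' →
        truncCost k (R + 1) (y' - x) ≤ truncCost k R (y - x) + ENNReal.ofReal ε ∧
        ecost k (x - y') ≤ truncCost k (R + 1) (x - y) + ENNReal.ofReal ε := by
  obtain ⟨η, hη, -, hunif⟩ := exists_truncCost_add_le hk hpos R hε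
  obtain ⟨η', hη', -, hunif'⟩ := exists_truncCost_add_le hk hpos (R + 1) hε
  set s := min η η' / (d + 1) with hs
  have hs0 : 0 < s := by positivity
  have hsd : s * d ≤ min η η' := by
    rw [hs, div_mul_eq_mul_div, div_le_iff₀ (by positivity)]
    nlinarith [lt_min hη hη']
  obtain ⟨q, hq, hvol, hdiam, hqf⟩ := exists_grid d hs0
  refine ⟨q, hq, fun n => by rw [hvol]; exact ENNReal.ofReal_ne_top, hqf, fun x y y' hy => ⟨?_, ?_⟩⟩
  · have h := hunif (y - x) (y' - y) ((hdiam _ _ hy.symm).trans (hsd.trans (min_le_left _ _)))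
    rwa [add_comm (y - x), sub_add_sub_cancel] at h
  · have h := hunif' (x - y) (y - y') ((hdiam _ _ hy).trans (hsd.trans (min_le_right _ _)))
    rw [sub_add_sub_cancel] at h
    exact (ofReal_le_truncCost k (R + 1 + 1) _).trans h

theorem le_upsSet {d : ℕ} (k : Rd d → ℝ) {E : Set (Rd d)} :
    extCost (ecost k) (volume.restrict E) ≤ UpsSet (transCost k) E := by
  refine le_iInf₂ fun F hF => le_iInf₂ fun γ hγ => ?_
  refine extCost_le (ecost k) hγ.1 ?_
  rw [hγ.2, ← Measure.restrict_union₀ (μ := volume) (s := E) (t := F) ?_ hF.1.nullMeasurableSet]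
  · exact Measure.restrict_le_self
  · rw [AEDisjoint, inter_comm]; exact hF.2.2

theorem upsSet_le {d : ℕ} (hd : 1 ≤ d) {k : Rd d → ℝ} (hpos : ∀ x, 0 ≤ k x) (h1 : H1 k)
    {E : Set (Rd d)} (hE : MeasurableSet E) (hEt : volume E ≠ ⊤) :
    UpsSet (transCost k) E ≤ extCost (ecost k) (volume.restrict E) := by
  set m := (volume E).toReal + 1 with hm
  have hm0 : 0 < m := by positivity
  have hEm : volume.restrict E univ ≤ ENNReal.ofReal m := by
    rw [Measure.restrict_apply_univ]
    exact ENNReal.le_ofReal_iff_toReal_le hEt hm0.le |>.2 (by linarith)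
  obtain ⟨R, K, -, -, htrunc, -⟩ := exists_trunc hd h1 hm0
  refine le_trans ?_ (htrunc _ hEm)
  refine le_extCost fun γ hγ1 hγ2 => ?_
  have hγu : γ univ = volume E := by
    rw [← measure_univ_eq_of_map_fst, hγ1, Measure.restrict_apply_univ]
  have hγfin : IsFiniteMeasure γ := ⟨by rw [hγu]; exact hEt.lt_top⟩
  refine ENNReal.le_of_forall_pos_le_add fun ε hε _ => ?_
  obtain ⟨q, hq, hvol, -, hcost⟩ := exists_fine_grid h1.1 hpos R (ε := ε / m) (by positivity)
  have hcell : ∀ n, γ.map Prod.snd (q ⁻¹' {n}) ≤ volume (q ⁻¹' {n} \ E) := by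
    intro n
    have h := hγ2 (q ⁻¹' {n})
    rw [Measure.add_apply, Measure.restrict_apply (hq n), 
      ← measure_inter_add_sdiff (μ := volume) (q ⁻¹' {n}) hE] at h
    exact (ENNReal.add_le_add_iff_left (measure_ne_top_of_subset inter_subset_left (hvol n))).1 h
  have hF := fun n => exists_subset_volume_eq hd ((hq n).diff hE)
    (measure_ne_top_of_subset sdiff_subset (hvol n)) (hcell n)
  choose F hFs hFm hFv using hF
  have hdisj : Pairwise (Function.onFun Disjoint F) := by
    intro i j hij
    refine Set.disjoint_left.2 fun y hyi hyj => hij ?_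
    have h1 : q y = i := (hFs i hyi).1
    have h2 : q y = j := (hFs j hyj).1
    rw [← h1, h2]
  have hFE : (⋃ n, F n) ∩ E = ∅ := by
    refine eq_empty_of_forall_notMem fun x hx => ?_
    obtain ⟨n, hn⟩ := mem_iUnion.1 hx.1
    exact (hFs n hn).2 hx.2
  have hFvol : volume (⋃ n, F n) = volume E := by
    rw [measure_iUnion hdisj hFm, ← hγu, ← measure_univ_eq_of_map_snd]
    simp only [hFv]
    rw [← measure_iUnion _ hq]
    · congr 1; ext x; simp
    · intro i j hij
      refine Set.disjoint_left.2 fun y hyi hyj => hij ?_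
      rw [← (show q y = i from hyi), (show q y = j from hyj)]
  obtain ⟨π, hπ1, hπ2, hπc⟩ := exists_relay q hq γ (volume.restrict (⋃ n, F n))
    (fun n => ((Measure.restrict_apply_le _ _).trans_lt (hvol n).lt_top).ne) (by
      intro n
      rw [← Measure.map_apply measurable_snd (hq n), ← hFv, Measure.restrict_apply (hq n)]
      exact measure_mono (subset_inter (fun x hx => (hFs n hx).1) (subset_iUnion F n)))
  have hπfin : IsFiniteMeasure (volume.restrict (⋃ n, F n)) := ⟨by
    rw [Measure.restrict_apply_univ, hFvol]; exact hEt.lt_top⟩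
  have hπ2fin : IsFiniteMeasure (π.map Prod.snd) := isFiniteMeasure_of_le _ hπ2
  have hπeq : π.map Prod.snd = volume.restrict (⋃ n, F n) := by
    refine Measure.eq_of_le_of_measure_univ_eq hπ2 ?_
    rw [measure_univ_eq_of_map_snd, ← measure_univ_eq_of_map_fst, hπ1, measure_univ_eq_of_map_fst,
      hγu, Measure.restrict_apply_univ, hFvol]
  calc UpsSet (transCost k) E ≤ Tcost (transCost k) (volume.restrict E)
        (volume.restrict (⋃ n, F n)) :=
        iInf₂_le (⋃ n, F n) ⟨MeasurableSet.iUnion hFm, hFvol, by rw [hFE, measure_empty]⟩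
    _ ≤ planCost (transCost k) π := iInf₂_le π ⟨hπ1.trans hγ1, hπeq⟩
    _ ≤ ∫⁻ p, (truncCost k R (p.2 - p.1) + ENNReal.ofReal (ε / m)) ∂γ :=
        hπc (fun p => ecost k (p.2 - p.1)) _ (by have := h1.1; fun_prop)
          fun p y hy => (ofReal_le_truncCost k (R + 1) _).trans (hcost p.1 p.2 y hy.symm).1
    _ = dispCost (truncCost k R) γ + ENNReal.ofReal (ε / m) * γ univ := by
        rw [lintegral_add_right _ measurable_const, lintegral_const]; rfl
    _ ≤ _ := by
        gcongr
        calc _ ≤ ENNReal.ofReal (ε / m) * ENNReal.ofReal m := by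
              gcongr; rwa [hγu, ← Measure.restrict_apply_univ]
          _ = ε := by
              rw [← ENNReal.ofReal_mul (by positivity), div_mul_cancel₀ _ hm0.ne',
                ENNReal.ofReal_coe_nnreal]

theorem fMeas_add_one_sub {d : ℕ} {f : Rd d → ℝ} (hf : InUnit f) :
    fMeas f + fMeas (fun x => 1 - f x) = volume := by
  have hfm : AEMeasurable (fun x => ENNReal.ofReal (f x)) volume :=
    hf.1.aestronglyMeasurable.aemeasurable.ennreal_ofReal
  ext A hA
  rw [fMeas, fMeas, Measure.add_apply, withDensity_apply _ hA, withDensity_apply _ hA,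
    ← lintegral_add_left' hfm.restrict]
  have : ∀ x, ENNReal.ofReal (f x) + ENNReal.ofReal (1 - f x) = 1 := fun x => by
    rw [← ENNReal.ofReal_add (hf.2 x).1 (by linarith [(hf.2 x).2])]
    simp
  simp [this]

theorem fMeas_univ {d : ℕ} {f : Rd d → ℝ} (hf : InUnit f) :
    fMeas f univ = ENNReal.ofReal (∫ x, f x) := by
  rw [fMeas, withDensity_apply _ MeasurableSet.univ, Measure.restrict_univ,
    ofReal_integral_eq_lintegral_ofReal hf.1 (Eventually.of_forall fun x => (hf.2 x).1)]

theorem fMeas_le_volume {d : ℕ} {f : Rd d → ℝ} (hf : InUnit f) : fMeas f ≤ volume := by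
  rw [← fMeas_add_one_sub hf]
  exact Measure.le_add_right le_rfl

theorem ups_eq_extCost {d : ℕ} {k : Rd d → ℝ} {f : Rd d → ℝ} (hf : InUnit f) :
    Ups (transCost k) f = extCost (ecost k) (fMeas f) := by
  have hfin : IsFiniteMeasure (fMeas f) := ⟨by rw [fMeas_univ hf]; exact ENNReal.ofReal_lt_top⟩
  have : ExtPlans f = {γ | γ.map Prod.fst = fMeas f ∧ fMeas f + γ.map Prod.snd ≤ volume} := by
    ext γ
    refine and_congr_right fun _ => ?_
    rw [← fMeas_add_one_sub hf]
    exact ⟨fun h => add_le_add le_rfl h, le_of_add_le_add_left_of_finite⟩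
  unfold Ups
  rw [this]
  rfl

theorem exists_density {d : ℕ} {μ : Measure (Rd d)} [IsFiniteMeasure μ] (hμ : μ ≤ volume) :
    ∃ f : Rd d → ℝ, InUnit f ∧ Measurable f ∧ fMeas f = μ := by
  have hac : μ ≪ volume := Measure.absolutelyContinuous_of_le hμ
  have hle : ∀ᵐ x, μ.rnDeriv volume x ≤ 1 := Measure.rnDeriv_le_one_of_le hμ
  have hmeas : Measurable fun x => (min (μ.rnDeriv volume x) 1).toReal :=
    ((Measure.measurable_rnDeriv _ _).min measurable_const).ennreal_toReal
  have heq : fMeas (fun x => (min (μ.rnDeriv volume x) 1).toReal) = μ := by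
    rw [fMeas]
    conv_rhs => rw [← Measure.withDensity_rnDeriv_eq μ volume hac]
    refine withDensity_congr_ae ?_
    filter_upwards [hle] with x hx
    rw [min_eq_left hx, ENNReal.ofReal_toReal (ne_top_of_le_ne_top one_ne_top hx)]
  have h01 : ∀ x, 0 ≤ (min (μ.rnDeriv volume x) 1).toReal ∧
      (min (μ.rnDeriv volume x) 1).toReal ≤ 1 := fun x =>
    ⟨ENNReal.toReal_nonneg, ENNReal.toReal_le_of_le_ofReal zero_le_one (by simp)⟩
  refine ⟨_, ⟨⟨hmeas.aestronglyMeasurable, ?_⟩, h01⟩, hmeas, heq⟩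
  rw [hasFiniteIntegral_iff_ofReal (Eventually.of_forall fun x => (h01 x).1),
    ← setLIntegral_univ, ← withDensity_apply _ MeasurableSet.univ]
  change fMeas _ univ < ⊤
  rw [heq]
  exact measure_lt_top _ _

theorem extCost_le_of_cells {d : ℕ} {k : Rd d → ℝ} (hk : Continuous k) {R : ℝ} {ε : ℝ≥0∞}
    {ι : Type*} [Countable ι] {q : Rd d → ι} (hq : ∀ n, MeasurableSet (q ⁻¹' {n}))
    (hvol : ∀ n, volume (q ⁻¹' {n}) ≠ ⊤)
    (hcost : ∀ x y y', q y = q y' →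
      truncCost k (R + 1) (y' - x) ≤ truncCost k R (y - x) + ε ∧
      ecost k (x - y') ≤ truncCost k (R + 1) (x - y) + ε)
    {μ μ' : Measure (Rd d)} [IsFiniteMeasure μ] (hμ' : μ' ≤ volume) (huniv : μ' univ = μ univ)
    {a θ K : ℝ≥0∞} (haθ : a + θ = 1)
    (hK : ∀ (γ : Measure (Rd d × Rd d)) (h : Measure (Rd d)), γ.map Prod.fst + h = μ' →
      μ' + γ.map Prod.snd ≤ volume → extCost (ecost k) μ' ≤ dispCost (ecost k) γ + K * h univ)
    {γ : Measure (Rd d × Rd d)} (hγ : γ.map Prod.fst = μ)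
    (hμ : ∀ n, a * μ (q ⁻¹' {n}) ≤ μ' (q ⁻¹' {n}))
    (hγ' : ∀ n, a * γ.map Prod.snd (q ⁻¹' {n}) + μ' (q ⁻¹' {n}) ≤ volume (q ⁻¹' {n})) :
    extCost (ecost k) μ' ≤ dispCost (truncCost k R) γ + ε * μ univ + ε * μ univ +
      K * (θ * μ univ) := by
  have ha1 : a ≤ 1 := by rw [← haθ]; exact le_self_add
  have hat : a ≠ ⊤ := ne_top_of_le_ne_top one_ne_top ha1
  have hμ'fin : IsFiniteMeasure μ' := ⟨by rw [huniv]; exact measure_lt_top _ _⟩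
  have hγu : γ univ = μ univ := by rw [← measure_univ_eq_of_map_fst, hγ]
  have hγfin : IsFiniteMeasure γ := ⟨by rw [hγu]; exact measure_lt_top _ _⟩
  have haγfin : IsFiniteMeasure (a • γ) := ⟨by
    rw [Measure.smul_apply, smul_eq_mul]
    exact ENNReal.mul_lt_top hat.lt_top (measure_lt_top _ _)⟩
  set ν := volume - μ' with hν
  have hνμ : ν + μ' = volume := Measure.sub_add_cancel_of_le hμ'
  obtain ⟨π₁, h1f, h1s, h1c⟩ := exists_relay q hq (a • γ) ν
    (fun n => ne_top_of_le_ne_top (hvol n) (Measure.sub_le _)) (by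
      intro n
      rw [← Measure.map_apply measurable_snd (hq n), Measure.map_smul, Measure.smul_apply,
        smul_eq_mul]
      have h := hγ' n
      conv_rhs at h => rw [← hνμ]
      exact (ENNReal.add_le_add_iff_right (measure_ne_top μ' _)).1 h)
  have h1fst : π₁.map Prod.fst = a • μ := by rw [h1f, Measure.map_smul, hγ]
  have h1u : π₁ univ = a * μ univ := by
    rw [← measure_univ_eq_of_map_fst, h1fst, Measure.smul_apply, smul_eq_mul]
  have h1u' : π₁ univ ≤ μ univ := by rw [h1u]; exact mul_le_of_le_one_left' ha1
  have h1fin : IsFiniteMeasure π₁ := ⟨h1u'.trans_lt (measure_lt_top _ _)⟩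
  have hswap : Measurable (Prod.swap : Rd d × Rd d → Rd d × Rd d) := measurable_swap
  obtain ⟨π₂, h2f, h2s, h2c⟩ := exists_relay q hq (π₁.map Prod.swap) μ'
    (fun n => measure_ne_top _ _) (by
      intro n
      rw [Measure.map_apply hswap (measurable_snd (hq n))]
      refine le_trans (le_of_eq ?_) (hμ n)
      rw [← smul_eq_mul, ← Measure.smul_apply, ← h1fst, Measure.map_apply measurable_fst (hq n)]
      rfl)
  set γ' := π₂.map Prod.swap with hγ'def
  have hfst : γ'.map Prod.fst = π₂.map Prod.snd := by
    rw [hγ'def, Measure.map_map measurable_fst hswap]; rfl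
  have hsnd : γ'.map Prod.snd = π₁.map Prod.snd := by
    rw [hγ'def, Measure.map_map measurable_snd hswap]
    change π₂.map Prod.fst = _
    rw [h2f, Measure.map_map measurable_fst hswap]; rfl
  have hγ'u : γ'.map Prod.fst univ = a * μ univ := by
    rw [measure_univ_eq_of_map_fst, ← measure_univ_eq_of_map_snd, hsnd, measure_univ_eq_of_map_snd,
      h1u]
  rw [← hfst] at h2s
  have hγ'fin : IsFiniteMeasure (γ'.map Prod.fst) := isFiniteMeasure_of_le _ h2s
  have hsub : μ' - γ'.map Prod.fst + γ'.map Prod.fst = μ' := Measure.sub_add_cancel_of_le h2s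
  have hrest : (μ' - γ'.map Prod.fst) univ = θ * μ univ := by
    have h : (μ' - γ'.map Prod.fst) univ + a * μ univ = θ * μ univ + a * μ univ := by
      rw [← hγ'u, ← Measure.add_apply, hsub, huniv, hγ'u, ← add_mul, add_comm, haθ, one_mul]
    exact (ENNReal.add_left_inj (ENNReal.mul_ne_top hat (measure_ne_top _ _))).1 h
  have hmain := hK γ' (μ' - γ'.map Prod.fst) (by rw [add_comm, hsub]) (by
    rw [hsnd, add_comm, ← hνμ]
    exact add_le_add h1s le_rfl)
  rw [hrest] at hmain
  refine hmain.trans (add_le_add ?_ le_rfl)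
  have htm := measurable_truncCost hk (R + 1)
  have c2 : dispCost (ecost k) γ' ≤
      ∫⁻ p, (truncCost k (R + 1) (p.1 - p.2) + ε) ∂π₁.map Prod.swap := by
    rw [dispCost, hγ'def, lintegral_map (by fun_prop) hswap]
    exact h2c (fun p => ecost k (p.1 - p.2)) _ (by fun_prop)
      fun p y hy => (hcost p.1 p.2 y hy.symm).2
  rw [lintegral_map (by fun_prop) hswap, lintegral_add_right _ measurable_const,
    lintegral_const] at c2
  have c1 := h1c (fun p => truncCost k (R + 1) (p.2 - p.1)) (fun p => truncCost k R (p.2 - p.1) + ε)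
    (by fun_prop) fun p y hy => (hcost p.1 p.2 y hy.symm).1
  rw [lintegral_add_right _ measurable_const, lintegral_const, lintegral_smul_measure,
    Measure.smul_apply, smul_eq_mul, smul_eq_mul, hγu] at c1
  refine c2.trans (add_le_add (c1.trans (add_le_add ?_ ?_)) ?_)
  · exact mul_le_of_le_one_left' ha1
  · gcongr; exact mul_le_of_le_one_left' ha1
  · gcongr

/-- Set functions on the measurable subsets of a space, with the product topology. -/
abbrev SetFun (X : Type*) [MeasurableSpace X] : Type _ := {A : Set X // MeasurableSet A} → ℝ

/-- The real-valued set function of a measure. -/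
def setFun {X : Type*} [MeasurableSpace X] (μ : Measure X) : SetFun X := fun A => μ.real A

theorem setFun_injOn {X : Type*} [MeasurableSpace X] :
    InjOn (setFun (X := X)) {μ | IsFiniteMeasure μ} := by
  intro μ hμ μ' hμ' h
  have : IsFiniteMeasure μ := hμ
  have : IsFiniteMeasure μ' := hμ'
  ext A hA
  have hA' : μ.real A = μ'.real A := congrFun h ⟨A, hA⟩
  exact (measureReal_eq_measureReal_iff).1 hA'

theorem exists_measure_of_dominated {X : Type*} [MeasurableSpace X] {ν : Measure X}
    [IsFiniteMeasure ν] {Φ : SetFun X} (h0 : ∀ A, 0 ≤ Φ A) (hν : ∀ A, Φ A ≤ ν.real A)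
    (hadd : ∀ A A' : {A : Set X // MeasurableSet A}, Disjoint A.1 A'.1 →
      Φ ⟨A.1 ∪ A'.1, A.2.union A'.2⟩ = Φ A + Φ A') :
    ∃ μ, μ ≤ ν ∧ setFun μ = Φ := by
  have hempty : Φ ⟨∅, MeasurableSet.empty⟩ = 0 :=
    le_antisymm ((hν _).trans (by simp)) (h0 _)
  have hsum : ∀ (f : ℕ → Set X) (hf : ∀ i, MeasurableSet (f i)),
      Pairwise (Function.onFun Disjoint f) →
      HasSum (fun i => Φ ⟨f i, hf i⟩) (Φ ⟨⋃ i, f i, MeasurableSet.iUnion hf⟩) := by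
    intro f hf hdisj
    have hnm : ∀ n : ℕ, MeasurableSet (⋃ i ∈ Finset.range n, f i) := fun n =>
      Finset.measurableSet_biUnion _ fun i _ => hf i
    have hnd : ∀ n : ℕ, Disjoint (⋃ i ∈ Finset.range n, f i) (f n) := by
      intro n
      refine disjoint_iUnion₂_left.2 fun i hi => hdisj ?_
      exact (Finset.mem_range.1 hi).ne
    have hfin : ∀ n, ∑ i ∈ Finset.range n, Φ ⟨f i, hf i⟩ = Φ ⟨_, hnm n⟩ := by
      intro n
      induction n with
      | zero => simpa using hempty.symm
      | succ n ih =>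
        rw [Finset.sum_range_succ, ih, ← hadd _ _ (hnd n)]
        congr 2
        rw [Finset.range_add_one, Finset.set_biUnion_insert, union_comm]
    have hdiff : ∀ n, Φ ⟨⋃ i, f i, MeasurableSet.iUnion hf⟩ =
        ∑ i ∈ Finset.range n, Φ ⟨f i, hf i⟩ +
          Φ ⟨(⋃ i, f i) \ ⋃ i ∈ Finset.range n, f i, (MeasurableSet.iUnion hf).diff (hnm n)⟩ := by
      intro n
      rw [hfin, ← hadd _ _ disjoint_sdiff_right]
      congr 2
      exact (union_sdiff_cancel (iUnion₂_subset fun i _ => subset_iUnion f i)).symm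
    have hνsum : HasSum (fun i => ν.real (f i)) (ν.real (⋃ i, f i)) := by
      have h := measure_iUnion (μ := ν) hdisj hf
      rw [measureReal_def, h, ENNReal.tsum_toReal_eq fun i => measure_ne_top _ _]
      exact ENNReal.hasSum_toReal (by rw [← h]; exact measure_ne_top _ _)
    rw [hasSum_iff_tendsto_nat_of_nonneg fun i => h0 _]
    have htail : Tendsto (fun n => Φ ⟨(⋃ i, f i) \ ⋃ i ∈ Finset.range n, f i,
        (MeasurableSet.iUnion hf).diff (hnm n)⟩) atTop (nhds 0) := by
      have h := hνsum.tendsto_sum_nat.const_sub (ν.real (⋃ i, f i))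
      rw [sub_self] at h
      refine squeeze_zero (fun n => h0 _) (fun n => (hν _).trans (le_of_eq ?_)) h
      rw [measureReal_sdiff (iUnion₂_subset fun i _ => subset_iUnion f i) (hnm n),
        measureReal_biUnion_finset (fun i _ j _ hij => hdisj hij) fun i _ => hf i]
    have h := htail.const_sub (Φ ⟨⋃ i, f i, MeasurableSet.iUnion hf⟩)
    rw [sub_zero] at h
    exact h.congr fun n => by rw [hdiff n, add_sub_cancel_right]
  set μ : Measure X := Measure.ofMeasurable (fun A hA => ENNReal.ofReal (Φ ⟨A, hA⟩))
    (by rw [hempty, ENNReal.ofReal_zero]) (fun f hf hdisj => by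
      rw [← (hsum f hf hdisj).tsum_eq,
        ENNReal.ofReal_tsum_of_nonneg (fun i => h0 _) (hsum f hf hdisj).summable]) with hμ
  have hμA : ∀ A (hA : MeasurableSet A), μ A = ENNReal.ofReal (Φ ⟨A, hA⟩) := fun A hA =>
    Measure.ofMeasurable_apply A hA
  refine ⟨μ, Measure.le_iff.2 fun A hA => ?_, ?_⟩
  · rw [hμA A hA, ← ofReal_measureReal]
    exact ENNReal.ofReal_le_ofReal (hν ⟨A, hA⟩)
  · ext A
    rw [setFun, measureReal_def, hμA A.1 A.2, ENNReal.toReal_ofReal (h0 _)]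

theorem isCompact_setFun_image {X : Type*} [MeasurableSpace X] (ν : Measure X) [IsFiniteMeasure ν]
    (m : ℝ) : IsCompact (setFun '' {μ | μ ≤ ν ∧ μ.real univ = m}) := by
  have heq : setFun '' {μ | μ ≤ ν ∧ μ.real univ = m} = {Φ : SetFun X |
      ((∀ A, 0 ≤ Φ A) ∧ ∀ A, Φ A ≤ ν.real A) ∧
      (∀ A A' : {A : Set X // MeasurableSet A}, Disjoint A.1 A'.1 →
        Φ ⟨A.1 ∪ A'.1, A.2.union A'.2⟩ = Φ A + Φ A') ∧ Φ ⟨univ, MeasurableSet.univ⟩ = m} := by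
    ext Φ
    constructor
    · rintro ⟨μ, ⟨hμ, hm⟩, rfl⟩
      have : IsFiniteMeasure μ := isFiniteMeasure_of_le ν hμ
      refine ⟨⟨fun A => measureReal_nonneg, fun A => ?_⟩, fun A A' h => ?_, hm⟩
      · exact ENNReal.toReal_mono (measure_ne_top _ _) (hμ A)
      · exact measureReal_union h A'.2
    · rintro ⟨⟨h0, hν⟩, hadd, hm⟩
      obtain ⟨μ, hμ, rfl⟩ := exists_measure_of_dominated h0 hν hadd
      exact ⟨μ, ⟨hμ, hm⟩, rfl⟩
  rw [heq]
  refine (isCompact_univ_pi fun A : {A : Set X // MeasurableSet A} =>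
    isCompact_Icc (a := 0) (b := ν.real A)).of_isClosed_subset ?_ fun Φ hΦ A _ =>
      ⟨hΦ.1.1 A, hΦ.1.2 A⟩
  simp only [ofPred_and, ofPred_forall]
  refine ((isClosed_iInter fun A => isClosed_le continuous_const (continuous_apply A)).inter
    (isClosed_iInter fun A => isClosed_le (continuous_apply A) continuous_const)).inter
    ((isClosed_iInter fun A => isClosed_iInter fun A' => isClosed_iInter fun _ => ?_).inter ?_)
  · exact isClosed_eq (continuous_apply _) ((continuous_apply A).add (continuous_apply A'))
  · exact isClosed_eq (continuous_apply _) continuous_const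

/-- The measure represented by a set function, if there is one. -/
def toMeas {X : Type*} [MeasurableSpace X] (Φ : SetFun X) : Measure X :=
  Function.invFunOn setFun {μ | IsFiniteMeasure μ} Φ

theorem toMeas_setFun {X : Type*} [MeasurableSpace X] (μ : Measure X) [h : IsFiniteMeasure μ] :
    toMeas (setFun μ) = μ :=
  setFun_injOn.leftInvOn_invFunOn h

theorem upperSemicontinuousOn_extCost {d : ℕ} (hd : 1 ≤ d) {k : Rd d → ℝ} (hpos : ∀ x, 0 ≤ k x)
    (h1 : H1 k) {m : ℝ} (hm : 0 < m) (r₁ : ℝ) :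
    UpperSemicontinuousOn (fun Φ => extCost (ecost k) (toMeas Φ))
      (setFun ''
        {μ | μ ≤ volume.restrict (Metric.closedBall (0 : Rd d) r₁) ∧ μ.real univ = m}) := by
  rintro _ ⟨μ, ⟨hμν, hμm⟩, rfl⟩ y hy
  obtain ⟨R, K, hR, hK0, htrunc, hK⟩ := exists_trunc hd h1 hm
  set B := Metric.closedBall (0 : Rd d) r₁ with hB
  have hνfin : IsFiniteMeasure (volume.restrict B) := ⟨by
    rw [Measure.restrict_apply_univ]; exact measure_closedBall_lt_top⟩
  have hμfin : IsFiniteMeasure μ := isFiniteMeasure_of_le _ hμν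
  have hmass : ∀ μ' : Measure (Rd d), μ' ≤ volume.restrict B → μ'.real univ = m →
      μ' univ = ENNReal.ofReal m := by
    intro μ' h h'
    have : IsFiniteMeasure μ' := isFiniteMeasure_of_le _ h
    rw [← h', ofReal_measureReal]
  dsimp only at hy
  rw [toMeas_setFun] at hy
  obtain ⟨γ, hγ1, hγ2, hγy⟩ := exists_plan_lt ((htrunc μ (hmass μ hμν hμm).le).trans_lt hy)
  obtain ⟨ε, hε, hεy⟩ := ENNReal.lt_iff_exists_add_pos_lt.1 hγy
  set ε₁ : ℝ := ε / (4 * m) with hε₁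
  have hε₁0 : 0 < ε₁ := by positivity
  set θ : ℝ := min (1 / 2) (ε / (4 * K * m)) with hθ
  have hθ0 : 0 < θ := by positivity
  have hθ1 : θ < 1 := (min_le_left _ _).trans_lt (by norm_num)
  obtain ⟨q, hq, hvol, hqfin, hcost⟩ := exists_fine_grid h1.1 hpos R hε₁0
  set a := ENNReal.ofReal (1 - θ) with ha
  have ha1 : a < 1 := by
    rw [ha, ← ENNReal.ofReal_one, ENNReal.ofReal_lt_ofReal_iff one_pos]; linarith
  have haθ : a + ENNReal.ofReal θ = 1 := by
    rw [ha, ← ENNReal.ofReal_add (by linarith) hθ0.le]; simp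
  have hμv : μ ≤ volume := hμν.trans Measure.restrict_le_self
  have hγu : γ univ = μ univ := by rw [← measure_univ_eq_of_map_fst, hγ1]
  have hγfin : IsFiniteMeasure γ := ⟨by rw [hγu]; exact measure_lt_top _ _⟩
  have hev : ∀ᶠ Φ in nhds (setFun μ), ∀ n ∈ q '' B,
      (a * μ (q ⁻¹' {n}) ≤ ENNReal.ofReal (Φ ⟨_, hq n⟩)) ∧
      (γ.map Prod.snd (q ⁻¹' {n}) = 0 ∨ a * γ.map Prod.snd (q ⁻¹' {n}) +
        ENNReal.ofReal (Φ ⟨_, hq n⟩) ≤ volume (q ⁻¹' {n})) := by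
    refine (Filter.eventually_all_finite (hqfin r₁)).2 fun n _ => ?_
    have hcont : Tendsto (fun Φ : SetFun (Rd d) => ENNReal.ofReal (Φ ⟨_, hq n⟩))
        (nhds (setFun μ)) (nhds (μ (q ⁻¹' {n}))) := by
      have h : Tendsto (fun Φ : SetFun (Rd d) => ENNReal.ofReal (Φ ⟨_, hq n⟩))
        (nhds (setFun μ)) (nhds (ENNReal.ofReal (μ.real (q ⁻¹' {n})))) :=
        (ENNReal.continuous_ofReal.comp
          (continuous_apply (⟨_, hq n⟩ : {A // MeasurableSet A}))).tendsto _
      rwa [ofReal_measureReal] at h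
    have hstrict : ∀ {x : ℝ≥0∞}, x ≠ 0 → x ≠ ⊤ → a * x < x := by
      intro x h0 ht
      conv_rhs => rw [← one_mul x]
      exact (ENNReal.mul_lt_mul_iff_left h0 ht).2 ha1
    refine Eventually.and ?_ ?_
    · by_cases h0 : μ (q ⁻¹' {n}) = 0
      · simp [h0]
      · exact (hcont.eventually (lt_mem_nhds (hstrict h0 (measure_ne_top _ _)))).mono
          fun _ h => h.le
    · by_cases h0 : γ.map Prod.snd (q ⁻¹' {n}) = 0
      · simp [h0]
      · have hlt : a * γ.map Prod.snd (q ⁻¹' {n}) + μ (q ⁻¹' {n}) < volume (q ⁻¹' {n}) := by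
          refine lt_of_lt_of_le ?_ (hγ2 _)
          rw [Measure.add_apply, add_comm]
          exact ENNReal.add_lt_add_left (measure_ne_top _ _) (hstrict h0 (measure_ne_top _ _))
        exact ((hcont.const_add _).eventually (gt_mem_nhds hlt)).mono fun _ h => .inr h.le
  filter_upwards [mem_nhdsWithin_of_mem_nhds hev, self_mem_nhdsWithin] with Φ hΦ hΦK
  obtain ⟨μ', ⟨hμ'ν, hμ'm⟩, rfl⟩ := hΦK
  have hμ'fin : IsFiniteMeasure μ' := isFiniteMeasure_of_le _ hμ'ν
  have hμ'v : μ' ≤ volume := hμ'ν.trans Measure.restrict_le_self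
  rw [toMeas_setFun]
  have hΦ' : ∀ n, ENNReal.ofReal (setFun μ' ⟨_, hq n⟩) = μ' (q ⁻¹' {n}) := fun n =>
    ofReal_measureReal
  simp only [hΦ'] at hΦ
  have hnull : ∀ n ∉ q '' B, ∀ σ : Measure (Rd d), σ ≤ volume.restrict B → σ (q ⁻¹' {n}) = 0 := by
    intro n hn σ hσ
    refine le_antisymm ((hσ _).trans ?_) bot_le
    rw [Measure.restrict_apply (hq n)]
    convert (measure_empty (μ := volume)).le
    refine eq_empty_of_forall_notMem fun x hx => hn ⟨x, hx.2, hx.1⟩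
  have hγv : γ.map Prod.snd ≤ volume := le_trans (Measure.le_add_left le_rfl) hγ2
  have hmain := extCost_le_of_cells h1.1 hq hvol hcost hμ'v
    ((hmass μ' hμ'ν hμ'm).trans (hmass μ hμν hμm).symm) haθ
    (hK μ' · · (hmass μ' hμ'ν hμ'm).le) hγ1 (fun n => by
      by_cases hn : n ∈ q '' B
      · exact (hΦ n hn).1
      · simp [hnull n hn μ hμν]) (fun n => by
      by_cases hn : n ∈ q '' B
      · rcases (hΦ n hn).2 with h | h
        · simpa [h] using hμ'v _
        · exact h
      · rw [hnull n hn μ' hμ'ν, add_zero]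
        exact (mul_le_of_le_one_left' ha1.le).trans (hγv _))
  refine hmain.trans_lt (lt_of_le_of_lt ?_ hεy)
  rw [hmass μ hμν hμm, ← ENNReal.ofReal_mul hε₁0.le, ← ENNReal.ofReal_mul hθ0.le,
    ← ENNReal.ofReal_mul hK0.le, add_assoc, add_assoc, ← ENNReal.ofReal_add (by positivity)
    (by positivity), ← ENNReal.ofReal_add (by positivity) (by positivity)]
  gcongr
  rw [← ENNReal.ofReal_coe_nnreal]
  refine ENNReal.ofReal_le_ofReal ?_
  have e1 : ε₁ * m = ε / 4 := by rw [hε₁]; field_simp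
  have e2 : K * (θ * m) ≤ ε / 4 := by
    calc K * (θ * m) ≤ K * (ε / (4 * K * m) * m) := by gcongr; exact min_le_right _ _
      _ = _ := by field_simp
  have : (0 : ℝ) < ε := hε
  linarith

theorem exists_restrict_or_intermediate {X : Type*} [MeasurableSpace X] {μ ν : Measure X}
    [IsFiniteMeasure ν] (hμ : μ ≤ ν) :
    (∃ E, MeasurableSet E ∧ μ = ν.restrict E) ∨
      ∃ S, MeasurableSet S ∧ ν S ≠ 0 ∧ ∃ ε : ℝ≥0∞, ε ≠ 0 ∧ ε ≠ ⊤ ∧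
        ε • ν.restrict S ≤ μ ∧ μ + ε • ν.restrict S ≤ ν := by
  have : IsFiniteMeasure μ := isFiniteMeasure_of_le ν hμ
  set f := μ.rnDeriv ν with hf
  have hfm : Measurable f := Measure.measurable_rnDeriv _ _
  have hμf : ν.withDensity f = μ :=
    Measure.withDensity_rnDeriv_eq μ ν (Measure.absolutelyContinuous_of_le hμ)
  have hf1 : ∀ᵐ x ∂ν, f x ≤ 1 := Measure.rnDeriv_le_one_of_le hμ
  set S : ℕ → Set X := fun n => {x | ((n : ℝ≥0∞) + 1)⁻¹ ≤ f x} ∩ {x | f x + ((n : ℝ≥0∞) + 1)⁻¹ ≤ 1}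
    with hS
  have hSm : ∀ n, MeasurableSet (S n) := fun n =>
    (measurableSet_le measurable_const hfm).inter
      (measurableSet_le (hfm.add measurable_const) measurable_const)
  have hεm : ∀ n : ℕ, ((n : ℝ≥0∞) + 1)⁻¹ • ν.restrict (S n) =
      ν.withDensity ((S n).indicator fun _ => ((n : ℝ≥0∞) + 1)⁻¹) := fun n => by
    rw [withDensity_indicator (hSm n), withDensity_const]
  by_cases hall : ∀ n, ν (S n) = 0
  · refine .inl ⟨f ⁻¹' {1}, hfm (measurableSet_singleton 1), ?_⟩
    rw [← hμf, ← withDensity_indicator_one (hfm (measurableSet_singleton 1))]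
    refine withDensity_congr_ae ?_
    have hall' : ∀ᵐ x ∂ν, ∀ n, x ∉ S n :=
        ae_all_iff.2 fun n => measure_eq_zero_iff_ae_notMem.1 (hall n)
    filter_upwards [hall', hf1] with x hx hx1
    by_cases hx' : f x = 1
    · rw [indicator_of_mem (by exact hx')]; exact hx'
    rw [indicator_of_notMem (by exact hx')]
    by_contra h0
    have hlt := lt_of_le_of_ne hx1 hx'
    have hd : 1 - f x ≠ 0 := (tsub_pos_of_lt hlt).ne'
    obtain ⟨n, hn⟩ := ENNReal.exists_inv_nat_lt (lt_min (pos_iff_ne_zero.2 h0) (pos_iff_ne_zero.2 hd)).ne'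
    have hn' : ((n : ℝ≥0∞) + 1)⁻¹ ≤ min (f x) (1 - f x) :=
      (ENNReal.inv_le_inv.2 le_self_add).trans hn.le
    refine hx n ⟨hn'.trans (min_le_left _ _), ?_⟩
    calc _ ≤ f x + (1 - f x) := by gcongr; exact hn'.trans (min_le_right _ _)
      _ = 1 := add_tsub_cancel_of_le hx1
  · push Not at hall
    obtain ⟨n, hn⟩ := hall
    refine .inr ⟨S n, hSm n, hn, ((n : ℝ≥0∞) + 1)⁻¹, ENNReal.inv_ne_zero.2 (by simp),
      ENNReal.inv_ne_top.2 (by simp), ?_, ?_⟩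
    · rw [hεm, ← hμf]
      refine withDensity_mono (Eventually.of_forall fun x => ?_)
      exact indicator_apply_le fun hx => hx.1
    · rw [hεm]
      conv_lhs => rw [← hμf]
      rw [← withDensity_add_left hfm]
      conv_rhs => rw [← withDensity_one (μ := ν)]
      refine withDensity_mono ?_
      filter_upwards [hf1] with x hx
      by_cases hxS : x ∈ S n
      · simpa [hxS] using hxS.2
      · simpa [hxS] using hx

theorem extCost_average_le {d : ℕ} (c : Rd d → ℝ≥0∞) {μ μ₁ μ₂ : Measure (Rd d)}
    (h : μ = (2 : ℝ≥0∞)⁻¹ • μ₁ + (2 : ℝ≥0∞)⁻¹ • μ₂) :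
    extCost c μ ≤ 2⁻¹ * extCost c μ₁ + 2⁻¹ * extCost c μ₂ := by
  have h2 : (2 : ℝ≥0∞)⁻¹ ≠ ⊤ := by simp
  have h20 : (2 : ℝ≥0∞)⁻¹ ≠ 0 := by simp
  simp only [extCost.eq_1 _ μ₁, extCost.eq_1 _ μ₂, ENNReal.mul_iInf_of_ne h20 h2, ENNReal.iInf_add,
    ENNReal.add_iInf]
  refine le_iInf₂ fun γ₂ h2 => le_iInf₂ fun γ₁ h1 => ?_
  refine (extCost_le c (γ := (2 : ℝ≥0∞)⁻¹ • γ₁ + (2 : ℝ≥0∞)⁻¹ • γ₂) ?_ ?_).trans (le_of_eq ?_)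
  · rw [Measure.map_add _ _ measurable_fst, Measure.map_smul, Measure.map_smul, h1.1, h2.1, h]
  · rw [Measure.map_add _ _ measurable_snd, Measure.map_smul, Measure.map_smul, h,
      add_add_add_comm, ← smul_add, ← smul_add]
    have hv : (volume : Measure (Rd d)) = (2 : ℝ≥0∞)⁻¹ • volume + (2 : ℝ≥0∞)⁻¹ • volume := by
      rw [← add_smul, ENNReal.inv_two_add_inv_two, one_smul]
    rw [hv]
    refine Measure.le_iff.2 fun A _ => ?_
    have e1 := h1.2 A
    have e2 := h2.2 A
    simp only [Measure.add_apply, Measure.smul_apply, smul_eq_mul] at e1 e2 ⊢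
    gcongr
  · simp [dispCost]

theorem exists_extremal_maximizer {d : ℕ} (hd : 1 ≤ d) {k : Rd d → ℝ} (hpos : ∀ x, 0 ≤ k x)
    (h1 : H1 k) {m : ℝ} (hm : 0 < m) {r₁ : ℝ} {μ₀ : Measure (Rd d)}
    (hμ₀ : μ₀ ≤ volume.restrict (Metric.closedBall 0 r₁)) (hμ₀m : μ₀.real univ = m) :
    ∃ E : Set (Rd d), MeasurableSet E ∧ volume E = ENNReal.ofReal m ∧
      ∀ μ ≤ volume.restrict (Metric.closedBall 0 r₁), μ.real univ = m →
        extCost (ecost k) μ ≤ extCost (ecost k) (volume.restrict E) := by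
  set ν := volume.restrict (Metric.closedBall (0 : Rd d) r₁) with hν
  have hνfin : IsFiniteMeasure ν := ⟨by
    rw [hν, Measure.restrict_apply_univ]; exact measure_closedBall_lt_top⟩
  have hfin : ∀ μ ≤ ν, IsFiniteMeasure μ := fun μ hμ => isFiniteMeasure_of_le ν hμ
  set D : Set (SetFun (Rd d)) := setFun '' {μ | μ ≤ ν ∧ μ.real univ = m} with hD
  have hDc : IsCompact D := isCompact_setFun_image ν m
  set U : SetFun (Rd d) → ℝ≥0∞ := fun Φ => extCost (ecost k) (toMeas Φ) with hU
  have hUs : UpperSemicontinuousOn U D := upperSemicontinuousOn_extCost hd hpos h1 hm r₁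
  have hUμ : ∀ μ ≤ ν, U (setFun μ) = extCost (ecost k) μ := fun μ hμ => by
    have := hfin μ hμ
    simp only [hU, toMeas_setFun]
  obtain ⟨Φ₀, hΦ₀, hmax⟩ := hUs.exists_isMaxOn (⟨_, μ₀, ⟨hμ₀, hμ₀m⟩, rfl⟩ : D.Nonempty) hDc
  set M := {Φ ∈ D | U Φ₀ ≤ U Φ} with hM
  have hMc : IsCompact M := by
    refine hDc.of_isClosed_subset ?_ fun Φ h => h.1
    refine isClosed_of_closure_subset fun Φ hΦ => ?_
    have hΦD : Φ ∈ D := hDc.isClosed.closure_subset_iff.2 (fun Φ h => h.1) hΦ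
    refine ⟨hΦD, not_lt.1 fun hlt => ?_⟩
    have h := hUs Φ hΦD _ hlt
    rw [eventually_nhdsWithin_iff] at h
    obtain ⟨Φ', h', hΦ'⟩ := ((mem_closure_iff_frequently.1 hΦ).and_eventually h).exists
    exact absurd (hΦ' h'.1) (not_lt.2 h'.2)
  obtain ⟨Φ, hΦ⟩ := hMc.extremePoints_nonempty ⟨Φ₀, hΦ₀, le_rfl⟩
  rw [mem_extremePoints] at hΦ
  obtain ⟨⟨⟨μ, ⟨hμν, hμm⟩, rfl⟩, hΦM⟩, hext⟩ := hΦ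
  have hμf := hfin μ hμν
  have hbest : ∀ μ' ≤ ν, μ'.real univ = m → extCost (ecost k) μ' ≤ extCost (ecost k) μ := by
    intro μ' hμ' hμ'm
    rw [← hUμ μ' hμ', ← hUμ μ hμν]
    exact (hmax ⟨μ', ⟨hμ', hμ'm⟩, rfl⟩).trans hΦM
  rcases exists_restrict_or_intermediate hμν with ⟨E, hE, rfl⟩ | ⟨S, hS, hS0, ε, hε0, hεt, hle, hge⟩
  · rw [hν, Measure.restrict_restrict hE] at hbest hμm
    refine ⟨_, hE.inter Metric.isClosed_closedBall.measurableSet, ?_, hbest⟩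
    have : IsFiniteMeasure (volume.restrict (E ∩ Metric.closedBall (0 : Rd d) r₁)) := by
      rwa [hν, Measure.restrict_restrict hE] at hμf
    rw [← Measure.restrict_apply_univ, ← ofReal_measureReal, hμm]
  exfalso
  set S' := S ∩ Metric.closedBall (0 : Rd d) r₁ with hS'
  have hS'm : MeasurableSet S' := hS.inter Metric.isClosed_closedBall.measurableSet
  have hS'v : volume S' ≠ 0 := by rwa [hν, Measure.restrict_apply hS] at hS0
  have hS't : volume S' ≠ ⊤ :=
    measure_ne_top_of_subset inter_subset_right measure_closedBall_lt_top.ne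
  obtain ⟨S₁, hS₁, hS₁m, hS₁v⟩ := exists_subset_volume_eq hd hS'm hS't (t := volume S' / 2)
    ENNReal.half_le_self
  set S₂ := S' \ S₁ with hS₂
  have hS₂m : MeasurableSet S₂ := hS'm.diff hS₁m
  have hS₁t : volume S₁ ≠ ⊤ := measure_ne_top_of_subset hS₁ hS't
  have hhalf : volume S' / 2 ≠ 0 := by simpa using hS'v
  have hS₂v : volume S₂ = volume S' / 2 := by
    rw [hS₂, measure_sdiff hS₁ hS₁m.nullMeasurableSet hS₁t, hS₁v, ENNReal.sub_half hS't]
  set σ : Set (Rd d) → Measure (Rd d) := fun A => ε • volume.restrict A with hσ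
  have hσsum : σ S₁ + σ S₂ = ε • ν.restrict S := by
    rw [hν, Measure.restrict_restrict hS, hσ]
    simp only
    rw [← smul_add, ← Measure.restrict_union disjoint_sdiff_right hS₂m,
      union_sdiff_cancel hS₁]
  have hσu : ∀ A, σ A univ = ε * volume A := fun A => by simp [hσ]
  rw [← hσsum] at hle hge
  have hσfin : IsFiniteMeasure (σ S₁ + σ S₂) := hfin _ (hle.trans hμν)
  have hσ₁fin : IsFiniteMeasure (σ S₁) := isFiniteMeasure_of_le _ (Measure.le_add_right le_rfl :
    σ S₁ ≤ σ S₁ + σ S₂)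
  have hσ₂fin : IsFiniteMeasure (σ S₂) := isFiniteMeasure_of_le _ (Measure.le_add_left le_rfl :
    σ S₂ ≤ σ S₁ + σ S₂)
  set τ := μ - (σ S₁ + σ S₂) with hτ
  have hτμ : τ + (σ S₁ + σ S₂) = μ := Measure.sub_add_cancel_of_le hle
  have hτfin : IsFiniteMeasure τ := isFiniteMeasure_of_le μ Measure.sub_le
  have hmem : ∀ A A', σ A + σ A' = σ S₁ + σ S₂ → volume A = volume A' →
      IsFiniteMeasure (σ A) → IsFiniteMeasure (σ A') →
      τ + (σ A + σ A) ≤ ν ∧ (τ + (σ A + σ A)).real univ = m := by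
    intro A A' hsum hv hf hf'
    constructor
    · refine le_trans ?_ hge
      rw [← hτμ, ← hsum]
      refine Measure.le_iff.2 fun C _ => ?_
      simp only [Measure.add_apply]
      calc τ C + (σ A C + σ A C) ≤ τ C + (σ A C + σ A C) + (σ A' C + σ A' C) := le_self_add
        _ = _ := by ring
    · rw [← hμm, ← hτμ, ← hsum, measureReal_def, measureReal_def]
      simp only [Measure.add_apply, hσu, hv]
  have e1 := hmem S₁ S₂ rfl (by rw [hS₁v, hS₂v]) hσ₁fin hσ₂fin
  have e2 := hmem S₂ S₁ (add_comm _ _) (by rw [hS₁v, hS₂v]) hσ₂fin hσ₁fin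
  have hself : ∀ ρ : Measure (Rd d), (2 : ℝ≥0∞)⁻¹ • ρ + (2 : ℝ≥0∞)⁻¹ • ρ = ρ := fun ρ => by
    rw [← add_smul, ENNReal.inv_two_add_inv_two, one_smul]
  have havg : μ = (2 : ℝ≥0∞)⁻¹ • (τ + (σ S₁ + σ S₁)) + (2 : ℝ≥0∞)⁻¹ • (τ + (σ S₂ + σ S₂)) := by
    conv_lhs => rw [← hτμ, ← hself τ, ← hself (σ S₁), ← hself (σ S₂)]
    simp only [smul_add]
    abel
  have hsfin : extCost (ecost k) μ ≠ ⊤ := by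
    obtain ⟨-, K, -, -, -, hK⟩ := exists_trunc hd h1 hm
    refine ne_top_of_le_ne_top ?_ (hK μ 0 μ (by rw [← hμm, ofReal_measureReal]) (by simp)
      (by simpa using hμν.trans Measure.restrict_le_self))
    simp [dispCost, ENNReal.mul_eq_top]
  have hU₀ : U Φ₀ ≤ extCost (ecost k) μ := by rw [← hUμ μ hμν]; exact hΦM
  have hhalves : ∀ μ₁ μ₂ : Measure (Rd d), μ₂ ≤ ν → μ₂.real univ = m →
      μ = (2 : ℝ≥0∞)⁻¹ • μ₁ + (2 : ℝ≥0∞)⁻¹ • μ₂ → extCost (ecost k) μ ≤ extCost (ecost k) μ₁ := by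
    intro μ₁ μ₂ h2 h2m h
    have hle := (extCost_average_le (ecost k) h).trans
      (add_le_add_right (mul_le_mul_right (hbest μ₂ h2 h2m) 2⁻¹) _)
    conv_lhs at hle => rw [← one_mul (extCost _ _), ← ENNReal.inv_two_add_inv_two, add_mul]
    have h2t : (2 : ℝ≥0∞)⁻¹ ≠ ⊤ := by simp
    exact (ENNReal.mul_le_mul_iff_right (by simp) h2t).1
      ((ENNReal.add_le_add_iff_right (ENNReal.mul_ne_top h2t hsfin)).1 hle)
  have hm1 : setFun (τ + (σ S₁ + σ S₁)) ∈ M := ⟨⟨_, e1, rfl⟩, by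
    rw [hUμ _ e1.1]
    exact hU₀.trans (hhalves _ _ e2.1 e2.2 havg)⟩
  have hm2 : setFun (τ + (σ S₂ + σ S₂)) ∈ M := ⟨⟨_, e2, rfl⟩, by
    rw [hUμ _ e2.1]
    exact hU₀.trans (hhalves _ _ e1.1 e1.2 (by rw [add_comm]; exact havg))⟩
  have hadd : ∀ A A', IsFiniteMeasure (σ A) → IsFiniteMeasure (σ A') → ∀ B,
      (τ + (σ A + σ A')).real B = τ.real B + ((σ A).real B + (σ A').real B) := by
    intro A A' _ _ B
    rw [measureReal_add_apply (measure_ne_top _ _) (measure_ne_top _ _),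
      measureReal_add_apply (measure_ne_top _ _) (measure_ne_top _ _)]
  have hseg : setFun μ ∈ openSegment ℝ
      (setFun (τ + (σ S₁ + σ S₁))) (setFun (τ + (σ S₂ + σ S₂))) := by
    refine ⟨1 / 2, 1 / 2, by norm_num, by norm_num, by norm_num, ?_⟩
    ext A
    simp only [Pi.add_apply, Pi.smul_apply, setFun, smul_eq_mul, ← hτμ]
    rw [hadd S₁ S₁ hσ₁fin hσ₁fin, hadd S₂ S₂ hσ₂fin hσ₂fin, hadd S₁ S₂ hσ₁fin hσ₂fin]
    ring
  have heq := (hext _ hm1 _ hm2 hseg).1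
  have h' : (τ + (σ S₁ + σ S₁)).real S₁ = μ.real S₁ := congrFun heq ⟨S₁, hS₁m⟩
  have hz : σ S₂ S₁ = 0 := by
    simp only [hσ, Measure.smul_apply, Measure.restrict_apply hS₁m, smul_eq_mul]
    rw [disjoint_sdiff_right.inter_eq, measure_empty, mul_zero]
  rw [← hτμ, hadd S₁ S₁ hσ₁fin hσ₁fin, hadd S₁ S₂ hσ₁fin hσ₂fin] at h'
  have h'' : (σ S₁).real S₁ = (σ S₂).real S₁ := by linarith
  rw [measureReal_def (σ S₂), hz, ENNReal.toReal_zero, measureReal_eq_zero_iff] at h''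
  simp only [hσ, Measure.smul_apply, Measure.restrict_apply_self, smul_eq_mul, mul_eq_zero] at h''
  rw [hS₁v] at h''
  exact h''.elim hε0 hhalf

theorem exists_volume_eq {d : ℕ} (hd : 1 ≤ d) (m : ℝ) :
    ∃ E : Set (Rd d), MeasurableSet E ∧ volume E = ENNReal.ofReal m := by
  have : Nonempty (Fin d) := ⟨⟨0, by omega⟩⟩
  have : Nontrivial (Rd d) := inferInstance
  have : NoncompactSpace (Rd d) := NormedSpace.noncompactSpace ℝ _
  have huniv : ENNReal.ofReal m < volume (univ : Set (Rd d)) := by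
    rw [measure_univ_of_isAddLeftInvariant]
    exact ENNReal.ofReal_lt_top
  obtain ⟨A, hA, -, hmA, hAt⟩ := Measure.exists_subset_measure_lt_top MeasurableSet.univ huniv
  obtain ⟨E, -, hE, hEm⟩ := exists_subset_volume_eq hd hA hAt.ne hmA.le
  exact ⟨E, hE, hEm⟩

theorem extCost_le_energy {d : ℕ} {k : Rd d → ℝ} {m : ℝ} (hm : 0 ≤ m) {μ : Measure (Rd d)}
    (hμ : μ ≤ volume) (hμm : μ univ = ENNReal.ofReal m) :
    extCost (ecost k) μ ≤ Energy (transCost k) m := by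
  have : IsFiniteMeasure μ := ⟨hμm ▸ ENNReal.ofReal_lt_top⟩
  obtain ⟨f, hf, -, rfl⟩ := exists_density hμ
  rw [fMeas_univ hf,
    ENNReal.ofReal_eq_ofReal_iff (integral_nonneg fun x => (hf.2 x).1) hm] at hμm
  rw [← ups_eq_extCost hf]
  exact le_iSup₂ (f := fun f _ => Ups (transCost k) f) f ⟨hf, hμm⟩

theorem energySet_le_energy {d : ℕ} (hd : 1 ≤ d) {k : Rd d → ℝ} (hpos : ∀ x, 0 ≤ k x)
    (h1 : H1 k) {m : ℝ} (hm : 0 ≤ m) :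
    EnergySet (transCost k) m ≤ Energy (transCost k) m := by
  refine iSup₂_le fun E ⟨hE, hEm⟩ => ?_
  refine (upsSet_le hd hpos h1 hE (hEm ▸ ENNReal.ofReal_ne_top)).trans ?_
  exact extCost_le_energy hm Measure.restrict_le_self (by rw [Measure.restrict_apply_univ, hEm])

theorem energy_le {d : ℕ} {k : Rd d → ℝ} {m : ℝ} {B : ℝ≥0∞}
    (h : ∀ μ : Measure (Rd d), μ ≤ volume → μ univ = ENNReal.ofReal m →
      extCost (ecost k) μ ≤ B) : Energy (transCost k) m ≤ B := by
  refine iSup₂_le fun f ⟨hf, hfm⟩ => ?_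
  rw [ups_eq_extCost hf]
  exact h _ (fMeas_le_volume hf) (by rw [fMeas_univ hf, hfm])

theorem energy_ne_top {d : ℕ} (hd : 1 ≤ d) {k : Rd d → ℝ} (h1 : H1 k) {m : ℝ} (hm : 0 < m) :
    Energy (transCost k) m ≠ ⊤ := by
  obtain ⟨R, K, -, -, -, hfin⟩ := exists_trunc hd h1 hm
  refine ne_top_of_le_ne_top (b := ENNReal.ofReal K * ENNReal.ofReal m) (by finiteness)
    (energy_le fun μ hμ hμm => ?_)
  simpa [dispCost, hμm] using hfin μ 0 μ hμm.le (by simp) (by simpa using hμ)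

theorem exists_energy_le_extCost_restrict {d : ℕ} (hd : 1 ≤ d) {k : Rd d → ℝ}
    (hpos : ∀ x, 0 ≤ k x) (h1 : H1 k) (h3 : H3 k) {m : ℝ} (hm : 0 < m) :
    ∃ E : Set (Rd d), MeasurableSet E ∧ volume E = ENNReal.ofReal m ∧
      Energy (transCost k) m ≤ extCost (ecost k) (volume.restrict E) := by
  have hfin := energy_ne_top hd h1 hm
  rcases eq_or_ne (Energy (transCost k) m) 0 with h0 | h0
  · obtain ⟨E, hE, hEm⟩ := exists_volume_eq hd m
    exact ⟨E, hE, hEm, h0 ▸ zero_le⟩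
  set e := (Energy (transCost k) m).toReal / 2 with he
  have he0 : 0 < e := half_pos (ENNReal.toReal_pos h0 hfin)
  have heE : ENNReal.ofReal e < Energy (transCost k) m :=
    (ENNReal.ofReal_lt_iff_lt_toReal he0.le hfin).2 (by linarith)
  have hmul : ENNReal.ofReal (e / m) * ENNReal.ofReal m = ENNReal.ofReal e := by
    rw [← ENNReal.ofReal_mul (by positivity), div_mul_cancel₀ _ hm.ne']
  obtain ⟨r₁, htight⟩ := exists_tight hd hpos h1 h3 hm (div_pos he0 hm)
  have hball : ∀ μ : Measure (Rd d), μ ≤ volume → μ univ = ENNReal.ofReal m →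
      ENNReal.ofReal e < extCost (ecost k) μ →
      ∃ μ' ≤ volume.restrict (Metric.closedBall 0 r₁), μ'.real univ = m ∧
        extCost (ecost k) μ ≤ extCost (ecost k) μ' := by
    intro μ hμ hμm hμe
    obtain ⟨μ', hμ', hμ'm, hsupp, hle⟩ := htight μ hμ hμm (by rwa [hμm, hmul])
    refine ⟨μ', ?_, by rw [measureReal_def, hμ'm, ENNReal.toReal_ofReal hm.le], hle⟩
    rw [← Measure.restrict_eq_self_of_ae_mem (μ := μ') (s := Metric.closedBall 0 r₁) hsupp]
    exact Measure.restrict_mono subset_rfl hμ'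
  have hex : ∃ μ : Measure (Rd d), μ ≤ volume ∧ μ univ = ENNReal.ofReal m ∧
      ENNReal.ofReal e < extCost (ecost k) μ := by
    by_contra! h
    exact heE.not_ge (energy_le h)
  obtain ⟨μ₀, hμ₀, hμ₀m, hμ₀e⟩ := hex
  obtain ⟨μ₁, hμ₁, hμ₁m, hμ₁e⟩ := hball μ₀ hμ₀ hμ₀m hμ₀e
  obtain ⟨E, hE, hEm, hmax⟩ := exists_extremal_maximizer hd hpos h1 hm hμ₁ hμ₁m
  refine ⟨E, hE, hEm, energy_le fun μ hμ hμm => ?_⟩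
  rcases le_or_gt (extCost (ecost k) μ) (ENNReal.ofReal e) with h | h
  · exact h.trans (hμ₀e.le.trans (hμ₁e.trans (hmax μ₁ hμ₁ hμ₁m)))
  · obtain ⟨μ', hμ', hμ'm, hle⟩ := hball μ hμ hμm h
    exact hle.trans (hmax μ' hμ' hμ'm)

/-- under (H1),(H2),(H3), for every `m > 0` the supremum defining `ℰ_set(m)` is
attained by some measurable set `E`, and `ℰ_set(m) = ℰ(m)`. -/
theorem stmt_1 {d : ℕ} (hd : 1 ≤ d) (k : Rd d → ℝ) (hpos : ∀ x, 0 ≤ k x)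
    (h1 : H1 k) (h2 : H2 k) (h3 : H3 k) (m : ℝ) (hm : 0 < m) :
    (∃ E : Set (Rd d), MeasurableSet E ∧ MeasureTheory.volume E = ENNReal.ofReal m ∧
        UpsSet (transCost k) E = EnergySet (transCost k) m) ∧
    EnergySet (transCost k) m = Energy (transCost k) m := by
  obtain ⟨E, hE, hEm, hle⟩ := exists_energy_le_extCost_restrict hd hpos h1 h3 hm
  have hup : UpsSet (transCost k) E ≤ EnergySet (transCost k) m :=
    le_iSup₂ (f := fun E _ => UpsSet (transCost k) E) E ⟨hE, hEm⟩
  have hset := energySet_le_energy hd hpos h1 hm.le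
  have hEn := hle.trans (le_upsSet k)
  exact ⟨⟨E, hE, hEm, le_antisymm hup (hset.trans hEn)⟩, le_antisymm hset (hEn.trans hup)⟩
end
end

section
/- Assume c(x,y) = k(y−x) with k satisfying (H1), (H2) and (H3). For every m > 0 there exist R_* = R_*(m) > 0 and ε_0 = ε_0(m) > 0 with the following property: for every 0 < ε ≤ ε_0 and every f ∈ L^1(ℝ^d,[0,1]) with ∫ f dx = m and Υ(f) ≥ ℰ(m) − ε, there exists z ∈ ℝ^d such that ∫_{ℝ^d ∖ B_{R_*}(z)} f dx ≤ (2m/ℰ(m))·ε. -/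
open MeasureTheory ENNReal Filter Set

noncomputable section

namespace ExteriorTransport

open scoped Topology

variable {d : ℕ}

/-- Proportional local allocation: a finite measure `μ` on `Ω`, located in `ℝ^d` through `φ`, can
be sent into the capacity `σ` within distance `s` as soon as every ball of radius `s` centred at a
relevant point has capacity at least `C` and every ball of radius `s` carries mass at most `C`. -/
theorem exists_local_plan {Ω : Type*} [MeasurableSpace Ω] (μ : Measure Ω) [IsFiniteMeasure μ]
    (σ : Measure (Rd d)) [SFinite σ] {φ : Ω → Rd d} (hφ : Measurable φ) (s : ℝ) {C : ℝ≥0∞}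
    (hC0 : C ≠ 0) (hCtop : C ≠ ⊤) (hσ : ∀ᵐ ω ∂μ, C ≤ σ (Metric.ball (φ ω) s))
    (hfin : ∀ y, σ (Metric.ball y s) ≠ ⊤) (hμ : ∀ y, μ (φ ⁻¹' Metric.ball y s) ≤ C) :
    ∃ π : Measure (Ω × Rd d), π.map Prod.fst = μ ∧ π.map Prod.snd ≤ σ ∧
      ∀ᵐ p ∂π, dist p.2 (φ p.1) < s := by
  classical
  set S : Set (Ω × Rd d) := {p | dist p.2 (φ p.1) < s} with hS
  have hSm : MeasurableSet S :=
    measurableSet_lt (measurable_snd.dist (hφ.comp measurable_fst)) measurable_const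
  have hslice : ∀ ω, Prod.mk ω ⁻¹' S = Metric.ball (φ ω) s := fun ω => by
    ext y; simp [hS]
  have hslice' : ∀ y, (fun ω => (ω, y)) ⁻¹' S = φ ⁻¹' Metric.ball y s := fun y => by
    ext ω; simp [hS, dist_comm]
  have hN : Measurable fun ω => σ (Metric.ball (φ ω) s) := by
    have := measurable_measure_prodMk_left (ν := σ) hSm
    simpa only [hslice] using this
  set w : Ω × Rd d → ℝ≥0∞ := S.indicator fun p => (σ (Metric.ball (φ p.1) s))⁻¹ with hw
  have hwm : Measurable w := (hN.inv.comp measurable_fst).indicator hSm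
  refine ⟨(μ.prod σ).withDensity w, ?_, ?_, ?_⟩
  · ext A hA
    rw [Measure.map_apply measurable_fst hA, withDensity_apply _ (measurable_fst hA),
      ← lintegral_indicator (measurable_fst hA),
      lintegral_prod _ (hwm.indicator (measurable_fst hA)).aemeasurable]
    rw [← lintegral_indicator_one hA]
    refine lintegral_congr_ae ?_
    filter_upwards [hσ] with ω hω
    by_cases hωA : ω ∈ A
    · have h0 : σ (Metric.ball (φ ω) s) ≠ 0 := fun h => hC0 (by simpa [h] using hω)
      have : ∀ y, (Prod.fst ⁻¹' A).indicator w (ω, y)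
          = (Metric.ball (φ ω) s).indicator (fun _ => (σ (Metric.ball (φ ω) s))⁻¹) y := by
        intro y
        rw [Set.indicator_of_mem (by simpa using hωA)]
        simp only [hw, Set.indicator, hS, Set.mem_ofPred_eq, Metric.mem_ball]
      simp only [this]
      rw [lintegral_indicator_const Metric.isOpen_ball.measurableSet, Set.indicator_of_mem hωA,
        ENNReal.inv_mul_cancel h0 (hfin _)]
      rfl
    · simp [Set.indicator, hωA]
  · refine Measure.le_iff.2 fun B hB => ?_
    rw [Measure.map_apply measurable_snd hB, withDensity_apply _ (measurable_snd hB),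
      ← lintegral_indicator (measurable_snd hB)]
    have hbound : ∀ᵐ p ∂(μ.prod σ), (Prod.snd ⁻¹' B).indicator w p
        ≤ (Prod.snd ⁻¹' B ∩ S).indicator (fun _ => C⁻¹) p := by
      have := Measure.quasiMeasurePreserving_fst (μ := μ) (ν := σ) |>.ae hσ
      filter_upwards [this] with p hp
      by_cases h1 : p ∈ Prod.snd ⁻¹' B <;> by_cases h2 : p ∈ S <;>
        simp only [hw, Set.indicator, h1, h2, Set.mem_inter_iff, and_true, and_false, if_true,
          if_false, le_refl]
      exact ENNReal.inv_le_inv.2 hp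
    refine (lintegral_mono_ae hbound).trans ?_
    rw [lintegral_indicator_const ((measurable_snd hB).inter hSm),
      Measure.prod_apply_symm ((measurable_snd hB).inter hSm)]
    have : ∀ y, μ ((fun ω => (ω, y)) ⁻¹' (Prod.snd ⁻¹' B ∩ S)) ≤ B.indicator (fun _ => C) y := by
      intro y
      by_cases hy : y ∈ B
      · rw [Set.indicator_of_mem hy]
        refine (measure_mono ?_).trans (hμ y)
        rw [← hslice' y]
        exact fun ω hω => hω.2
      · have : (fun ω : Ω => (ω, y)) ⁻¹' (Prod.snd ⁻¹' B ∩ S) = ∅ := by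
          ext ω; simp [hy]
        simp [this]
    calc C⁻¹ * ∫⁻ y, μ ((fun ω => (ω, y)) ⁻¹' (Prod.snd ⁻¹' B ∩ S)) ∂σ
        ≤ C⁻¹ * ∫⁻ y, B.indicator (fun _ => C) y ∂σ := by gcongr; exact this _
      _ = σ B := by
        rw [lintegral_indicator_const hB, ← mul_assoc, ENNReal.inv_mul_cancel hC0 hCtop, one_mul]
  · have : ∀ᵐ p ∂(μ.prod σ).withDensity w, p ∈ S := by
      rw [ae_withDensity_iff hwm]
      refine Eventually.of_forall fun p hp => ?_
      by_contra h
      exact hp (by simp [hw, h])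
    exact this

/-- `γ` is an admissible exterior plan for the measure `F`. -/
def IsPlan (F : Measure (Rd d)) (γ : Measure (Rd d × Rd d)) : Prop :=
  γ.map Prod.fst = F ∧ γ.map Prod.snd + F ≤ volume

/-- The exterior transport cost of a measure `F ≤ Leb`. -/
def extCost (k : Rd d → ℝ) (F : Measure (Rd d)) : ℝ≥0∞ :=
  ⨅ γ, ⨅ _ : IsPlan F γ, planCost (transCost k) γ

theorem extCost_le {k : Rd d → ℝ} {F : Measure (Rd d)} {γ : Measure (Rd d × Rd d)}
    (h : IsPlan F γ) : extCost k F ≤ planCost (transCost k) γ :=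
  iInf₂_le γ h

theorem planCost_add (c : Rd d → Rd d → ℝ) (γ γ' : Measure (Rd d × Rd d)) :
    planCost c (γ + γ') = planCost c γ + planCost c γ' :=
  lintegral_add_measure _ _ _

theorem fMeas_le_volume {f : Rd d → ℝ} (hf : InUnit f) : fMeas f ≤ volume := by
  refine (withDensity_mono (Eventually.of_forall fun x => ?_)).trans_eq withDensity_one
  simpa using (hf.2 x).2

theorem fMeas_univ {f : Rd d → ℝ} (hf : InUnit f) :
    fMeas f univ = ENNReal.ofReal (∫ x, f x) := by
  rw [fMeas, withDensity_apply _ MeasurableSet.univ, Measure.restrict_univ,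
    ofReal_integral_eq_lintegral_ofReal hf.1 (Eventually.of_forall fun x => (hf.2 x).1)]

theorem fMeas_add_one_sub {f : Rd d → ℝ} (hf : InUnit f) :
    (fMeas fun x => 1 - f x) + fMeas f = volume := by
  ext s hs
  have hm := hf.1.aestronglyMeasurable.aemeasurable
  rw [Measure.add_apply, fMeas, fMeas, withDensity_apply _ hs, withDensity_apply _ hs,
    ← lintegral_add_right' _ hm.ennreal_ofReal.restrict, ← setLIntegral_one]
  refine lintegral_congr fun x => ?_
  rw [← ENNReal.ofReal_add (by linarith [(hf.2 x).2]) (hf.2 x).1]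
  simp

theorem mem_extPlans_iff {f : Rd d → ℝ} (hf : InUnit f) (γ : Measure (Rd d × Rd d)) :
    γ ∈ ExtPlans f ↔ IsPlan (fMeas f) γ := by
  have hfin : ∀ s, fMeas f s ≠ ⊤ := fun s =>
    ((measure_mono (subset_univ s)).trans_lt (by simp [fMeas_univ hf])).ne
  refine and_congr Iff.rfl ?_
  rw [← fMeas_add_one_sub hf, Measure.le_iff, Measure.le_iff]
  refine forall₂_congr fun s _ => ?_
  rw [Measure.add_apply, Measure.add_apply, ENNReal.add_le_add_iff_right (hfin s)]

theorem ups_eq_extCost {f : Rd d → ℝ} (hf : InUnit f) (k : Rd d → ℝ) :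
    Ups (transCost k) f = extCost k (fMeas f) := by
  simp only [Ups, extCost, mem_extPlans_iff hf]

theorem exists_density {F : Measure (Rd d)} [IsFiniteMeasure F] (hF : F ≤ volume) :
    ∃ g : Rd d → ℝ≥0∞, Measurable g ∧ (∀ x, g x ≤ 1) ∧ volume.withDensity g = F := by
  refine ⟨fun x => min (F.rnDeriv volume x) 1, (Measure.measurable_rnDeriv _ _).min
    measurable_const, fun x => min_le_right _ _, ?_⟩
  have hac : F ≪ volume := Measure.absolutelyContinuous_of_le hF
  conv_rhs => rw [← Measure.withDensity_rnDeriv_eq F volume hac]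
  refine withDensity_congr_ae ?_
  have : F.rnDeriv volume ≤ᵐ[volume] 1 := by
    refine ae_le_of_forall_setLIntegral_le_of_sigmaFinite (Measure.measurable_rnDeriv _ _)
      fun s hs _ => ?_
    rw [← withDensity_apply _ hs, Measure.withDensity_rnDeriv_eq F volume hac]
    simpa using hF s
  filter_upwards [this] with x hx
  exact min_eq_left hx

theorem extCost_le_energy (k : Rd d → ℝ) {m : ℝ} (hm : 0 ≤ m) {F : Measure (Rd d)}
    (hF : F ≤ volume) (hFm : F univ = ENNReal.ofReal m) :
    extCost k F ≤ Energy (transCost k) m := by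
  have : IsFiniteMeasure F := ⟨by simp [hFm]⟩
  obtain ⟨g, hgm, hg1, hgF⟩ := exists_density hF
  have hgt : ∀ x, g x ≠ ⊤ := fun x => ((hg1 x).trans_lt one_lt_top).ne
  have hfF : fMeas (fun x => (g x).toReal) = F := by
    simp only [fMeas, ENNReal.ofReal_toReal (hgt _), hgF]
  have hint : ∫⁻ x, g x = ENNReal.ofReal m := by
    rw [← hFm, ← hgF, withDensity_apply _ MeasurableSet.univ, Measure.restrict_univ]
  have hu : InUnit fun x => (g x).toReal := by
    refine ⟨integrable_toReal_of_lintegral_ne_top hgm.aemeasurable (by simp [hint]),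
      fun x => ⟨ENNReal.toReal_nonneg, ?_⟩⟩
    simpa using ENNReal.toReal_mono one_ne_top (hg1 x)
  have hi : ∫ x, (g x).toReal = m := by
    rw [integral_toReal hgm.aemeasurable (Eventually.of_forall fun x => (hgt x).lt_top), hint,
      ENNReal.toReal_ofReal hm]
  rw [← hfF, ← ups_eq_extCost hu]
  exact le_iSup₂ (f := fun f (_ : f ∈ {f : Rd d → ℝ | InUnit f ∧ (∫ x, f x) = m}) =>
    Ups (transCost k) f) _ ⟨hu, hi⟩

theorem exists_capacity {ν : Measure (Rd d)} [IsFiniteMeasure ν] (h : ν ≤ volume) :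
    ∃ σ : Measure (Rd d), SFinite σ ∧ σ + ν = volume := by
  refine ⟨volume - ν, ?_, Measure.sub_add_cancel_of_le h⟩
  have : IsLocallyFiniteMeasure ((volume : Measure (Rd d)) - ν) :=
    Measure.isLocallyFiniteMeasure_of_le Measure.sub_le
  infer_instance

/-- Completing a partial plan `γ₀` by moving the endpoints of the overfull part `μ` by less
than `s`. -/
theorem exists_reroute {k : Rd d → ℝ} (hk : Continuous k) {F : Measure (Rd d)} [IsFiniteMeasure F]
    {γ₀ μ : Measure (Rd d × Rd d)} [IsFiniteMeasure γ₀] [IsFiniteMeasure μ] {s : ℝ} {C : ℝ≥0∞}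
    (hC0 : C ≠ 0) (hCtop : C ≠ ⊤) (hfst : γ₀.map Prod.fst + μ.map Prod.fst = F)
    (hsnd : γ₀.map Prod.snd + F ≤ volume)
    (hcap : ∀ᵐ p ∂μ, C + (γ₀.map Prod.snd + F) (Metric.ball p.2 s)
      ≤ volume (Metric.ball (0 : Rd d) s))
    (hμ : ∀ y, μ (Prod.snd ⁻¹' Metric.ball y s) ≤ C) :
    ∃ π : Measure (Rd d × Rd d), IsPlan F (γ₀ + π) ∧
      (∀ Q : Set (Rd d × Rd d), MeasurableSet Q →
        (∀ᵐ p ∂μ, ∀ y, dist y p.2 < s → (p.1, y) ∈ Q) → ∀ᵐ p ∂π, p ∈ Q) ∧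
      ∀ b : Rd d × Rd d → ℝ≥0∞, Measurable b →
        (∀ᵐ p ∂μ, ∀ y, dist y p.2 < s → ENNReal.ofReal (k (y - p.1)) ≤ b p) →
          planCost (transCost k) π ≤ ∫⁻ p, b p ∂μ := by
  obtain ⟨σ, hσs, hσ⟩ := exists_capacity hsnd
  have hσle : σ ≤ volume := hσ ▸ Measure.le_add_right le_rfl
  obtain ⟨π, hπ1, hπ2, hπ3⟩ := exists_local_plan μ σ measurable_snd s hC0 hCtop
    (by
      filter_upwards [hcap] with p hp
      rw [← Measure.addHaar_ball_center volume p.2 s, ← hσ, Measure.add_apply] at hp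
      exact (ENNReal.add_le_add_iff_right (measure_ne_top _ _)).1 hp)
    (fun y => ((hσle _).trans_lt measure_ball_lt_top).ne) hμ
  have hΦ : Measurable fun p : (Rd d × Rd d) × Rd d => (p.1.1, p.2) := by fun_prop
  have lift : ∀ P : Rd d × Rd d → Rd d → Prop, (∀ᵐ p ∂μ, ∀ y, dist y p.2 < s → P p y) →
      ∀ᵐ q ∂π, P q.1 q.2 := by
    intro P hP
    rw [← hπ1] at hP
    filter_upwards [ae_of_ae_map measurable_fst.aemeasurable hP, hπ3] with q hq hq'
    exact hq _ hq'
  refine ⟨π.map fun p => (p.1.1, p.2), ⟨?_, ?_⟩, ?_, ?_⟩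
  · rw [Measure.map_add _ _ measurable_fst, Measure.map_map measurable_fst hΦ, ← hfst, ← hπ1,
      Measure.map_map measurable_fst measurable_fst]
    rfl
  · rw [Measure.map_add _ _ measurable_snd, Measure.map_map measurable_snd hΦ, add_right_comm, ← hσ,
      add_comm]
    exact add_le_add_left hπ2 _
  · intro Q hQ h
    exact (ae_map_iff hΦ.aemeasurable (p := (· ∈ Q)) hQ).2 (lift _ h)
  · intro b hb h
    rw [planCost, lintegral_map (by unfold transCost; fun_prop) hΦ, ← hπ1,
      lintegral_map hb measurable_fst]
    exact lintegral_mono_ae (lift _ h)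

theorem ae_map_diag {Ω : Type*} [MeasurableSpace Ω] (μ : Measure Ω) {φ : Ω → Rd d}
    (hφ : Measurable φ) : ∀ᵐ p ∂μ.map fun x => (φ x, φ x), p.1 = p.2 := by
  rw [ae_map_iff (by fun_prop) (measurableSet_eq_fun measurable_fst measurable_snd)]
  exact Eventually.of_forall fun _ => rfl

theorem isFiniteMeasure_of_isPlan {F : Measure (Rd d)} [IsFiniteMeasure F]
    {γ : Measure (Rd d × Rd d)} (h : IsPlan F γ) : IsFiniteMeasure γ := by
  refine ⟨?_⟩
  have := Measure.map_apply (μ := γ) measurable_fst (MeasurableSet.univ (α := Rd d))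
  rw [h.1, preimage_univ] at this
  exact this ▸ measure_lt_top F _

theorem extCost_le_of_ball_le {k : Rd d → ℝ} (hk : Continuous k) {F : Measure (Rd d)}
    [IsFiniteMeasure F] (hF : F ≤ volume) {s : ℝ} {C : ℝ≥0∞} (hC0 : C ≠ 0) (hCtop : C ≠ ⊤)
    (hFC : ∀ y, F (Metric.ball y s) ≤ C) (hC : 2 * C ≤ volume (Metric.ball (0 : Rd d) s)) {η : ℝ}
    (hη : ∀ w : Rd d, ‖w‖ < s → k w ≤ η) : extCost k F ≤ ENNReal.ofReal η * F univ := by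
  have hdiag : Measurable fun x : Rd d => (x, x) := by fun_prop
  obtain ⟨π, hπ, -, hb⟩ := exists_reroute hk (F := F) (γ₀ := 0) (μ := F.map fun x => (x, x))
    (s := s) hC0 hCtop
    (by simp [Measure.map_map measurable_fst hdiag, Function.comp_def])
    (by simpa using hF)
    (Eventually.of_forall fun p => by
      simp only [Measure.map_zero, zero_add]
      refine le_trans ?_ hC
      rw [two_mul]
      gcongr
      exact hFC _)
    (fun y => by
      rw [Measure.map_apply hdiag (measurable_snd measurableSet_ball)]
      exact hFC y)
  rw [zero_add] at hπ
  refine (extCost_le hπ).trans ((hb (fun _ => ENNReal.ofReal η) measurable_const ?_).trans_eq ?_)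
  · filter_upwards [ae_map_diag F measurable_id] with p hp y hy
    refine ENNReal.ofReal_le_ofReal (hη _ ?_)
    rwa [hp, ← dist_eq_norm]
  · rw [lintegral_const, Measure.map_apply hdiag MeasurableSet.univ, preimage_univ]

theorem IsPlan.map_snd_le {F : Measure (Rd d)} {γ : Measure (Rd d × Rd d)} (h : IsPlan F γ) :
    γ.map Prod.snd ≤ volume :=
  (Measure.le_add_right le_rfl).trans h.2

theorem IsPlan.map_snd_univ {F : Measure (Rd d)} {γ : Measure (Rd d × Rd d)} (h : IsPlan F γ) :
    γ.map Prod.snd univ = F univ := by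
  rw [← h.1, Measure.map_apply measurable_fst MeasurableSet.univ,
    Measure.map_apply measurable_snd MeasurableSet.univ]
  rfl

/-- Moves longer than `r` can be rerouted without increasing the cost, where all moves of length
at most `s` are cheaper than moves of length more than `r`. -/
theorem IsPlan.exists_truncation {k : Rd d → ℝ} (hk : Continuous k) {F : Measure (Rd d)}
    [IsFiniteMeasure F] {γ : Measure (Rd d × Rd d)} (hγ : IsPlan F γ) {s r K : ℝ} {C : ℝ≥0∞}
    (hC0 : C ≠ 0) (hCtop : C ≠ ⊤) (hFC : F univ ≤ C)
    (hC : 3 * C ≤ volume (Metric.ball (0 : Rd d) s)) (hsr : s ≤ r)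
    (hs : ∀ w : Rd d, ‖w‖ < s → k w ≤ K) (hr : ∀ w : Rd d, r < ‖w‖ → K ≤ k w) :
    ∃ γ', IsPlan F γ' ∧ (∀ᵐ p ∂γ', dist p.2 p.1 ≤ r) ∧
      planCost (transCost k) γ' ≤ planCost (transCost k) γ := by
  have := isFiniteMeasure_of_isPlan hγ
  set S : Set (Rd d × Rd d) := {p | dist p.2 p.1 ≤ r} with hS
  have hSm : MeasurableSet S := measurableSet_le (by fun_prop) measurable_const
  have hdiag : Measurable fun p : Rd d × Rd d => (p.1, p.1) := by fun_prop
  have hsplit : γ.restrict S + γ.restrict Sᶜ = γ := Measure.restrict_add_restrict_compl hSm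
  have hle : (γ.restrict S).map Prod.snd ≤ γ.map Prod.snd :=
    Measure.map_mono Measure.restrict_le_self measurable_snd
  obtain ⟨π, hπ, hQ, hb⟩ := exists_reroute hk (F := F) (γ₀ := γ.restrict S)
    (μ := (γ.restrict Sᶜ).map fun p => (p.1, p.1)) (s := s) hC0 hCtop
    (by
      rw [Measure.map_map measurable_fst hdiag]
      change _ + (γ.restrict Sᶜ).map Prod.fst = F
      rw [← Measure.map_add _ _ measurable_fst, hsplit, hγ.1])
    ((add_le_add_left hle F).trans hγ.2)
    (Eventually.of_forall fun p => by
      refine le_trans ?_ hC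
      have h1 : (γ.restrict S).map Prod.snd (Metric.ball p.2 s) ≤ C :=
        ((hle _).trans (measure_mono (subset_univ _))).trans (hγ.map_snd_univ.trans_le hFC)
      have h2 : F (Metric.ball p.2 s) ≤ C := (measure_mono (subset_univ _)).trans hFC
      calc C + ((γ.restrict S).map Prod.snd + F) (Metric.ball p.2 s) ≤ C + (C + C) := by
            rw [Measure.add_apply]; gcongr
        _ = 3 * C := by ring)
    (fun y => by
      refine le_trans ?_ hFC
      rw [Measure.map_apply hdiag (measurable_snd measurableSet_ball), ← hγ.map_snd_univ,
        Measure.map_apply measurable_snd MeasurableSet.univ]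
      exact (Measure.restrict_le_self _).trans (measure_mono (subset_univ _)))
  have hdiag_ae := ae_map_diag (γ.restrict Sᶜ) (φ := Prod.fst) measurable_fst
  refine ⟨_, hπ, ?_, ?_⟩
  · rw [ae_add_measure_iff]
    refine ⟨ae_restrict_mem hSm, hQ S hSm ?_⟩
    filter_upwards [hdiag_ae] with p hp y hy
    rw [hS, mem_ofPred_eq]
    rw [hp]
    exact hy.le.trans hsr
  · have hbad : planCost (transCost k) π ≤ planCost (transCost k) (γ.restrict Sᶜ) := by
      refine (hb (fun _ => ENNReal.ofReal K) measurable_const ?_).trans ?_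
      · filter_upwards [hdiag_ae] with p hp y hy
        refine ENNReal.ofReal_le_ofReal (hs _ ?_)
        rwa [hp, ← dist_eq_norm]
      · rw [lintegral_map measurable_const hdiag]
        refine lintegral_mono_ae ?_
        filter_upwards [ae_restrict_mem hSm.compl] with p hp
        refine ENNReal.ofReal_le_ofReal (hr _ ?_)
        simpa [hS, dist_eq_norm] using hp
    calc _ = planCost (transCost k) (γ.restrict S) + planCost (transCost k) π := planCost_add _ _ _
      _ ≤ planCost (transCost k) (γ.restrict S) + planCost (transCost k) (γ.restrict Sᶜ) := by
        gcongr
      _ = _ := by rw [← planCost_add, hsplit]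

/-- Adding back to `H.restrict A` the part of `H` outside `A`, at small cost per unit of mass. -/
theorem extCost_le_add_compl {k : Rd d → ℝ} (hk : Continuous k) (hk0 : k 0 = 0)
    (hpos : ∀ x, 0 ≤ k x) {H : Measure (Rd d)}
    [IsFiniteMeasure H] (hH : H ≤ volume) {A : Set (Rd d)} (hA : MeasurableSet A)
    {γ : Measure (Rd d × Rd d)} (hγ : IsPlan (H.restrict A) γ) {r s η : ℝ} (hr0 : 0 ≤ r)
    (hη0 : 0 ≤ η)
    (hγr : ∀ᵐ p ∂γ, dist p.2 p.1 ≤ r) (hη : ∀ v w : Rd d, ‖v‖ ≤ r → ‖w‖ < s → k (v + w) ≤ k v + η)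
    {a : ℝ≥0∞} (ha0 : a ≠ 0) (hatop : a ≠ ⊤) (ha : 4 * a ≤ volume (Metric.ball (0 : Rd d) s))
    (hHA : H Aᶜ ≤ a) (hHball : ∀ y ∉ A, H (Metric.ball y (s + r)) ≤ a) :
    extCost k H ≤ planCost (transCost k) γ + 2 * ENNReal.ofReal η * H Aᶜ := by
  have := isFiniteMeasure_of_isPlan hγ
  obtain ⟨g₀, hg₀m, hg₀1, hg₀⟩ := exists_density hH
  set g : Rd d → ℝ≥0∞ := Aᶜ.indicator g₀ with hgdef
  have hgm : Measurable g := hg₀m.indicator hA.compl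
  have hg1 : ∀ x, g x ≤ 1 := fun x => (indicator_le_self _ _ x).trans (hg₀1 x)
  have hg : volume.withDensity g = H.restrict Aᶜ := by
    rw [hgdef, withDensity_indicator hA.compl, ← restrict_withDensity hA.compl, hg₀]
  have hgs : Measurable fun p : Rd d × Rd d => g p.2 := hgm.comp measurable_snd
  set γ₀ := γ.withDensity fun p => 1 - g p.2 with hγ₀
  set γ₁ := γ.withDensity fun p => g p.2 with hγ₁
  have hsum : γ₀ + γ₁ = γ := by
    rw [hγ₀, hγ₁, ← withDensity_add_right _ hgs]
    have : ((fun p : Rd d × Rd d => 1 - g p.2) + fun p => g p.2) = 1 := by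
      ext p; simp [tsub_add_cancel_of_le (hg1 p.2)]
    rw [this, withDensity_one]
  have hγ₀le : γ₀ ≤ γ := by
    conv_rhs => rw [← hsum]
    exact Measure.le_add_right le_rfl
  have hγ₁le : γ₁ ≤ γ := by
    conv_rhs => rw [← hsum]
    exact Measure.le_add_left le_rfl
  have : IsFiniteMeasure γ₀ := isFiniteMeasure_of_le γ hγ₀le
  have : IsFiniteMeasure γ₁ := isFiniteMeasure_of_le γ hγ₁le
  have hmap : ∀ u : Rd d → ℝ≥0∞, Measurable u → ∀ B, MeasurableSet B →
      (γ.withDensity fun p => u p.2) (Prod.snd ⁻¹' B) = ∫⁻ y in B, u y ∂γ.map Prod.snd := by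
    intro u hu B hB
    rw [withDensity_apply _ (measurable_snd hB), setLIntegral_map hB hu measurable_snd]
  have hHsplit : H.restrict A + H.restrict Aᶜ = H := Measure.restrict_add_restrict_compl hA
  have hdiag : Measurable fun x : Rd d => (x, x) := by fun_prop
  set G := H.restrict Aᶜ with hG
  have hGuniv : G univ = H Aᶜ := by simp [hG]
  have hγ₁mass : γ₁ univ ≤ H Aᶜ := by
    rw [← preimage_univ (f := Prod.snd), hγ₁, hmap g hgm _ MeasurableSet.univ, ← hGuniv, ← hg,
      withDensity_apply _ MeasurableSet.univ]
    exact lintegral_mono' (Measure.restrict_mono le_rfl hγ.map_snd_le) le_rfl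
  set μ := γ₁ + G.map fun x => (x, x) with hμdef
  have hμmass : μ univ ≤ 2 * H Aᶜ := by
    rw [hμdef, Measure.add_apply, Measure.map_apply hdiag MeasurableSet.univ, preimage_univ, hGuniv,
      two_mul]
    gcongr
  have hγ₀snd : γ₀.map Prod.snd ≤ γ.map Prod.snd := Measure.map_mono hγ₀le measurable_snd
  have hdiag_ae := ae_map_diag G measurable_id
  obtain ⟨π, hπ, -, hb⟩ := exists_reroute hk (F := H) (γ₀ := γ₀) (μ := μ) (s := s) (C := 2 * a)
    (by simpa using ha0) (ENNReal.mul_ne_top (by simp) hatop)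
    (by
      rw [hμdef, Measure.map_add _ _ measurable_fst, ← add_assoc,
        ← Measure.map_add _ _ measurable_fst, hsum, Measure.map_map measurable_fst hdiag, hγ.1]
      change _ + G.map id = H
      rw [Measure.map_id, hHsplit])
    (by
      refine Measure.le_iff.2 fun B hB => ?_
      have hBA := hB.inter hA
      have hBA' := hB.diff hA
      rw [← measure_inter_add_sdiff _ hA,
        ← measure_inter_add_sdiff (μ := (volume : Measure (Rd d))) _ hA]
      gcongr ?_ + ?_
      · refine le_trans ?_ (hγ.2 _)
        rw [Measure.add_apply, Measure.add_apply]
        refine add_le_add (hγ₀snd _) (le_of_eq ?_)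
        rw [Measure.restrict_apply hBA, inter_assoc, inter_self]
      · rw [Measure.add_apply, Measure.map_apply measurable_snd hBA', hγ₀,
          hmap (fun y => 1 - g y) (measurable_const.sub hgm) _ hBA']
        have h1 : H (B \ A) = ∫⁻ y in B \ A, g y := by
          rw [← withDensity_apply _ hBA', hg, Measure.restrict_apply hBA']
          congr 1
          ext x; simp [Set.mem_sdiff]
        rw [h1]
        calc _ ≤ (∫⁻ y in B \ A, (1 - g y)) + ∫⁻ y in B \ A, g y := by
              gcongr
              exact hγ.map_snd_le
          _ = volume (B \ A) := by
              rw [← lintegral_add_right _ hgm, ← setLIntegral_one]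
              exact lintegral_congr fun y => tsub_add_cancel_of_le (hg1 y))
    (by
      have hnotA : ∀ᵐ p ∂μ, p.2 ∉ A := by
        rw [hμdef, ae_add_measure_iff]
        constructor
        · rw [hγ₁, ae_withDensity_iff hgs]
          refine Eventually.of_forall fun p hp h => hp ?_
          simp [hgdef, h]
        · rw [ae_map_iff (p := fun p : Rd d × Rd d => p.2 ∉ A) hdiag.aemeasurable
            (measurable_snd hA.compl)]
          exact ae_restrict_mem hA.compl
      filter_upwards [hnotA] with p hp
      refine le_trans ?_ ha
      have h1 : H (Metric.ball p.2 s) ≤ a :=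
        (measure_mono (Metric.ball_subset_ball (by linarith))).trans (hHball _ hp)
      have h2 : γ₀.map Prod.snd (Metric.ball p.2 s) ≤ a := by
        refine (hγ₀snd _).trans (le_trans ?_ (hHball _ hp))
        refine le_trans ?_ (Measure.restrict_le_self (s := A) _)
        rw [← hγ.1, Measure.map_apply measurable_snd measurableSet_ball,
          Measure.map_apply measurable_fst measurableSet_ball]
        refine measure_mono_ae ?_
        filter_upwards [hγr] with q hq hq'
        have h3 : dist q.2 p.2 < s := hq'
        change dist q.1 p.2 < s + r
        linarith [dist_triangle q.1 q.2 p.2, dist_comm q.1 q.2]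
      calc 2 * a + (γ₀.map Prod.snd + H) (Metric.ball p.2 s) ≤ 2 * a + (a + a) := by
            rw [Measure.add_apply]; gcongr
        _ = 4 * a := by ring)
    (fun y => (measure_mono (subset_univ _)).trans (hμmass.trans (by gcongr)))
  have hμr : ∀ᵐ p ∂μ, dist p.2 p.1 ≤ r := by
    rw [hμdef, ae_add_measure_iff]
    refine ⟨(Measure.absolutelyContinuous_of_le hγ₁le).ae_le hγr, ?_⟩
    filter_upwards [hdiag_ae] with p hp
    rw [hp, dist_self]
    exact hr0
  have hcm : Measurable fun p : Rd d × Rd d => ENNReal.ofReal (transCost k p.1 p.2) := by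
    unfold transCost; fun_prop
  have hπcost := hb (fun p => ENNReal.ofReal (transCost k p.1 p.2) + ENNReal.ofReal η)
    (hcm.add measurable_const) (by
      filter_upwards [hμr] with p hp y hy
      rw [← ENNReal.ofReal_add (p := transCost k p.1 p.2) (hpos _) hη0]
      refine ENNReal.ofReal_le_ofReal ?_
      have := hη (p.2 - p.1) (y - p.2) (by rwa [← dist_eq_norm]) (by rwa [← dist_eq_norm])
      rwa [sub_add_sub_cancel'] at this)
  have hG0 : planCost (transCost k) (G.map fun x => (x, x)) = 0 := by
    rw [planCost, lintegral_map hcm hdiag]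
    simp [transCost, hk0]
  calc extCost k H ≤ planCost (transCost k) (γ₀ + π) := extCost_le hπ
    _ = planCost (transCost k) γ₀ + planCost (transCost k) π := planCost_add _ _ _
    _ ≤ planCost (transCost k) γ₀ +
        (planCost (transCost k) γ₁ + ENNReal.ofReal η * (2 * H Aᶜ)) := by
      gcongr
      refine hπcost.trans ?_
      rw [lintegral_add_right _ measurable_const, lintegral_const]
      gcongr
      exact (planCost_add _ _ _).trans_le (by rw [hG0, add_zero])
    _ = _ := by rw [← add_assoc, ← planCost_add, hsum]; ring

theorem add_le_of_disjoint {α : Type*} [MeasurableSpace α] {μ₁ μ₂ ν : Measure α} (h₁ : μ₁ ≤ ν)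
    (h₂ : μ₂ ≤ ν) {Q : Set α} (hQ : MeasurableSet Q) (hQ₁ : μ₁ Qᶜ = 0) (hQ₂ : μ₂ Q = 0) :
    μ₁ + μ₂ ≤ ν := by
  refine Measure.le_iff.2 fun B _ => ?_
  rw [← measure_inter_add_sdiff _ hQ, ← measure_inter_add_sdiff (μ := ν) _ hQ]
  gcongr ?_ + ?_
  · rw [Measure.add_apply, measure_mono_null inter_subset_right hQ₂, add_zero]
    exact h₁ _
  · rw [Measure.add_apply, measure_mono_null (fun x hx => hx.2) hQ₁, zero_add]
    exact h₂ _

theorem IsPlan.add_of_disjoint {F₁ F₂ : Measure (Rd d)} {γ₁ γ₂ : Measure (Rd d × Rd d)}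
    (h₁ : IsPlan F₁ γ₁) (h₂ : IsPlan F₂ γ₂) {Q : Set (Rd d)} (hQ : MeasurableSet Q)
    (hQ₁ : (γ₁.map Prod.snd + F₁) Qᶜ = 0) (hQ₂ : (γ₂.map Prod.snd + F₂) Q = 0) :
    IsPlan (F₁ + F₂) (γ₁ + γ₂) := by
  refine ⟨by rw [Measure.map_add _ _ measurable_fst, h₁.1, h₂.1], ?_⟩
  rw [Measure.map_add _ _ measurable_snd, add_add_add_comm]
  exact add_le_of_disjoint h₁.2 h₂.2 hQ hQ₁ hQ₂

/-- Plans for the inner and outer parts of `H` do not interact when the gap between the two parts is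
at least twice the length of the moves. -/
theorem isPlan_add_of_gap {H : Measure (Rd d)} {γ₁ γ₂ : Measure (Rd d × Rd d)} {z : Rd d}
    {P₁ P₂ r : ℝ} (hr0 : 0 ≤ r) (hP : P₁ + 2 * r ≤ P₂)
    (h₁ : IsPlan (H.restrict (Metric.ball z P₁)) γ₁)
    (h₂ : IsPlan (H.restrict (Metric.ball z P₂)ᶜ) γ₂) (hr₁ : ∀ᵐ p ∂γ₁, dist p.2 p.1 ≤ r)
    (hr₂ : ∀ᵐ p ∂γ₂, dist p.2 p.1 ≤ r) :
    IsPlan (H.restrict (Metric.ball z P₁ ∪ (Metric.ball z P₂)ᶜ)) (γ₁ + γ₂) := by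
  have hdisj : Disjoint (Metric.ball z P₁) (Metric.ball z P₂)ᶜ :=
    disjoint_compl_right_iff_subset.2 (Metric.ball_subset_ball (by linarith))
  rw [Measure.restrict_union hdisj measurableSet_ball.compl]
  have hfst : ∀ {F : Measure (Rd d)} {γ : Measure (Rd d × Rd d)} {S : Set (Rd d)},
      MeasurableSet S → IsPlan (F.restrict S) γ → ∀ᵐ p ∂γ, p.1 ∈ S := by
    intro F γ S hS h
    have := ae_restrict_mem (μ := F) hS
    rw [← h.1] at this
    exact ae_of_ae_map measurable_fst.aemeasurable this
  refine h₁.add_of_disjoint h₂ (Q := Metric.ball z (P₁ + r)) measurableSet_ball ?_ ?_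
  · rw [Measure.add_apply, Measure.map_apply measurable_snd measurableSet_ball.compl,
      Measure.restrict_apply measurableSet_ball.compl, add_eq_zero]
    constructor
    · rw [measure_eq_zero_iff_ae_notMem]
      filter_upwards [hr₁, hfst measurableSet_ball h₁] with p hp hp' h
      simp only [mem_preimage, mem_compl_iff, Metric.mem_ball, not_lt] at h hp'
      linarith [dist_triangle p.2 p.1 z]
    · convert measure_empty (μ := H)
      ext x
      simp only [mem_inter_iff, mem_compl_iff, Metric.mem_ball, mem_empty_iff_false, iff_false]
      rintro ⟨h, h'⟩
      linarith
  · rw [Measure.add_apply, Measure.map_apply measurable_snd measurableSet_ball,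
      Measure.restrict_apply measurableSet_ball, add_eq_zero]
    constructor
    · rw [measure_eq_zero_iff_ae_notMem]
      filter_upwards [hr₂, hfst measurableSet_ball.compl h₂] with p hp hp' h
      simp only [mem_preimage, mem_compl_iff, Metric.mem_ball, not_lt] at h hp'
      linarith [dist_triangle p.1 p.2 z, dist_comm p.1 p.2]
    · convert measure_empty (μ := H)
      ext x
      simp only [mem_inter_iff, mem_compl_iff, Metric.mem_ball, mem_empty_iff_false, iff_false]
      rintro ⟨h, h'⟩
      linarith

/-- The mass-preserving-density dilation of a measure by the factor `t`. -/
def dilate (t : ℝ) (F : Measure (Rd d)) : Measure (Rd d) :=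
  ENNReal.ofReal (t ^ d) • F.map (t • ·)

theorem dilate_univ (t : ℝ) (F : Measure (Rd d)) :
    dilate t F univ = ENNReal.ofReal (t ^ d) * F univ := by
  rw [dilate, Measure.smul_apply, Measure.map_apply (measurable_const_smul t) MeasurableSet.univ]
  rfl

theorem dilate_volume {t : ℝ} (ht : 0 < t) : dilate t (volume : Measure (Rd d)) = volume := by
  rw [dilate, Measure.map_addHaar_smul _ ht.ne', finrank_euclideanSpace_fin, smul_smul,
    ← ENNReal.ofReal_mul (by positivity), abs_of_pos (by positivity),
    mul_inv_cancel₀ (by positivity), ENNReal.ofReal_one, one_smul]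

theorem dilate_mono (t : ℝ) {F G : Measure (Rd d)} (h : F ≤ G) : dilate t F ≤ dilate t G := by
  intro B
  simp only [dilate, Measure.smul_apply, smul_eq_mul]
  gcongr
  exact measurable_const_smul t

theorem dilate_add (t : ℝ) (F G : Measure (Rd d)) :
    dilate t (F + G) = dilate t F + dilate t G := by
  simp only [dilate, Measure.map_add _ _ (measurable_const_smul t), smul_add]

theorem dilate_inv_dilate {t : ℝ} (ht : 0 < t) (F : Measure (Rd d)) :
    dilate t⁻¹ (dilate t F) = F := by
  rw [dilate, dilate, Measure.map_smul,
    Measure.map_map (measurable_const_smul _) (measurable_const_smul _), smul_smul,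
    ← ENNReal.ofReal_mul (by positivity), ← mul_pow, inv_mul_cancel₀ ht.ne', one_pow,
    ENNReal.ofReal_one, one_smul]
  convert Measure.map_id
  ext x
  simp [smul_smul, ht.ne']

theorem extCost_le_of_dilate {k : Rd d → ℝ} (hk : Continuous k) {t : ℝ} (ht : 0 < t)
    {F : Measure (Rd d)} {γ : Measure (Rd d × Rd d)} (hγ : IsPlan (dilate t F) γ) :
    extCost k F ≤ ENNReal.ofReal (t⁻¹ ^ d) *
      ∫⁻ p, ENNReal.ofReal (k (t⁻¹ • (p.2 - p.1))) ∂γ := by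
  have hm : Measurable fun p : Rd d × Rd d => (t⁻¹ • p.1, t⁻¹ • p.2) := by fun_prop
  have hplan : IsPlan F
      (ENNReal.ofReal (t⁻¹ ^ d) • γ.map fun p => (t⁻¹ • p.1, t⁻¹ • p.2)) := by
    have hfst : (ENNReal.ofReal (t⁻¹ ^ d) • γ.map fun p => (t⁻¹ • p.1, t⁻¹ • p.2)).map Prod.fst
        = dilate t⁻¹ (γ.map Prod.fst) := by
      rw [dilate, Measure.map_smul, Measure.map_map measurable_fst hm,
        Measure.map_map (measurable_const_smul _) measurable_fst]
      rfl
    have hsnd : (ENNReal.ofReal (t⁻¹ ^ d) • γ.map fun p => (t⁻¹ • p.1, t⁻¹ • p.2)).map Prod.snd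
        = dilate t⁻¹ (γ.map Prod.snd) := by
      rw [dilate, Measure.map_smul, Measure.map_map measurable_snd hm,
        Measure.map_map (measurable_const_smul _) measurable_snd]
      rfl
    refine ⟨by rw [hfst, hγ.1, dilate_inv_dilate ht], ?_⟩
    rw [hsnd]
    conv_lhs => rw [← dilate_inv_dilate ht F]
    rw [← dilate_add, ← dilate_volume (inv_pos.2 ht)]
    exact dilate_mono _ hγ.2
  refine (extCost_le hplan).trans_eq ?_
  rw [planCost, lintegral_smul_measure, smul_eq_mul,
    lintegral_map (by unfold transCost; fun_prop) hm]
  simp only [transCost, smul_sub]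

theorem exists_le_volume_ball (hd : 1 ≤ d) {M : ℝ≥0∞} (hM : M ≠ ⊤) :
    ∃ s : ℝ, 0 < s ∧ M ≤ volume (Metric.ball (0 : Rd d) s) := by
  set v := volume (Metric.ball (0 : Rd d) 1) with hv
  have hv0 : v ≠ 0 := (Metric.measure_ball_pos volume _ one_pos).ne'
  have hvt : v ≠ ⊤ := measure_ball_lt_top.ne
  refine ⟨max 1 (M / v).toReal, by positivity, ?_⟩
  rw [Measure.addHaar_ball_of_pos _ _ (by positivity), finrank_euclideanSpace_fin, ← hv]
  have h1 : M / v ≤ ENNReal.ofReal (max 1 (M / v).toReal ^ d) := by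
    rw [← ENNReal.ofReal_toReal (ENNReal.div_ne_top hM hv0)]
    refine ENNReal.ofReal_le_ofReal ?_
    rw [ENNReal.ofReal_toReal (ENNReal.div_ne_top hM hv0)]
    exact (le_max_right _ _).trans (le_self_pow₀ (le_max_left _ _) (by lia))
  calc M = M / v * v := (ENNReal.div_mul_cancel hv0 hvt).symm
    _ ≤ _ := by gcongr

theorem exists_volume_ball_eq (hd : 1 ≤ d) {m : ℝ} (hm : 0 < m) :
    ∃ ρ : ℝ, 0 < ρ ∧ volume (Metric.ball (0 : Rd d) ρ) = ENNReal.ofReal m := by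
  set v := (volume (Metric.ball (0 : Rd d) 1)).toReal with hv
  have hv0 : 0 < v :=
    ENNReal.toReal_pos (Metric.measure_ball_pos volume _ one_pos).ne' measure_ball_lt_top.ne
  have hρ : 0 < (m / v) ^ (1 / d : ℝ) := by positivity
  refine ⟨(m / v) ^ (1 / d : ℝ), hρ, ?_⟩
  have hd' : (d : ℝ) ≠ 0 := by positivity
  rw [Measure.addHaar_ball_of_pos _ _ hρ, finrank_euclideanSpace_fin, ← Real.rpow_natCast,
    ← Real.rpow_mul (by positivity), one_div_mul_cancel hd', Real.rpow_one,
    ← ENNReal.ofReal_toReal (a := volume (Metric.ball (0 : Rd d) 1)) measure_ball_lt_top.ne, ← hv,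
    ← ENNReal.ofReal_mul (by positivity), div_mul_cancel₀ _ hv0.ne']

theorem exists_bound {k : Rd d → ℝ} (hk : Continuous k) (s : ℝ) :
    ∃ K : ℝ, 0 < K ∧ ∀ w : Rd d, ‖w‖ ≤ s → k w ≤ K := by
  obtain ⟨K, hK⟩ := (isCompact_closedBall (0 : Rd d) s).exists_bound_of_continuousOn hk.continuousOn
  refine ⟨max K 1, by positivity, fun w hw => ?_⟩
  exact (le_abs_self _).trans ((hK w (by simpa using hw)).trans (le_max_left _ _))

theorem exists_modulus {k : Rd d → ℝ} (hk : Continuous k) (r : ℝ) {η : ℝ} (hη : 0 < η) :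
    ∃ s : ℝ, 0 < s ∧ ∀ v w : Rd d, ‖v‖ ≤ r → ‖w‖ < s → k (v + w) ≤ k v + η := by
  have := (isCompact_closedBall (0 : Rd d) (r + 1)).uniformContinuousOn_of_continuous
    hk.continuousOn
  obtain ⟨δ, hδ, h⟩ := Metric.uniformContinuousOn_iff.1 this η hη
  refine ⟨min δ 1, by positivity, fun v w hv hw => ?_⟩
  have hw1 : ‖w‖ < 1 := hw.trans_le (min_le_right _ _)
  have := h (v + w) (by
      rw [mem_closedBall_zero_iff]
      linarith [norm_add_le v w]) v (by rw [mem_closedBall_zero_iff]; linarith)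
    (by simpa [dist_eq_norm] using hw.trans_le (min_le_left _ _))
  rw [Real.dist_eq] at this
  linarith [(abs_lt.1 this).2]

theorem exists_lower_of_H1 {k : Rd d → ℝ} (h1 : H1 k) (K : ℝ) :
    ∃ r : ℝ, ∀ w : Rd d, r < ‖w‖ → K ≤ k w := by
  obtain ⟨r, -, hr⟩ := (hasBasis_cobounded_norm.eventually_iff).1
    (h1.2.2.eventually (eventually_ge_atTop K))
  exact ⟨r, fun w hw => hr hw.le⟩

theorem smul_lt_of_H3 {k : Rd d → ℝ} (h3 : H3 k) {t : ℝ} (ht0 : 0 ≤ t) (ht1 : t < 1) {v : Rd d}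
    (hv : v ≠ 0) : k (t • v) < k v := by
  have hn : 0 < ‖v‖ := norm_pos_iff.2 hv
  have := h3 (‖v‖⁻¹ • v) (by rw [norm_smul, norm_inv, norm_norm, inv_mul_cancel₀ hn.ne'])
    (a := t * ‖v‖) (b := ‖v‖) (by simp only [mem_Ici]; positivity) hn.le (by nlinarith)
  simpa [smul_smul, mul_assoc, hn.ne'] using this

theorem smul_le_of_H3 {k : Rd d → ℝ} (h3 : H3 k) {t : ℝ} (ht0 : 0 ≤ t) (ht1 : t ≤ 1) (v : Rd d) :
    k (t • v) ≤ k v := by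
  rcases ht1.eq_or_lt with rfl | ht
  · simp
  rcases eq_or_ne v 0 with rfl | hv
  · simp
  exact (smul_lt_of_H3 h3 ht0 ht hv).le

theorem exists_lower_away {k : Rd d → ℝ} (h1 : H1 k) (h3 : H3 k) {t : ℝ} (ht : 0 < t) :
    ∃ β : ℝ, 0 < β ∧ ∀ v : Rd d, t ≤ ‖v‖ → β ≤ k v := by
  obtain ⟨r, hr⟩ := exists_lower_of_H1 h1 1
  have hc : IsCompact (Metric.closedBall (0 : Rd d) r ∩ {v | t ≤ ‖v‖}) :=
    (isCompact_closedBall _ _).inter_right (isClosed_le continuous_const continuous_norm)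
  obtain ⟨β, hβ, h⟩ := hc.exists_forall_le' h1.1.continuousOn (a := 0) (by
    rintro v ⟨-, hv⟩
    have hv0 : v ≠ 0 := norm_pos_iff.1 (ht.trans_le hv)
    simpa [h1.2.1] using smul_lt_of_H3 h3 le_rfl one_pos hv0)
  refine ⟨min β 1, by positivity, fun v hv => ?_⟩
  by_cases hvr : ‖v‖ ≤ r
  · exact (min_le_left _ _).trans (h v ⟨by simpa using hvr, hv⟩)
  · exact (min_le_right _ _).trans (hr v (not_le.1 hvr))

/-- On bounded sets, shrinking the argument by a factor `t < 1` shrinks the cost by a definite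
factor, up to a small error. -/
theorem exists_contraction {k : Rd d → ℝ} (h1 : H1 k) (h3 : H3 k) (r : ℝ) {t : ℝ} (ht0 : 0 ≤ t)
    (ht1 : t < 1) {η : ℝ} (hη : 0 < η) :
    ∃ θ : ℝ, 0 < θ ∧ θ ≤ 1 ∧ ∀ v : Rd d, ‖v‖ ≤ r → k (t • v) ≤ (1 - θ) * k v + θ * η := by
  have hk := h1.1
  obtain ⟨K, hK0, hK⟩ := exists_bound hk r
  have hc : IsCompact (Metric.closedBall (0 : Rd d) r ∩ {v | η ≤ k v}) :=
    (isCompact_closedBall _ _).inter_right (isClosed_le continuous_const hk)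
  obtain ⟨β, hβ, h⟩ := hc.exists_forall_le' (f := fun v => k v - k (t • v))
    (by fun_prop) (a := 0) (by
      rintro v ⟨-, hv⟩
      have hv0 : v ≠ 0 := by
        rintro rfl
        have : η ≤ k 0 := hv
        linarith [h1.2.1]
      exact sub_pos.2 (smul_lt_of_H3 h3 ht0 ht1 hv0))
  have hθ : min 1 (β / K) * K ≤ β := by
    calc _ ≤ β / K * K := by gcongr; exact min_le_right _ _
      _ = β := div_mul_cancel₀ _ hK0.ne'
  have hθ0 : 0 < min 1 (β / K) := by positivity
  refine ⟨min 1 (β / K), hθ0, min_le_left _ _, fun v hv => ?_⟩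
  generalize min 1 (β / K) = θ at *
  by_cases hvη : η ≤ k v
  · have := h v ⟨by simpa using hv, hvη⟩
    nlinarith [hK v hv]
  · have := smul_le_of_H3 h3 ht0 ht1.le v
    nlinarith

/-- Plans for measures of mass at most `m` can be replaced, without increasing the cost, by plans
whose moves have length at most `r`. -/
def TruncatesAt (k : Rd d → ℝ) (m r : ℝ) : Prop :=
  ∀ F : Measure (Rd d), F univ ≤ ENNReal.ofReal m → ∀ γ, IsPlan F γ →
    ∃ γ', IsPlan F γ' ∧ (∀ᵐ p ∂γ', dist p.2 p.1 ≤ r) ∧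
      planCost (transCost k) γ' ≤ planCost (transCost k) γ

theorem exists_truncatesAt (hd : 1 ≤ d) {k : Rd d → ℝ} (h1 : H1 k) {m : ℝ} (hm : 0 < m) :
    ∃ r : ℝ, 0 < r ∧ TruncatesAt k m r := by
  obtain ⟨s, hs0, hs⟩ := exists_le_volume_ball hd (M := 3 * ENNReal.ofReal m)
    (ENNReal.mul_ne_top (by simp) ofReal_ne_top)
  obtain ⟨K, -, hK⟩ := exists_bound h1.1 s
  obtain ⟨r, hr⟩ := exists_lower_of_H1 h1 K
  refine ⟨max r s, by positivity, fun F hF γ hγ => ?_⟩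
  have : IsFiniteMeasure F := ⟨hF.trans_lt ofReal_lt_top⟩
  exact hγ.exists_truncation h1.1 (by simpa using hm) ofReal_ne_top hF hs (le_max_right _ _)
    (fun w hw => hK w hw.le) (fun w hw => hr w ((le_max_left _ _).trans_lt hw))

theorem exists_energy_eq_ofReal (hd : 1 ≤ d) {k : Rd d → ℝ} (h1 : H1 k) (h3 : H3 k) {m : ℝ}
    (hm : 0 < m) : ∃ E : ℝ, 0 < E ∧ Energy (transCost k) m = ENNReal.ofReal E := by
  have htop : Energy (transCost k) m ≠ ⊤ := by
    obtain ⟨s, hs0, hs⟩ := exists_le_volume_ball hd (M := 2 * ENNReal.ofReal m)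
      (ENNReal.mul_ne_top (by simp) ofReal_ne_top)
    obtain ⟨K, -, hK⟩ := exists_bound h1.1 s
    refine ((iSup₂_le ?_).trans_lt (ENNReal.mul_lt_top (a := ENNReal.ofReal K)
      (b := ENNReal.ofReal m) ofReal_lt_top ofReal_lt_top)).ne
    rintro f ⟨hf, hfm⟩
    have hu : fMeas f univ = ENNReal.ofReal m := by rw [fMeas_univ hf, hfm]
    have : IsFiniteMeasure (fMeas f) := ⟨by simp [hu]⟩
    rw [ups_eq_extCost hf, ← hu]
    exact extCost_le_of_ball_le h1.1 (fMeas_le_volume hf) (by simpa using hm) ofReal_ne_top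
      (fun y => (measure_mono (subset_univ _)).trans hu.le) hs fun w hw => hK w hw.le
  have hpos : 0 < Energy (transCost k) m := by
    obtain ⟨ρ, hρ, hball⟩ := exists_volume_ball_eq hd hm
    obtain ⟨β, hβ, hkβ⟩ := exists_lower_away h1 h3 (half_pos hρ)
    refine lt_of_lt_of_le ?_ (extCost_le_energy k hm.le
      (F := volume.restrict (Metric.ball 0 ρ)) Measure.restrict_le_self (by simpa using hball))
    refine lt_of_lt_of_le (b := ENNReal.ofReal β * volume (Metric.ball (0 : Rd d) (ρ / 2)))
      (ENNReal.mul_pos (by simpa using hβ) (Metric.measure_ball_pos volume _ (half_pos hρ)).ne') ?_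
    refine le_iInf₂ fun γ hγ => ?_
    have hout : γ (Prod.snd ⁻¹' Metric.ball 0 ρ) = 0 := by
      have := hγ.2 (Metric.ball 0 ρ)
      rw [Measure.add_apply, Measure.restrict_apply measurableSet_ball, inter_self,
        Measure.map_apply measurable_snd measurableSet_ball] at this
      simpa using (ENNReal.le_sub_of_add_le_right measure_ball_lt_top.ne this)
    rw [measure_eq_zero_iff_ae_notMem] at hout
    have hin : γ (Prod.fst ⁻¹' Metric.ball 0 (ρ / 2)) = volume (Metric.ball (0 : Rd d) (ρ / 2)) := by
      rw [← Measure.map_apply measurable_fst measurableSet_ball, hγ.1,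
        Measure.restrict_apply measurableSet_ball,
        inter_eq_left.2 (Metric.ball_subset_ball (by linarith))]
    rw [← hin, ← setLIntegral_const]
    refine le_trans (lintegral_mono_ae ?_) (setLIntegral_le_lintegral _ _)
    filter_upwards [ae_restrict_of_ae hout,
      ae_restrict_mem (measurable_fst measurableSet_ball)] with p hp hp'
    refine ENNReal.ofReal_le_ofReal (hkβ _ ?_)
    simp only [mem_preimage, mem_ball_zero_iff, not_lt] at hp hp'
    linarith [norm_sub_norm_le p.2 p.1]
  exact ⟨(Energy (transCost k) m).toReal, ENNReal.toReal_pos hpos.ne' htop,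
    (ENNReal.ofReal_toReal htop).symm⟩

theorem exists_plan_le {k : Rd d → ℝ} {m r : ℝ}
    (hr : TruncatesAt k m r)
    {F : Measure (Rd d)} (hF : F univ ≤ ENNReal.ofReal m) {b τ : ℝ} (hb : 0 ≤ b) (hτ : 0 < τ)
    (h : extCost k F ≤ ENNReal.ofReal b) :
    ∃ γ, IsPlan F γ ∧ (∀ᵐ p ∂γ, dist p.2 p.1 ≤ r) ∧
      planCost (transCost k) γ ≤ ENNReal.ofReal (b + τ) := by
  have hlt : extCost k F < ENNReal.ofReal (b + τ) :=
    h.trans_lt ((ENNReal.ofReal_lt_ofReal_iff (by positivity)).2 (by linarith))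
  simp only [extCost, iInf_lt_iff] at hlt
  obtain ⟨γ, hγ, hlt'⟩ := hlt
  obtain ⟨γ', h1, h2, h3⟩ := hr F hF γ hγ
  exact ⟨γ', h1, h2, h3.trans hlt'.le⟩

theorem le_ofReal_of_forall_pos {a : ℝ≥0∞} {b : ℝ} (c : ℝ)
    (h : ∀ τ > 0, a ≤ ENNReal.ofReal (b + c * τ)) : a ≤ ENNReal.ofReal b := by
  have hc : Continuous fun τ : ℝ => ENNReal.ofReal (b + c * τ) :=
    ENNReal.continuous_ofReal.comp (by fun_prop)
  have := (hc.tendsto 0).mono_left (nhdsWithin_le_nhds (s := Ioi 0))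
  simp only [mul_zero, add_zero] at this
  exact ge_of_tendsto this (by filter_upwards [self_mem_nhdsWithin] with τ hτ using h τ hτ)

/-- Comparison of the costs at masses `m' ≤ m` by dilation. -/
theorem extCost_le_of_dilation (hd : 1 ≤ d) {k : Rd d → ℝ} (hk : Continuous k)
    (hpos : ∀ x, 0 ≤ k x) {m m' E r θ β : ℝ}
    (hr : TruncatesAt k m r)
    (hE0 : 0 ≤ E)
    (hE : ∀ F : Measure (Rd d), F ≤ volume → F univ = ENNReal.ofReal m →
      extCost k F ≤ ENNReal.ofReal E) (hm : 0 < m) (hm' : 0 < m') (hθ1 : θ ≤ 1) (hβ : 0 ≤ β)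
    (h : ∀ v : Rd d, ‖v‖ ≤ r → k (((m / m') ^ (1 / d : ℝ))⁻¹ • v) ≤ (1 - θ) * k v + β)
    {F : Measure (Rd d)} (hF : F ≤ volume) (hFm : F univ = ENNReal.ofReal m') :
    extCost k F ≤ ENNReal.ofReal (m' / m * ((1 - θ) * E + β * m)) := by
  set t := (m / m') ^ (1 / d : ℝ) with htdef
  have ht : 0 < t := by positivity
  have hd' : (d : ℝ) ≠ 0 := by positivity
  have htd : t ^ d = m / m' := by
    rw [htdef, ← Real.rpow_natCast, ← Real.rpow_mul (by positivity), one_div_mul_cancel hd',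
      Real.rpow_one]
  have hmass : dilate t F univ = ENNReal.ofReal m := by
    rw [dilate_univ, hFm, htd, ← ENNReal.ofReal_mul (by positivity), div_mul_cancel₀ _ hm'.ne']
  have hle : dilate t F ≤ volume := dilate_volume (d := d) ht ▸ dilate_mono t hF
  refine le_ofReal_of_forall_pos (m' / m * (1 - θ)) fun τ hτ => ?_
  obtain ⟨γ, hγ, hγr, hγc⟩ := exists_plan_le hr hmass.le hE0 hτ (hE _ hle hmass)
  have : IsFiniteMeasure (dilate t F) := ⟨by simp [hmass]⟩
  have := isFiniteMeasure_of_isPlan hγ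
  have hγm : γ univ = ENNReal.ofReal m := by
    rw [← hmass, ← hγ.1, Measure.map_apply measurable_fst MeasurableSet.univ]
    rfl
  refine (extCost_le_of_dilate hk ht hγ).trans ?_
  have hint : ∫⁻ p, ENNReal.ofReal (k (t⁻¹ • (p.2 - p.1))) ∂γ
      ≤ ENNReal.ofReal ((1 - θ) * (E + τ) + β * m) := by
    calc _ ≤ ∫⁻ p, (ENNReal.ofReal (1 - θ) * ENNReal.ofReal (transCost k p.1 p.2)
            + ENNReal.ofReal β) ∂γ := by
          refine lintegral_mono_ae ?_
          filter_upwards [hγr] with p hp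
          rw [← ENNReal.ofReal_mul (by linarith), ← ENNReal.ofReal_add
            (p := (1 - θ) * transCost k p.1 p.2) (mul_nonneg (by linarith) (hpos _)) hβ]
          exact ENNReal.ofReal_le_ofReal (h _ (by rwa [← dist_eq_norm]))
      _ = ENNReal.ofReal (1 - θ) * planCost (transCost k) γ
            + ENNReal.ofReal β * ENNReal.ofReal m := by
          rw [lintegral_add_right _ measurable_const, lintegral_const, hγm,
            lintegral_const_mul _ (by unfold transCost; fun_prop), planCost]
      _ ≤ ENNReal.ofReal (1 - θ) * ENNReal.ofReal (E + τ)
            + ENNReal.ofReal β * ENNReal.ofReal m := by gcongr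
      _ = _ := by
          rw [← ENNReal.ofReal_mul (by linarith), ← ENNReal.ofReal_mul hβ, ← ENNReal.ofReal_add
            (mul_nonneg (by linarith) (by linarith)) (by positivity)]
  calc _ ≤ ENNReal.ofReal (t⁻¹ ^ d) * ENNReal.ofReal ((1 - θ) * (E + τ) + β * m) := by gcongr
    _ = _ := by
      rw [← ENNReal.ofReal_mul (by positivity), inv_pow, htd, inv_div]
      congr 1
      ring

theorem extCost_le_linear (hd : 1 ≤ d) {k : Rd d → ℝ} (h1 : H1 k) (h3 : H3 k)
    (hpos : ∀ x, 0 ≤ k x) {m m' E r : ℝ}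
    (hr : TruncatesAt k m r)
    (hE0 : 0 ≤ E)
    (hE : ∀ F : Measure (Rd d), F ≤ volume → F univ = ENNReal.ofReal m →
      extCost k F ≤ ENNReal.ofReal E) (hm : 0 < m) (hm0 : 0 ≤ m') (hmm : m' ≤ m)
    {F : Measure (Rd d)} (hF : F ≤ volume) (hFm : F univ = ENNReal.ofReal m') :
    extCost k F ≤ ENNReal.ofReal (m' / m * E) := by
  rcases hm0.eq_or_lt with rfl | hm'
  · have hF0 : F = 0 := by simpa using hFm
    refine (extCost_le (γ := 0) ⟨by simp [hF0], by simpa [hF0] using Measure.zero_le _⟩).trans ?_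
    simp [planCost]
  · have ht : 1 ≤ (m / m') ^ (1 / d : ℝ) :=
      Real.one_le_rpow ((one_le_div hm').2 hmm) (by positivity)
    simpa using extCost_le_of_dilation hd h1.1 hpos hr hE0 hE hm hm' zero_le_one le_rfl
      (fun v _ => by simpa using smul_le_of_H3 h3 (by positivity) (inv_le_one_of_one_le₀ ht) v)
      hF hFm

theorem exists_extCost_le_sublinear (hd : 1 ≤ d) {k : Rd d → ℝ} (h1 : H1 k) (h3 : H3 k)
    (hpos : ∀ x, 0 ≤ k x) {m E r : ℝ}
    (hr : TruncatesAt k m r)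
    (hE0 : 0 < E)
    (hE : ∀ F : Measure (Rd d), F ≤ volume → F univ = ENNReal.ofReal m →
      extCost k F ≤ ENNReal.ofReal E) (hm : 0 < m) :
    ∃ κ : ℝ, 0 < κ ∧ κ ≤ E / m ∧ ∀ m', 0 ≤ m' → m' ≤ m / 2 → ∀ F : Measure (Rd d), F ≤ volume →
      F univ = ENNReal.ofReal m' → extCost k F ≤ ENNReal.ofReal (m' * (E / m - κ)) := by
  have hd' : (0 : ℝ) < 1 / d := by positivity
  have hl : (1 : ℝ) < 2 ^ (1 / d : ℝ) := Real.one_lt_rpow one_lt_two hd'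
  obtain ⟨θ, hθ0, hθ1, hθ⟩ := exists_contraction h1 h3 r (t := ((2 : ℝ) ^ (1 / d : ℝ))⁻¹)
    (by positivity) (inv_lt_one_of_one_lt₀ hl) (η := E / (2 * m)) (by positivity)
  refine ⟨θ * (E / (2 * m)), by positivity, ?_, fun m' hm0 hmm F hF hFm => ?_⟩
  · calc _ ≤ 1 * (E / (2 * m)) := by gcongr
      _ = E / m / 2 := by field_simp
      _ ≤ E / m := half_le_self (by positivity)
  rcases hm0.eq_or_lt with rfl | hm'
  · simpa using extCost_le_linear hd h1 h3 hpos hr hE0.le hE hm le_rfl hm.le hF hFm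
  have hle : (2 : ℝ) ^ (1 / d : ℝ) ≤ (m / m') ^ (1 / d : ℝ) := by
    refine Real.rpow_le_rpow zero_le_two ?_ hd'.le
    rw [le_div_iff₀ hm']
    linarith
  refine (extCost_le_of_dilation (β := θ * (E / (2 * m))) hd h1.1 hpos hr hE0.le hE hm hm' hθ1
    (by positivity) (fun v hv => le_trans ?_ (hθ v hv)) hF hFm).trans_eq ?_
  · have := smul_le_of_H3 h3 (t := (2 : ℝ) ^ (1 / d : ℝ) / (m / m') ^ (1 / d : ℝ)) (by positivity)
      (div_le_one_of_le₀ hle (by positivity)) (((2 : ℝ) ^ (1 / d : ℝ))⁻¹ • v)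
    rwa [smul_smul, div_mul_eq_mul_div, mul_inv_cancel₀ (by positivity), one_div] at this
  · congr 1
    field_simp
    ring

theorem exists_small_annulus {α : Type*} [PseudoMetricSpace α] [MeasurableSpace α]
    [OpensMeasurableSpace α] (H : Measure α) (z : α) (s : ℝ) {L : ℝ} (hL : 0 ≤ L) {N : ℕ}
    {a : ℝ≥0∞} (h : H univ < N * a) :
    ∃ n < N, H (Metric.ball z (s + (n + 1) * L) \ Metric.ball z (s + n * L)) ≤ a := by
  by_contra! hcon
  have key : ∀ n ≤ N, n * a ≤ H (Metric.ball z (s + n * L)) := by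
    intro n
    induction n with
    | zero => simp
    | succ n ih =>
      intro hn
      have hsub : Metric.ball z (s + n * L) ⊆ Metric.ball z (s + (n + 1) * L) :=
        Metric.ball_subset_ball (by nlinarith)
      rw [Nat.cast_succ, Nat.cast_succ, ← measure_inter_add_sdiff (Metric.ball z (s + (n + 1) * L))
        (measurableSet_ball (x := z) (ε := s + n * L)), inter_eq_right.2 hsub, add_mul, one_mul]
      exact add_le_add (ih (by lia)) (hcon n (by lia)).le
  exact absurd (h.trans_le (key N le_rfl)) (measure_mono (subset_univ _)).not_gt

/-- If `H` has little mass in an annulus, its cost is almost the sum of the costs inside and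
outside. -/
theorem extCost_le_of_annulus {k : Rd d → ℝ} (hk : Continuous k) (hk0 : k 0 = 0)
    (hpos : ∀ x, 0 ≤ k x) {m r s η a b₁ b₂ R : ℝ}
    (hr : TruncatesAt k m r)
    (hr0 : 0 ≤ r) (hs0 : 0 ≤ s) (hη0 : 0 ≤ η)
    (hη : ∀ v w : Rd d, ‖v‖ ≤ r → ‖w‖ < s → k (v + w) ≤ k v + η) (ha0 : 0 < a)
    (ha : 4 * ENNReal.ofReal a ≤ volume (Metric.ball (0 : Rd d) s)) {H : Measure (Rd d)}
    (hH : H ≤ volume) (hHm : H univ ≤ ENNReal.ofReal m) {z : Rd d}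
    (hHa : H (Metric.ball z (R + 3 * r + s) \ Metric.ball z (R - r - s)) ≤ ENNReal.ofReal a)
    (hb₁ : 0 ≤ b₁) (hb₂ : 0 ≤ b₂) (h₁ : extCost k (H.restrict (Metric.ball z R)) ≤ ENNReal.ofReal b₁)
    (h₂ : extCost k (H.restrict (Metric.ball z (R + 2 * r))ᶜ) ≤ ENNReal.ofReal b₂) :
    extCost k H ≤ ENNReal.ofReal (b₁ + b₂ + 2 * η * a) := by
  have : IsFiniteMeasure H := ⟨hHm.trans_lt ofReal_lt_top⟩
  refine le_ofReal_of_forall_pos 2 fun τ hτ => ?_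
  have hres : ∀ A, H.restrict A univ ≤ ENNReal.ofReal m := fun A =>
    (Measure.restrict_le_self univ).trans hHm
  obtain ⟨γ₁, hγ₁, hr₁, hc₁⟩ := exists_plan_le hr (hres _) hb₁ hτ h₁
  obtain ⟨γ₂, hγ₂, hr₂, hc₂⟩ := exists_plan_le hr (hres _) hb₂ hτ h₂
  have hγ := isPlan_add_of_gap hr0 le_rfl hγ₁ hγ₂ hr₁ hr₂
  set A := Metric.ball z R ∪ (Metric.ball z (R + 2 * r))ᶜ with hA
  have hball : ∀ y ∉ A, Metric.ball y (s + r) ⊆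
      Metric.ball z (R + 3 * r + s) \ Metric.ball z (R - r - s) := by
    intro y hy x hx
    simp only [hA, mem_union, mem_compl_iff, Metric.mem_ball, not_or, not_lt, not_le] at hy
    simp only [Set.mem_sdiff, Metric.mem_ball, not_lt] at hx ⊢
    have h1 := dist_triangle x y z
    have h2 := dist_triangle y x z
    rw [dist_comm y x] at h2
    constructor <;> linarith
  have hAc : Aᶜ ⊆ Metric.ball z (R + 3 * r + s) \ Metric.ball z (R - r - s) := by
    intro y hy
    simp only [hA, mem_union, mem_compl_iff, Metric.mem_ball, not_or, not_lt, not_le] at hy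
    simp only [Set.mem_sdiff, Metric.mem_ball, not_lt]
    constructor <;> linarith
  have hHA : H Aᶜ ≤ ENNReal.ofReal a := (measure_mono hAc).trans hHa
  refine (extCost_le_add_compl hk hk0 hpos hH (measurableSet_ball.union measurableSet_ball.compl)
    hγ hr0 hη0 (ae_add_measure_iff.2 ⟨hr₁, hr₂⟩) hη (by simpa using ha0) ofReal_ne_top ha
    hHA fun y hy => (measure_mono (hball y hy)).trans hHa).trans ?_
  rw [planCost_add]
  calc _ ≤ ENNReal.ofReal (b₁ + τ) + ENNReal.ofReal (b₂ + τ)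
        + 2 * ENNReal.ofReal η * ENNReal.ofReal a := by gcongr
    _ = _ := by
      have h2 : 2 * ENNReal.ofReal η = ENNReal.ofReal (2 * η) := by
        rw [ENNReal.ofReal_mul zero_le_two, ENNReal.ofReal_ofNat]
      rw [h2,
        ← ENNReal.ofReal_mul (by positivity), ← ENNReal.ofReal_add (by positivity) (by positivity),
        ← ENNReal.ofReal_add (by positivity) (by positivity)]
      congr 1
      ring

/-- If `H` has little mass outside of a ball, then the mass outside of a larger ball costs little
more than in isolation. -/
theorem extCost_le_of_ball {k : Rd d → ℝ} (hk : Continuous k) (hk0 : k 0 = 0)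
    (hpos : ∀ x, 0 ≤ k x) {m r s η b R : ℝ} {a : ℝ≥0∞}
    (hr : TruncatesAt k m r)
    (hr0 : 0 ≤ r) (hs0 : 0 ≤ s) (hη0 : 0 ≤ η)
    (hη : ∀ v w : Rd d, ‖v‖ ≤ r → ‖w‖ < s → k (v + w) ≤ k v + η) (ha0 : a ≠ 0) (hatop : a ≠ ⊤)
    (ha : 4 * a ≤ volume (Metric.ball (0 : Rd d) s)) {H : Measure (Rd d)}
    (hH : H ≤ volume) (hHm : H univ ≤ ENNReal.ofReal m) {z : Rd d}
    (hHa : H (Metric.ball z R)ᶜ ≤ a) (hb : 0 ≤ b)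
    (h : extCost k (H.restrict (Metric.ball z (R + r + s))) ≤ ENNReal.ofReal b) :
    extCost k H ≤ ENNReal.ofReal (b + 2 * η * H.real (Metric.ball z (R + r + s))ᶜ) := by
  have : IsFiniteMeasure H := ⟨hHm.trans_lt ofReal_lt_top⟩
  refine le_ofReal_of_forall_pos 1 fun τ hτ => ?_
  obtain ⟨γ, hγ, hγr, hγc⟩ :=
    exists_plan_le hr ((Measure.restrict_le_self univ).trans hHm) hb hτ h
  have hball : ∀ y ∉ Metric.ball z (R + r + s), Metric.ball y (s + r) ⊆ (Metric.ball z R)ᶜ := by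
    intro y hy x hx
    simp only [mem_compl_iff, Metric.mem_ball, not_lt] at hy hx ⊢
    have h2 := dist_triangle y x z
    rw [dist_comm y x] at h2
    linarith
  have hAc : (Metric.ball z (R + r + s))ᶜ ⊆ (Metric.ball z R)ᶜ :=
    compl_subset_compl.2 (Metric.ball_subset_ball (by linarith))
  refine (extCost_le_add_compl hk hk0 hpos hH measurableSet_ball hγ hr0 hη0 hγr hη ha0 hatop ha
    ((measure_mono hAc).trans hHa) fun y hy => (measure_mono (hball y hy)).trans hHa).trans ?_
  rw [← ofReal_measureReal (μ := H)]
  calc _ ≤ ENNReal.ofReal (b + τ)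
        + 2 * ENNReal.ofReal η * ENNReal.ofReal (H.real (Metric.ball z (R + r + s))ᶜ) := by gcongr
    _ = _ := by
      have h2 : 2 * ENNReal.ofReal η = ENNReal.ofReal (2 * η) := by
        rw [ENNReal.ofReal_mul zero_le_two, ENNReal.ofReal_ofNat]
      rw [h2,
        ← ENNReal.ofReal_mul (by positivity), ← ENNReal.ofReal_add (by positivity) (by positivity)]
      congr 1
      ring

/-- A nearly optimal `H` cannot split into two substantial parts separated by an almost empty
annulus. -/
theorem measure_compl_ball_le {k : Rd d → ℝ} (hk : Continuous k) (hk0 : k 0 = 0)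
    (hpos : ∀ x, 0 ≤ k x) {m r s η E κ ε a₀ a₁ R : ℝ} (hr : TruncatesAt k m r) (hr0 : 0 ≤ r)
    (hs0 : 0 ≤ s) (hη0 : 0 ≤ η)
    (hη : ∀ v w : Rd d, ‖v‖ ≤ r → ‖w‖ < s → k (v + w) ≤ k v + η)
    (hm : 0 < m) (hE0 : 0 ≤ E) (hκ0 : 0 < κ) (hκ : κ ≤ E / m)
    (hlin : ∀ m', 0 ≤ m' → m' ≤ m → ∀ F : Measure (Rd d), F ≤ volume →
      F univ = ENNReal.ofReal m' → extCost k F ≤ ENNReal.ofReal (m' / m * E))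
    (hsub : ∀ m', 0 ≤ m' → m' ≤ m / 2 → ∀ F : Measure (Rd d), F ≤ volume →
      F univ = ENNReal.ofReal m' → extCost k F ≤ ENNReal.ofReal (m' * (E / m - κ)))
    (ha₁ : 0 < a₁) (ha₁₀ : 2 * a₁ ≤ a₀) (ha₁κ : 8 * η * a₁ ≤ κ * a₀) (hε : 4 * ε < κ * a₀)
    (ha : 4 * ENNReal.ofReal a₁ ≤ volume (Metric.ball (0 : Rd d) s)) {H : Measure (Rd d)}
    [IsFiniteMeasure H] (hH : H ≤ volume) (hHm : H univ = ENNReal.ofReal m)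
    (hlow : ∀ X : ℝ, extCost k H ≤ ENNReal.ofReal X → E - ε ≤ X) {z : Rd d}
    (hz : 2 * a₀ ≤ H.real (Metric.ball z R))
    (hHa : H (Metric.ball z (R + 3 * r + s) \ Metric.ball z (R - r - s)) ≤ ENNReal.ofReal a₁) :
    H (Metric.ball z R)ᶜ ≤ ENNReal.ofReal a₀ := by
  set m₁ := H.real (Metric.ball z R)
  set m₂ := H.real (Metric.ball z (R + 2 * r))ᶜ
  have hm₁0 : 0 ≤ m₁ := measureReal_nonneg
  have hm₂0 : 0 ≤ m₂ := measureReal_nonneg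
  have hsum : m₁ + m₂ ≤ m := by
    have hd : Disjoint (Metric.ball z R) (Metric.ball z (R + 2 * r))ᶜ :=
      disjoint_compl_right_iff_subset.2 (Metric.ball_subset_ball (by linarith))
    rw [← measureReal_union hd measurableSet_ball.compl]
    refine (measureReal_mono (subset_univ _)).trans_eq ?_
    rw [Measure.real, hHm, ENNReal.toReal_ofReal hm.le]
  have hmass : ∀ S, H.restrict S univ = ENNReal.ofReal (H.real S) := fun S => by
    rw [Measure.restrict_apply_univ, ofReal_measureReal]
  have hle : ∀ S, H.restrict S ≤ volume := fun S => Measure.restrict_le_self.trans hH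
  have hann : ∀ {b₁ b₂ : ℝ}, 0 ≤ b₁ → 0 ≤ b₂ →
      extCost k (H.restrict (Metric.ball z R)) ≤ ENNReal.ofReal b₁ →
      extCost k (H.restrict (Metric.ball z (R + 2 * r))ᶜ) ≤ ENNReal.ofReal b₂ →
      E - ε ≤ b₁ + b₂ + 2 * η * a₁ := fun h₁ h₂ h₃ h₄ =>
    hlow _ (extCost_le_of_annulus hk hk0 hpos hr hr0 hs0 hη0 hη ha₁ ha hH
      hHm.le hHa h₁ h₂ h₃ h₄)
  have hm₂a : m₂ ≤ a₀ / 2 := by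
    by_contra! hcon
    have hEm : 0 ≤ E / m - κ := by linarith
    have h₁ : 0 ≤ m₁ / m * E := by positivity
    have h₂ : 0 ≤ m₂ / m * E := by positivity
    have hsE : m₁ / m * E + m₂ / m * E ≤ E := by
      rw [← add_mul, ← add_div]
      exact mul_le_of_le_one_left hE0 ((div_le_one hm).2 hsum)
    rcases le_total m₁ (m / 2) with h | h
    · have := hann (mul_nonneg hm₁0 hEm) h₂ (hsub _ hm₁0 h _ (hle _) (hmass _))
        (hlin _ hm₂0 (by linarith) _ (hle _) (hmass _))
      have e : m₁ * (E / m - κ) = m₁ / m * E - m₁ * κ := by ring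
      nlinarith
    · have := hann h₁ (mul_nonneg hm₂0 hEm) (hlin _ hm₁0 (by linarith) _ (hle _) (hmass _))
        (hsub _ hm₂0 (by linarith) _ (hle _) (hmass _))
      have e : m₂ * (E / m - κ) = m₂ / m * E - m₂ * κ := by ring
      nlinarith
  have hcover : (Metric.ball z R)ᶜ ⊆
      (Metric.ball z (R + 3 * r + s) \ Metric.ball z (R - r - s)) ∪
        (Metric.ball z (R + 2 * r))ᶜ := by
    intro x hx
    simp only [mem_compl_iff, Metric.mem_ball, not_lt, mem_union, Set.mem_sdiff] at hx ⊢
    rcases le_or_gt (R + 2 * r) (dist x z) with h | h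
    · exact Or.inr h
    · exact Or.inl ⟨by linarith, by linarith⟩
  calc H (Metric.ball z R)ᶜ ≤ ENNReal.ofReal a₁ + ENNReal.ofReal m₂ :=
        (measure_mono hcover).trans ((measure_union_le _ _).trans
          (add_le_add hHa (ofReal_measureReal).ge))
    _ = ENNReal.ofReal (a₁ + m₂) := (ENNReal.ofReal_add ha₁.le hm₂0).symm
    _ ≤ ENNReal.ofReal a₀ := ENNReal.ofReal_le_ofReal (by linarith)

/-- Nearly optimal measures concentrate on a ball of fixed radius. -/
theorem exists_radius_measureReal_compl_le (hd : 1 ≤ d) {k : Rd d → ℝ} (hpos : ∀ x, 0 ≤ k x)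
    (h1 : H1 k) (h3 : H3 k) {m : ℝ} (hm : 0 < m) {E : ℝ} (hE0 : 0 < E)
    (hE : Energy (transCost k) m = ENNReal.ofReal E) :
    ∃ Rstar εzero : ℝ, 0 < Rstar ∧ 0 < εzero ∧ ∀ ε : ℝ, 0 < ε → ε ≤ εzero →
      ∀ H : Measure (Rd d), H ≤ volume → H univ = ENNReal.ofReal m →
        ENNReal.ofReal E - ENNReal.ofReal ε ≤ extCost k H →
        ∃ z : Rd d, H.real (Metric.ball z Rstar)ᶜ ≤ 2 * m * ε / E := by
  have hk := h1.1
  obtain ⟨r, hr0, hr⟩ := exists_truncatesAt hd h1 hm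
  have hEF : ∀ F : Measure (Rd d), F ≤ volume → F univ = ENNReal.ofReal m →
      extCost k F ≤ ENNReal.ofReal E := fun F hF hFm =>
    (extCost_le_energy k hm.le hF hFm).trans_eq hE
  have hlin : ∀ m', 0 ≤ m' → m' ≤ m → ∀ F : Measure (Rd d), F ≤ volume →
      F univ = ENNReal.ofReal m' → extCost k F ≤ ENNReal.ofReal (m' / m * E) :=
    fun m' hm0 hmm F hF hFm => extCost_le_linear hd h1 h3 hpos hr hE0.le hEF hm hm0 hmm hF hFm
  obtain ⟨κ, hκ0, hκ, hsub⟩ := exists_extCost_le_sublinear hd h1 h3 hpos hr hE0 hEF hm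
  obtain ⟨η, hηdef⟩ : ∃ η, η = E / (4 * m) := ⟨_, rfl⟩
  have hη0 : 0 < η := by rw [hηdef]; positivity
  have hηm : 4 * (η * m) = E := by rw [hηdef]; field_simp
  obtain ⟨s, hs0, hη⟩ := exists_modulus hk r hη0
  obtain ⟨a₀, ha₀0, ha₀⟩ : ∃ a₀ : ℝ, 0 < a₀ ∧
      volume (Metric.ball (0 : Rd d) s) = ENNReal.ofReal (4 * a₀) := by
    have hpos := Metric.measure_ball_pos volume (0 : Rd d) hs0
    have htop : volume (Metric.ball (0 : Rd d) s) ≠ ⊤ := measure_ball_lt_top.ne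
    refine ⟨(volume (Metric.ball (0 : Rd d) s)).toReal / 4,
      div_pos (ENNReal.toReal_pos hpos.ne' htop) four_pos, ?_⟩
    rw [mul_div_cancel₀ _ four_ne_zero, ENNReal.ofReal_toReal htop]
  obtain ⟨a₁, ha₁0, ha₁₀, ha₁κ⟩ : ∃ a₁ : ℝ, 0 < a₁ ∧ 2 * a₁ ≤ a₀ ∧ 8 * η * a₁ ≤ κ * a₀ := by
    refine ⟨min (a₀ / 2) (κ * a₀ / (8 * η)), by positivity, ?_, ?_⟩
    · linarith [min_le_left (a₀ / 2) (κ * a₀ / (8 * η))]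
    · rw [mul_comm, ← le_div_iff₀ (by positivity)]
      exact min_le_right _ _
  have h4 : ∀ {a}, 0 ≤ a → a ≤ a₀ →
      4 * ENNReal.ofReal a ≤ volume (Metric.ball (0 : Rd d) s) := by
    intro a h0 h
    rw [ha₀, ENNReal.ofReal_mul zero_le_four, ENNReal.ofReal_ofNat]
    gcongr
  obtain ⟨N, hN⟩ := exists_nat_gt (m / a₁)
  rw [div_lt_iff₀ ha₁0] at hN
  set L := 4 * r + 2 * s with hL
  have hL0 : 0 ≤ L := by positivity
  refine ⟨s + N * L + r + s, min (κ * a₀ / 8) (E / 2), by positivity, by positivity, ?_⟩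
  intro ε hε0 hε H hH hHm hHE
  have hε1 : 4 * ε < κ * a₀ := by
    have : 0 < κ * a₀ := by positivity
    linarith [hε.trans (min_le_left _ _)]
  have hε2 : 2 * ε ≤ E := by linarith [hε.trans (min_le_right _ _)]
  have : IsFiniteMeasure H := ⟨by simp [hHm]⟩
  have hlow : ∀ X : ℝ, extCost k H ≤ ENNReal.ofReal X → E - ε ≤ X := by
    intro X hX
    rw [← ENNReal.ofReal_sub _ hε0.le] at hHE
    exact (ENNReal.ofReal_le_ofReal_iff'.1 (hHE.trans hX)).resolve_right (by linarith)
  obtain ⟨z, hz⟩ : ∃ z, 2 * a₀ ≤ H.real (Metric.ball z s) := by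
    by_contra! hcon
    have := extCost_le_of_ball_le hk hH (C := ENNReal.ofReal (2 * a₀)) (s := s) (η := η)
      (by simpa using ha₀0) ofReal_ne_top (fun y => by
        rw [← ofReal_measureReal (μ := H)]
        exact ENNReal.ofReal_le_ofReal (hcon y).le)
      (by
        rw [ha₀, ← ENNReal.ofReal_ofNat 2, ← ENNReal.ofReal_mul zero_le_two]
        exact ENNReal.ofReal_le_ofReal (by linarith))
      (fun w hw => by simpa [h1.2.1] using hη 0 w (by simpa using hr0.le) hw)
    rw [hHm, ← ENNReal.ofReal_mul hη0.le] at this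
    linarith [hlow _ this]
  obtain ⟨n, hnN, hn⟩ := exists_small_annulus H z s hL0 (N := N) (a := ENNReal.ofReal a₁) (by
    rw [hHm, ← ENNReal.ofReal_natCast, ← ENNReal.ofReal_mul (Nat.cast_nonneg N)]
    exact (ENNReal.ofReal_lt_ofReal_iff (hm.trans hN)).2 hN)
  have hnL : 0 ≤ n * L := by positivity
  have hcompl : H (Metric.ball z (s + n * L + r + s))ᶜ ≤ ENNReal.ofReal a₀ := by
    refine measure_compl_ball_le hk h1.2.1 hpos hr hr0.le hs0.le hη0.le hη hm hE0.le hκ0 hκ hlin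
      hsub ha₁0 ha₁₀ ha₁κ hε1 (h4 ha₁0.le (by linarith)) hH hHm hlow
      (hz.trans (measureReal_mono (Metric.ball_subset_ball (by linarith)))) ?_
    convert hn using 4 <;> rw [hL] <;> ring
  have hcompl' : H (Metric.ball z (s + N * L))ᶜ ≤ ENNReal.ofReal a₀ := by
    refine (measure_mono (compl_subset_compl.2 (Metric.ball_subset_ball ?_))).trans hcompl
    have : ((n : ℝ) + 1) * L ≤ N * L := by
      gcongr
      exact_mod_cast hnN
    linarith
  refine ⟨z, ?_⟩
  set B := Metric.ball z (s + N * L + r + s)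
  have hsplit : H.real B + H.real Bᶜ = m := by
    rw [measureReal_add_measureReal_compl measurableSet_ball, Measure.real, hHm,
      ENNReal.toReal_ofReal hm.le]
  have hδ0 : 0 ≤ H.real Bᶜ := measureReal_nonneg
  have hB0 : 0 ≤ H.real B := measureReal_nonneg
  have := hlow _ (extCost_le_of_ball hk h1.2.1 hpos hr hr0.le hs0.le hη0.le hη (by simpa using ha₀0)
    ofReal_ne_top (h4 ha₀0.le le_rfl) hH hHm.le hcompl'
    (b := H.real B / m * E) (by positivity)
    (hlin _ hB0 (by linarith) _ (Measure.restrict_le_self.trans hH)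
      (by rw [Measure.restrict_apply_univ, ofReal_measureReal])))
  change E - ε ≤ H.real B / m * E + 2 * η * H.real Bᶜ at this
  rw [eq_sub_of_add_eq hsplit, hηdef] at this
  rw [le_div_iff₀ hE0]
  field_simp at this
  nlinarith

end ExteriorTransport

/-- under (H1),(H2),(H3), for every `m > 0` there are `R_* > 0` and `ε₀ > 0` such
that for all `0 < ε ≤ ε₀` and all `f ∈ L¹(ℝ^d,[0,1])` with `∫ f = m` and `Υ(f) ≥ ℰ(m) − ε`,
up to a translation, `∫_{ℝ^d ∖ B_{R_*}(z)} f ≤ (2m/ℰ(m))·ε`. -/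
theorem stmt_19 {d : ℕ} (hd : 1 ≤ d) (k : Rd d → ℝ) (hpos : ∀ x, 0 ≤ k x)
    (h1 : H1 k) (h2 : H2 k) (h3 : H3 k) (m : ℝ) (hm : 0 < m) :
    ∃ Rstar εzero : ℝ, 0 < Rstar ∧ 0 < εzero ∧
      ∀ ε : ℝ, 0 < ε → ε ≤ εzero →
        ∀ f : Rd d → ℝ, InUnit f → (∫ x, f x) = m →
          Energy (transCost k) m - ENNReal.ofReal ε ≤ Ups (transCost k) f →
          ∃ z : Rd d,
            (∫⁻ x in (Metric.ball z Rstar)ᶜ, ENNReal.ofReal (f x)) ≤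
              ENNReal.ofReal (2 * m * ε) / Energy (transCost k) m := by
  obtain ⟨E, hE0, hE⟩ := ExteriorTransport.exists_energy_eq_ofReal hd h1 h3 hm
  obtain ⟨R, ε₀, hR, hε₀, h⟩ :=
    ExteriorTransport.exists_radius_measureReal_compl_le hd hpos h1 h3 hm hE0 hE
  refine ⟨R, ε₀, hR, hε₀, fun ε hε hεε f hf hfm hΥ => ?_⟩
  have hu : fMeas f univ = ENNReal.ofReal m := by rw [ExteriorTransport.fMeas_univ hf, hfm]
  have : IsFiniteMeasure (fMeas f) := ⟨by simp [hu]⟩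
  rw [hE, ExteriorTransport.ups_eq_extCost hf] at hΥ
  obtain ⟨z, hz⟩ := h ε hε hεε (fMeas f) (ExteriorTransport.fMeas_le_volume hf) hu hΥ
  refine ⟨z, ?_⟩
  rw [hE, ← ENNReal.ofReal_div_of_pos hE0, ← withDensity_apply _ measurableSet_ball.compl]
  exact (ofReal_measureReal (μ := fMeas f)).symm.le.trans (ENNReal.ofReal_le_ofReal hz)
end
end
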